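/- There exists an integer L ≥ 4 such that for every integer l ≥ L the following holds: there exist a constant a_l ∈ (0,1), nonzero real constants α_l and β_l, some s_l > 0, and for each s ∈ (−s_l, s_l) real-analytic 2π-periodic functions b_{l,s}, B_{l,s} : ℝ → ℝ with sup_θ |b_{l,s}(θ) − α_l cos(lθ)| → 0 and sup_θ |B_{l,s}(θ) − β_l cos(lθ)| → 0 as s → 0, such that for each s ∈ (−s_l, s_l) the doubly connected bounded domain Ω_{l,s} := {(r cos θ, r sin θ) : a_l + s·b_{l,s}(θ) < r < 1 + s·B_{l,s}(θ)} admits a real number μ_{l,s} and a nonconstant function u, twice continuously differentiable on the closure of Ω_{l,s}, satisfying Δu + μ_{l,s} u = 0 in Ω_{l,s} and ∇u = 0 at every point of ∂Ω_{l,s} (so u is a Neumann eigenfunction which is locally constant on the boundary); moreover, for s ≠ 0 the eigenfunction u is non-radial, i.e. u is not a function of |x| alone. -/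

import Mathlib

open Real Set MeasureTheory

noncomputable section

abbrev Pt := EuclideanSpace ℝ (Fin 2)

/-- The point of the plane with polar coordinates `(r, θ)`. -/
def polar (r θ : ℝ) : Pt := (WithLp.equiv 2 (Fin 2 → ℝ)).symm ![r * Real.cos θ, r * Real.sin θ]

/-- Partial derivative in the `i`-th coordinate direction. -/
def pd (i : Fin 2) (f : Pt → ℝ) (x : Pt) : ℝ := fderiv ℝ f x (EuclideanSpace.single i 1)

/-- The Laplacian of a function on the plane. -/
def lap (f : Pt → ℝ) (x : Pt) : ℝ := pd 0 (pd 0 f) x + pd 1 (pd 1 f) x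

set_option linter.unusedSectionVars false
set_option linter.unusedSimpArgs false
noncomputable section
namespace Schiffer

/-! ### The space of absolutely summable sequences -/

/-- absolutely summable sequences -/
def L1 (V : Type) [NormedAddCommGroup V] : Type := lp (fun _ : ℕ => V) 1

section L1
variable {V W Z : Type} [NormedAddCommGroup V] [NormedSpace ℝ V]
  [NormedAddCommGroup W] [NormedSpace ℝ W] [NormedAddCommGroup Z] [NormedSpace ℝ Z]

instance L1.instNACG : NormedAddCommGroup (L1 V) :=
  inferInstanceAs (NormedAddCommGroup (lp (fun _ : ℕ => V) 1))
instance L1.instNS : NormedSpace ℝ (L1 V) :=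
  inferInstanceAs (NormedSpace ℝ (lp (fun _ : ℕ => V) 1))
instance L1.instCS [CompleteSpace V] : CompleteSpace (L1 V) :=
  inferInstanceAs (CompleteSpace (lp (fun _ : ℕ => V) 1))
/-- coordinates of a sequence -/
def L1.fn (f : L1 V) : ℕ → V := Subtype.val f
instance L1.instCoe : CoeFun (L1 V) (fun _ => ℕ → V) := ⟨L1.fn⟩

@[ext] lemma L1.ext {f g : L1 V} (h : ∀ k, f k = g k) : f = g := Subtype.ext (funext h)
@[simp] lemma L1.add_apply (f g : L1 V) (k : ℕ) : (f + g) k = f k + g k := rfl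
@[simp] lemma L1.sub_apply (f g : L1 V) (k : ℕ) : (f - g) k = f k - g k := rfl
@[simp] lemma L1.neg_apply (f : L1 V) (k : ℕ) : (-f) k = - f k := rfl
@[simp] lemma L1.smul_apply (c : ℝ) (f : L1 V) (k : ℕ) : (c • f) k = c • f k := rfl
@[simp] lemma L1.zero_apply (k : ℕ) : (0 : L1 V) k = 0 := rfl

lemma L1.summable (f : L1 V) : Summable fun k => ‖f k‖ := by
  have h := (lp.memℓp (E := fun _ : ℕ => V) (p := 1) f)
  rw [memℓp_gen_iff (by norm_num)] at h
  simp only [ENNReal.toReal_one, Real.rpow_one] at h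
  exact h

lemma L1.norm_eq (f : L1 V) : ‖f‖ = ∑' k, ‖f k‖ := by
  have := lp.norm_eq_tsum_rpow (E := fun _ : ℕ => V) (p := 1) (by norm_num) f
  simp only [ENNReal.toReal_one, Real.rpow_one, div_one] at this
  exact this

def L1.mk (f : ℕ → V) (h : Summable fun k => ‖f k‖) : L1 V :=
  (⟨f, by
    have : Memℓp f 1 := by
      rw [memℓp_gen_iff (by norm_num)]
      simpa using h
    exact this⟩ : lp (fun _ : ℕ => V) 1)

@[simp] lemma L1.mk_apply (f : ℕ → V) (h : Summable fun k => ‖f k‖) (k : ℕ) :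
    L1.mk f h k = f k := rfl

lemma L1.norm_apply_le (f : L1 V) (k : ℕ) : ‖f k‖ ≤ ‖f‖ := by
  rw [L1.norm_eq]
  exact (L1.summable f).le_tsum k (fun _ _ => norm_nonneg _)

/-- coordinate -/
def coord (k : ℕ) : L1 V →L[ℝ] V :=
  LinearMap.mkContinuous
    { toFun := fun f => f k
      map_add' := fun _ _ => rfl
      map_smul' := fun _ _ => rfl } 1 (fun f => by rw [one_mul]; exact L1.norm_apply_le f k)

@[simp] lemma coord_apply (k : ℕ) (f : L1 V) : coord k f = f k := rfl

/-- A bounded family of operators acts diagonally. -/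
def diag (T : ℕ → V →L[ℝ] W) (C : ℝ) (hT : ∀ k, ‖T k‖ ≤ C) : L1 V →L[ℝ] L1 W :=
  have hs : ∀ f : L1 V, Summable fun k => ‖T k (f k)‖ := fun f =>
    Summable.of_nonneg_of_le (fun _ => norm_nonneg _)
      (fun k => (T k).le_of_opNorm_le (hT k) (f k)) ((L1.summable f).mul_left C)
  LinearMap.mkContinuous
    { toFun := fun f => L1.mk (fun k => T k (f k)) (hs f)
      map_add' := fun f g => by ext k; simp
      map_smul' := fun c f => by ext k; simp } C (fun f => by
        simp only [LinearMap.coe_mk, AddHom.coe_mk, L1.norm_eq, L1.mk_apply]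
        rw [← tsum_mul_left]
        exact (hs f).tsum_le_tsum (fun k => (T k).le_of_opNorm_le (hT k) (f k))
          ((L1.summable f).mul_left C))

@[simp] lemma diag_apply (T : ℕ → V →L[ℝ] W) (C : ℝ) (hT : ∀ k, ‖T k‖ ≤ C) (f : L1 V) (k : ℕ) :
    diag T C hT f k = T k (f k) := rfl

lemma diag_norm_le (T : ℕ → V →L[ℝ] W) (C : ℝ) (hT : ∀ k, ‖T k‖ ≤ C) (hC : 0 ≤ C) :
    ‖diag T C hT‖ ≤ C := by
  unfold diag
  exact LinearMap.mkContinuous_norm_le _ hC _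

/-- A bounded family of operators into a fixed Banach space. -/
def lift [CompleteSpace W] (T : ℕ → V →L[ℝ] W) (C : ℝ) (hT : ∀ k, ‖T k‖ ≤ C) : L1 V →L[ℝ] W :=
  have hs : ∀ f : L1 V, Summable fun k => ‖T k (f k)‖ := fun f =>
    Summable.of_nonneg_of_le (fun _ => norm_nonneg _)
      (fun k => (T k).le_of_opNorm_le (hT k) (f k)) ((L1.summable f).mul_left C)
  LinearMap.mkContinuous
    { toFun := fun f => ∑' k, T k (f k)
      map_add' := fun f g => by
        rw [← Summable.tsum_add (hs f).of_norm (hs g).of_norm]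
        simp
      map_smul' := fun c f => by
        simp only [L1.smul_apply, map_smul, RingHom.id_apply]
        rw [tsum_const_smul'' c] } C (fun f => by
        simp only [LinearMap.coe_mk, AddHom.coe_mk, L1.norm_eq]
        rw [← tsum_mul_left]
        exact (norm_tsum_le_tsum_norm (hs f)).trans
          ((hs f).tsum_le_tsum (fun k => (T k).le_of_opNorm_le (hT k) (f k))
          ((L1.summable f).mul_left C)))

lemma lift_apply [CompleteSpace W] (T : ℕ → V →L[ℝ] W) (C : ℝ) (hT : ∀ k, ‖T k‖ ≤ C) (f : L1 V) :
    lift T C hT f = ∑' k, T k (f k) := rfl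

/-- single -/
def sgl (k : ℕ) : V →L[ℝ] L1 V :=
  have hs : ∀ v : V, HasSum (fun j => ‖(if j = k then v else 0 : V)‖) ‖v‖ := fun v => by
    convert hasSum_ite_eq k ‖v‖ using 2 with j
    split_ifs <;> simp
  LinearMap.mkContinuous
    { toFun := fun v => L1.mk (fun j => if j = k then v else 0) (hs v).summable
      map_add' := fun f g => by ext j; simp; split_ifs <;> simp
      map_smul' := fun c f => by ext j; simp } 1 (fun f => by
        simp only [LinearMap.coe_mk, AddHom.coe_mk, L1.norm_eq, L1.mk_apply]
        rw [(hs f).tsum_eq]; simp)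

lemma sgl_apply (k : ℕ) (v : V) (j : ℕ) : sgl k v j = if j = k then v else 0 := rfl

@[simp] lemma sgl_self (k : ℕ) (v : V) : sgl k v k = v := by simp [sgl_apply]

lemma sgl_norm_le (k : ℕ) (v : V) : ‖sgl k v‖ ≤ ‖v‖ := by
  have h : HasSum (fun j => ‖sgl k v j‖) ‖v‖ := by
    convert hasSum_ite_eq k ‖v‖ using 2 with j
    rw [sgl_apply]
    split_ifs <;> simp
  rw [L1.norm_eq, h.tsum_eq]

/-- shift by two -/
def sh : L1 V →L[ℝ] L1 V :=
  have hs : ∀ f : L1 V, HasSum (fun j => ‖(if j < 2 then 0 else f (j-2) : V)‖) ‖f‖ := fun f => by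
    rw [L1.norm_eq, ← hasSum_nat_add_iff' 2]
    simpa [Finset.sum_range_succ] using (L1.summable f).hasSum
  LinearMap.mkContinuous
    { toFun := fun f => L1.mk (fun j => if j < 2 then 0 else f (j-2)) (hs f).summable
      map_add' := fun f g => by ext j; simp; split_ifs <;> simp
      map_smul' := fun c f => by ext j; simp } 1 (fun f => by
        simp only [LinearMap.coe_mk, AddHom.coe_mk]
        rw [L1.norm_eq]
        simp only [L1.mk_apply]
        rw [(hs f).tsum_eq]; simp)

@[simp] lemma sh_apply_zero (f : L1 V) : sh f 0 = 0 := rfl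
@[simp] lemma sh_apply_one (f : L1 V) : sh f 1 = 0 := rfl
@[simp] lemma sh_apply_add (f : L1 V) (k : ℕ) : sh f (k+2) = f k := rfl

/-- drop the first two -/
def dr : L1 V →L[ℝ] L1 V :=
  have hs : ∀ f : L1 V, Summable (fun j => ‖f (j+2)‖) := fun f =>
    (summable_nat_add_iff 2).2 (L1.summable f)
  LinearMap.mkContinuous
    { toFun := fun f => L1.mk (fun j => f (j+2)) (hs f)
      map_add' := fun f g => by ext j; simp
      map_smul' := fun c f => by ext j; simp } 1 (fun f => by
        simp only [LinearMap.coe_mk, AddHom.coe_mk, L1.norm_eq, L1.mk_apply]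
        rw [one_mul, ← (L1.summable f).sum_add_tsum_nat_add 2]
        have : 0 ≤ ∑ i ∈ Finset.range 2, ‖f i‖ := Finset.sum_nonneg (fun _ _ => norm_nonneg _)
        linarith)

@[simp] lemma dr_apply (f : L1 V) (k : ℕ) : dr f k = f (k+2) := rfl

end L1

/-! ### Bilinear products -/
section Bil
variable {A : Type} [NormedCommRing A] [NormedAlgebra ℝ A] [CompleteSpace A]

lemma bil_summable (φ : ℕ → ℕ → ℕ) (c : ℕ → ℕ → ℝ) (hc : ∀ i j, |c i j| ≤ 1) (f g : L1 A) :
    Summable fun p : ℕ × ℕ => ‖sgl (φ p.1 p.2) (c p.1 p.2 • (f p.1 * g p.2))‖ := by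
  refine Summable.of_nonneg_of_le (fun _ => norm_nonneg _) (fun p => ?_)
    ((L1.summable f).mul_of_nonneg (L1.summable g) (fun _ => norm_nonneg _) (fun _ => norm_nonneg _))
  refine (sgl_norm_le _ _).trans ?_
  rw [norm_smul]
  calc ‖c p.1 p.2‖ * ‖f p.1 * g p.2‖ ≤ 1 * (‖f p.1‖ * ‖g p.2‖) := by
        gcongr
        · exact hc _ _
        · exact norm_mul_le _ _
    _ = _ := one_mul _

def bil (φ : ℕ → ℕ → ℕ) (c : ℕ → ℕ → ℝ) (hc : ∀ i j, |c i j| ≤ 1) :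
    L1 A →L[ℝ] L1 A →L[ℝ] L1 A :=
  LinearMap.mkContinuous₂
    (LinearMap.mk₂ ℝ (fun f g => ∑' p : ℕ × ℕ, sgl (φ p.1 p.2) (c p.1 p.2 • (f p.1 * g p.2)))
      (fun f f' g => by
        rw [← Summable.tsum_add (bil_summable φ c hc f g).of_norm (bil_summable φ c hc f' g).of_norm]
        refine tsum_congr fun p => ?_
        rw [← map_add]; simp [add_mul])
      (fun a f g => by
        rw [← tsum_const_smul'' a]
        refine tsum_congr fun p => ?_
        rw [← map_smul]; simp [smul_comm a])
      (fun f g g' => by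
        rw [← Summable.tsum_add (bil_summable φ c hc f g).of_norm (bil_summable φ c hc f g').of_norm]
        refine tsum_congr fun p => ?_
        rw [← map_add]; simp [mul_add])
      (fun a f g => by
        rw [← tsum_const_smul'' a]
        refine tsum_congr fun p => ?_
        rw [← map_smul]; simp [smul_comm a])) 1 (fun f g => by
        simp only [LinearMap.mk₂_apply]
        refine (norm_tsum_le_tsum_norm (bil_summable φ c hc f g)).trans ?_
        have h1 := ((L1.summable f).mul_of_nonneg (L1.summable g) (fun _ => norm_nonneg _)
          (fun _ => norm_nonneg _))
        rw [one_mul, L1.norm_eq f, L1.norm_eq g,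
          (L1.summable f).tsum_mul_tsum (L1.summable g) h1]
        refine (bil_summable φ c hc f g).tsum_le_tsum (fun p => ?_) h1
        refine (sgl_norm_le _ _).trans ?_
        rw [norm_smul]
        calc ‖c p.1 p.2‖ * ‖f p.1 * g p.2‖ ≤ 1 * (‖f p.1‖ * ‖g p.2‖) := by
              gcongr
              · exact hc _ _
              · exact norm_mul_le _ _
          _ = _ := one_mul _)

lemma bil_apply (φ : ℕ → ℕ → ℕ) (c : ℕ → ℕ → ℝ) (hc : ∀ i j, |c i j| ≤ 1) (f g : L1 A) :
    bil φ c hc f g = ∑' p : ℕ × ℕ, sgl (φ p.1 p.2) (c p.1 p.2 • (f p.1 * g p.2)) := rfl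

lemma bil_hasSum {Z : Type} [NormedAddCommGroup Z] [NormedSpace ℝ Z]
    (φ : ℕ → ℕ → ℕ) (c : ℕ → ℕ → ℝ) (hc : ∀ i j, |c i j| ≤ 1) (f g : L1 A) (T : L1 A →L[ℝ] Z) :
    HasSum (fun p : ℕ × ℕ => T (sgl (φ p.1 p.2) (c p.1 p.2 • (f p.1 * g p.2))))
      (T (bil φ c hc f g)) :=
  T.hasSum (bil_summable φ c hc f g).of_norm.hasSum

/-- `M₊` -/
def Mp : L1 A →L[ℝ] L1 A →L[ℝ] L1 A := bil (fun i j => i + j) (fun _ _ => 1) (by simp)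

lemma quarter_le (n : ℕ) : |(1/4:ℝ)^n| ≤ 1 := by
  rw [abs_of_nonneg (by positivity)]
  exact pow_le_one₀ (by norm_num) (by norm_num)

/-- `M₋` -/
def Mm : L1 A →L[ℝ] L1 A →L[ℝ] L1 A :=
  bil (fun i j => i - j + (j - i)) (fun i j => (1/4:ℝ)^(min i j)) (fun _ _ => quarter_le _)

lemma bil_sgl (φ : ℕ → ℕ → ℕ) (c : ℕ → ℕ → ℝ) (hc : ∀ i j, |c i j| ≤ 1) (i j : ℕ) (u v : A) :
    bil φ c hc (sgl i u) (sgl j v) = sgl (φ i j) (c i j • (u * v)) := by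
  rw [bil_apply, tsum_eq_single (i, j)]
  · simp
  · rintro ⟨i', j'⟩ h
    simp only [sgl_apply]
    by_cases h1 : i' = i
    · by_cases h2 : j' = j
      · subst h1 h2; simp at h
      · simp [h2]
    · simp [h1]

/-- modewise multiplication -/
def ml (u : A) (f : L1 A) : L1 A := Mp (sgl 0 u) f

lemma ml_apply (u : A) (f : L1 A) (k : ℕ) : ml u f k = u * f k := by
  have h := bil_hasSum (fun i j => i + j) (fun _ _ => 1) (by simp) (sgl 0 u) f (coord k)
  have h2 : HasSum (fun p : ℕ × ℕ => coord k (sgl (p.1 + p.2) ((1:ℝ) • (sgl 0 u p.1 * f p.2))))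
      (u * f k) := by
    convert hasSum_ite_eq ((0, k) : ℕ × ℕ) (u * f k) using 2 with p
    obtain ⟨i, j⟩ := p
    simp only [coord_apply, sgl_apply, Prod.mk.injEq, one_smul]
    by_cases hi : i = 0
    · subst hi
      by_cases hj : j = k
      · simp [hj]
      · simp [hj, Ne.symm hj]
    · simp [hi]
  exact h.unique h2

end Bil
end Schiffer
end

set_option linter.unusedSectionVars false
set_option linter.unusedSimpArgs false
noncomputable section
namespace Schiffer

abbrev X := C(Set.Icc (0:ℝ) π, ℝ)

/-- cosine evaluation -/
def evc (x : Set.Icc (0:ℝ) π) (Y : ℝ) : L1 X →L[ℝ] ℝ :=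
  lift (fun k => ((1/2:ℝ)^k * Real.cos (k*Y)) • ContinuousMap.evalCLM ℝ x) 1 (fun k => by
    refine ContinuousLinearMap.opNorm_le_bound _ zero_le_one (fun f => ?_)
    simp only [_root_.smul_apply, ContinuousMap.evalCLM_apply, norm_smul]
    refine mul_le_mul ?_ (f.norm_coe_le_norm x) (norm_nonneg _) zero_le_one
    rw [norm_mul, Real.norm_eq_abs, Real.norm_eq_abs, abs_of_nonneg (by positivity)]
    exact mul_le_one₀ (pow_le_one₀ (by norm_num) (by norm_num)) (abs_nonneg _) (abs_cos_le_one _))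

/-- sine evaluation -/
def evs (x : Set.Icc (0:ℝ) π) (Y : ℝ) : L1 X →L[ℝ] ℝ :=
  lift (fun k => ((1/2:ℝ)^k * Real.sin (k*Y)) • ContinuousMap.evalCLM ℝ x) 1 (fun k => by
    refine ContinuousLinearMap.opNorm_le_bound _ zero_le_one (fun f => ?_)
    simp only [_root_.smul_apply, ContinuousMap.evalCLM_apply, norm_smul]
    refine mul_le_mul ?_ (f.norm_coe_le_norm x) (norm_nonneg _) zero_le_one
    rw [norm_mul, Real.norm_eq_abs, Real.norm_eq_abs, abs_of_nonneg (by positivity)]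
    exact mul_le_one₀ (pow_le_one₀ (by norm_num) (by norm_num)) (abs_nonneg _) (abs_sin_le_one _))

lemma evc_apply (x : Set.Icc (0:ℝ) π) (Y : ℝ) (f : L1 X) :
    evc x Y f = ∑' k : ℕ, ((1/2:ℝ)^k * Real.cos (k*Y)) * f k x := rfl

lemma evs_apply (x : Set.Icc (0:ℝ) π) (Y : ℝ) (f : L1 X) :
    evs x Y f = ∑' k : ℕ, ((1/2:ℝ)^k * Real.sin (k*Y)) * f k x := rfl

lemma ev_summable (x : Set.Icc (0:ℝ) π) (f : L1 X) (c : ℕ → ℝ) (hc : ∀ k, |c k| ≤ 1) :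
    Summable fun k : ℕ => ‖((1/2:ℝ)^k * c k) * f k x‖ := by
  refine Summable.of_nonneg_of_le (fun _ => norm_nonneg _) (fun k => ?_) (L1.summable f)
  rw [norm_mul, norm_mul, Real.norm_eq_abs, Real.norm_eq_abs, abs_of_nonneg (by positivity)]
  calc (1/2:ℝ)^k * |c k| * ‖f k x‖ ≤ 1 * ‖f k‖ := by
        gcongr
        · exact mul_le_one₀ (pow_le_one₀ (by norm_num) (by norm_num)) (abs_nonneg _) (hc k)
        · exact (f k).norm_coe_le_norm x
    _ = _ := one_mul _

lemma evc_sgl (x : Set.Icc (0:ℝ) π) (Y : ℝ) (k : ℕ) (v : X) :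
    evc x Y (sgl k v) = ((1/2:ℝ)^k * Real.cos (k*Y)) * v x := by
  rw [evc_apply, tsum_eq_single k]
  · simp
  · intro j hj; simp [sgl_apply, hj]

lemma ev_prod (x : Set.Icc (0:ℝ) π) (f g : L1 X) (c d : ℕ → ℝ) (hc : ∀ k, |c k| ≤ 1)
    (hd : ∀ k, |d k| ≤ 1) :
    HasSum (fun p : ℕ × ℕ => (((1/2:ℝ)^p.1 * c p.1) * f p.1 x) * (((1/2:ℝ)^p.2 * d p.2) * g p.2 x))
      ((∑' k : ℕ, ((1/2:ℝ)^k * c k) * f k x) * (∑' k : ℕ, ((1/2:ℝ)^k * d k) * g k x)) := by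
  have h1 := ev_summable x f c hc
  have h2 := ev_summable x g d hd
  rw [tsum_mul_tsum_of_summable_norm h1 h2]
  exact (summable_mul_of_summable_norm h1 h2).hasSum

lemma evc_Mp (x : Set.Icc (0:ℝ) π) (Y : ℝ) (f g : L1 X) :
    evc x Y (Mp f g) = evc x Y f * evc x Y g - evs x Y f * evs x Y g := by
  have h := bil_hasSum (fun i j => i + j) (fun _ _ => 1) (by simp) f g (evc x Y)
  have hc := ev_prod x f g (fun k => Real.cos (k*Y)) (fun k => Real.cos (k*Y))
    (fun _ => abs_cos_le_one _) (fun _ => abs_cos_le_one _)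
  have hs := ev_prod x f g (fun k => Real.sin (k*Y)) (fun k => Real.sin (k*Y))
    (fun _ => abs_sin_le_one _) (fun _ => abs_sin_le_one _)
  refine h.unique ?_
  have e : (fun p : ℕ × ℕ => evc x Y (sgl (p.1 + p.2) ((1:ℝ) • (f p.1 * g p.2)))) = fun p : ℕ × ℕ =>
      (((1/2:ℝ)^p.1 * Real.cos (p.1*Y)) * f p.1 x) * (((1/2:ℝ)^p.2 * Real.cos (p.2*Y)) * g p.2 x) -
      (((1/2:ℝ)^p.1 * Real.sin (p.1*Y)) * f p.1 x) * (((1/2:ℝ)^p.2 * Real.sin (p.2*Y)) * g p.2 x) := by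
    funext p
    rw [evc_sgl, one_smul]
    push_cast
    rw [add_mul, Real.cos_add, pow_add]
    change _ * (f p.1 x * g p.2 x) = _
    ring
  rw [e]
  exact hc.sub hs

lemma evc_Mm (x : Set.Icc (0:ℝ) π) (Y : ℝ) (f g : L1 X) :
    evc x Y (Mm f g) = evc x Y f * evc x Y g + evs x Y f * evs x Y g := by
  have h := bil_hasSum (fun i j => i - j + (j - i)) (fun i j => (1/4:ℝ)^(min i j))
    (fun _ _ => quarter_le _) f g (evc x Y)
  have hc := ev_prod x f g (fun k => Real.cos (k*Y)) (fun k => Real.cos (k*Y))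
    (fun _ => abs_cos_le_one _) (fun _ => abs_cos_le_one _)
  have hs := ev_prod x f g (fun k => Real.sin (k*Y)) (fun k => Real.sin (k*Y))
    (fun _ => abs_sin_le_one _) (fun _ => abs_sin_le_one _)
  refine h.unique ?_
  have e : (fun p : ℕ × ℕ => evc x Y (sgl (p.1 - p.2 + (p.2 - p.1)) ((1/4:ℝ)^(min p.1 p.2) • (f p.1 * g p.2)))) = fun p : ℕ × ℕ =>
      (((1/2:ℝ)^p.1 * Real.cos (p.1*Y)) * f p.1 x) * (((1/2:ℝ)^p.2 * Real.cos (p.2*Y)) * g p.2 x) +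
      (((1/2:ℝ)^p.1 * Real.sin (p.1*Y)) * f p.1 x) * (((1/2:ℝ)^p.2 * Real.sin (p.2*Y)) * g p.2 x) := ?_
  · rw [e]
    exact hc.add hs
  funext ⟨i, j⟩
  rw [evc_sgl]
  have key : (1/2:ℝ)^(i - j + (j - i)) * (1/4)^(min i j) = (1/2)^i * (1/2)^j := by
    rw [show (1/4:ℝ) = (1/2)^2 by norm_num, ← pow_mul, ← pow_add, ← pow_add]
    congr 1
    omega
  have key2 : Real.cos (((i - j + (j - i) : ℕ):ℝ) * Y) = Real.cos (i*Y) * Real.cos (j*Y)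
      + Real.sin (i*Y) * Real.sin (j*Y) := by
    rw [← Real.cos_sub]
    rcases le_total i j with h | h
    · rw [Nat.sub_eq_zero_of_le h, zero_add, Nat.cast_sub h, ← Real.cos_neg]
      congr 1; ring
    · rw [Nat.sub_eq_zero_of_le h, add_zero, Nat.cast_sub h]
      congr 1; ring
  change ((1/2:ℝ)^(i - j + (j - i)) * Real.cos (((i - j + (j - i) : ℕ):ℝ) * Y)) *
    ((1/4:ℝ)^(min i j) * (f i x * g j x)) = _
  rw [key2]
  linear_combination (Real.cos (i*Y) * Real.cos (j*Y) + Real.sin (i*Y) * Real.sin (j*Y)) *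
    (f i x * g j x) * key

/-! ### Operators on `X` -/

/-- extension to the line by clamping -/
def ext (f : X) : ℝ → ℝ := Set.IccExtend pi_pos.le f

lemma ext_continuous (f : X) : Continuous (ext f) := f.continuous.Icc_extend'

lemma ext_of_mem (f : X) {x : ℝ} (hx : x ∈ Set.Icc (0:ℝ) π) : ext f x = f ⟨x, hx⟩ :=
  Set.IccExtend_of_mem _ _ hx

lemma ext_coe (f : X) (x : Set.Icc (0:ℝ) π) : ext f x = f x := ext_of_mem f x.2

lemma ext_abs_le (f : X) (x : ℝ) : |ext f x| ≤ ‖f‖ := f.norm_coe_le_norm _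

/-- primitive on the line -/
def pr (f : X) (x : ℝ) : ℝ := ∫ t in (0:ℝ)..x, ext f t

lemma pr_hasDerivAt (f : X) (x : ℝ) : HasDerivAt (pr f) (ext f x) x :=
  intervalIntegral.integral_hasDerivAt_right ((ext_continuous f).intervalIntegrable _ _)
    ((ext_continuous f).stronglyMeasurableAtFilter _ _) (ext_continuous f).continuousAt

lemma pr_continuous (f : X) : Continuous (pr f) :=
  continuous_iff_continuousAt.2 fun x => (pr_hasDerivAt f x).continuousAt

@[simp] lemma pr_zero (f : X) : pr f 0 = 0 := by simp [pr]

lemma pr_abs_le (f : X) (x : ℝ) : |pr f x| ≤ ‖f‖ * |x| := by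
  have := intervalIntegral.norm_integral_le_of_norm_le_const (a := 0) (b := x) (f := ext f)
    (C := ‖f‖) (fun t _ => ext_abs_le f t)
  simpa [pr] using this

/-- primitive operator -/
def P : X →L[ℝ] X :=
  LinearMap.mkContinuous
    { toFun := fun f => ⟨fun x => pr f x, (pr_continuous f).comp continuous_subtype_val⟩
      map_add' := fun f g => by
        ext x
        simp only [ContinuousMap.coe_mk, ContinuousMap.add_apply, pr]
        rw [← intervalIntegral.integral_add ((ext_continuous f).intervalIntegrable _ _)
          ((ext_continuous g).intervalIntegrable _ _)]
        rfl
      map_smul' := fun c f => by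
        ext x
        simp only [ContinuousMap.coe_mk, ContinuousMap.smul_apply, pr, RingHom.id_apply, smul_eq_mul]
        rw [← intervalIntegral.integral_const_mul]
        rfl } π (fun f => by
      rw [ContinuousMap.norm_le _ (by positivity)]
      intro x
      refine (pr_abs_le f x).trans ?_
      rw [mul_comm, abs_of_nonneg x.2.1]
      exact mul_le_mul_of_nonneg_right x.2.2 (norm_nonneg _))

lemma P_apply (f : X) (x : Set.Icc (0:ℝ) π) : P f x = pr f x := rfl

def ptπ : Set.Icc (0:ℝ) π := ⟨π, pi_pos.le, le_rfl⟩
def pt0 : Set.Icc (0:ℝ) π := ⟨0, le_rfl, pi_pos.le⟩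

def V : X →L[ℝ] X := P.comp P
/-- total integral -/
def I0 : X →L[ℝ] ℝ := (ContinuousMap.evalCLM ℝ ptπ).comp P
/-- `∫ (π - x) f` -/
def I1 : X →L[ℝ] ℝ := (ContinuousMap.evalCLM ℝ ptπ).comp V

lemma I0_eq (f : X) : I0 f = pr f π := rfl
lemma V_eq (f : X) : V f = P (P f) := rfl
lemma I1_eq (f : X) : I1 f = V f ptπ := rfl

/-- If `F' = f` on the interval then `P f = F - F 0`. -/
lemma pr_eq_of_deriv (f : X) (F : ℝ → ℝ) (hF : ∀ x ∈ Set.Icc (0:ℝ) π, HasDerivAt F (ext f x) x)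
    {x : ℝ} (hx : x ∈ Set.Icc (0:ℝ) π) : pr f x = F x - F 0 := by
  unfold pr
  refine intervalIntegral.integral_eq_sub_of_hasDerivAt (fun t ht => hF t ?_)
    ((ext_continuous f).intervalIntegrable _ _)
  rw [uIcc_of_le hx.1] at ht
  exact ⟨ht.1, ht.2.trans hx.2⟩

lemma I0_eq_of_deriv (f : X) (F : ℝ → ℝ) (hF : ∀ x ∈ Set.Icc (0:ℝ) π, HasDerivAt F (ext f x) x) :
    I0 f = F π - F 0 := pr_eq_of_deriv f F hF ⟨pi_pos.le, le_rfl⟩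

lemma I0_abs_le_of (f g : X) (h : ∀ x, |f x| ≤ g x) : |I0 f| ≤ I0 g := by
  rw [I0_eq, I0_eq, pr, pr]
  have := intervalIntegral.norm_integral_le_of_norm_le (a := 0) (b := π) (f := ext f) (g := ext g)
    (μ := volume) pi_pos.le (Filter.Eventually.of_forall fun t _ => h _)
    ((ext_continuous g).intervalIntegrable _ _)
  simpa using this

/-- pointwise function as an element of `X` -/
def mkX (f : ℝ → ℝ) (hf : Continuous f) : X := ⟨fun x => f x, hf.comp continuous_subtype_val⟩

@[simp] lemma mkX_apply (f : ℝ → ℝ) (hf : Continuous f) (x : Set.Icc (0:ℝ) π) :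
    mkX f hf x = f x := rfl

lemma ext_mkX (f : ℝ → ℝ) (hf : Continuous f) {x : ℝ} (hx : x ∈ Set.Icc (0:ℝ) π) :
    ext (mkX f hf) x = f x := by rw [ext_of_mem _ hx]; rfl

lemma ext_mul (f g : X) (x : ℝ) : ext (f * g) x = ext f x * ext g x := rfl
lemma ext_add (f g : X) (x : ℝ) : ext (f + g) x = ext f x + ext g x := rfl
lemma ext_sub (f g : X) (x : ℝ) : ext (f - g) x = ext f x - ext g x := rfl
lemma ext_smul (c : ℝ) (g : X) (x : ℝ) : ext (c • g) x = c * ext g x := rfl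

/-- identity function -/
def xi : X := mkX (fun x => x) continuous_id

/-- exponentials -/
def ex (c : ℝ) : X := mkX (fun x => Real.exp (c * x)) (by fun_prop)
def exd (c : ℝ) : X := mkX (fun x => Real.exp (c * (π - x))) (by fun_prop)

lemma ex_apply (c : ℝ) (x : Set.Icc (0:ℝ) π) : ex c x = Real.exp (c * x) := rfl
lemma exd_apply (c : ℝ) (x : Set.Icc (0:ℝ) π) : exd c x = Real.exp (c * (π - x)) := rfl

lemma exp_eval (f : X) (x : Set.Icc (0:ℝ) π) : NormedSpace.exp f x = Real.exp (f x) := by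
  have h := NormedSpace.map_exp (ContinuousMap.evalStarAlgHom ℝ ℝ x : X →⋆ₐ[ℝ] ℝ)
    (ContinuousMap.evalCLM ℝ x : X →L[ℝ] ℝ).continuous f
  rw [Real.exp_eq_exp_ℝ]
  exact h

lemma ex_eq (c : ℝ) : ex c = NormedSpace.exp (c • xi) := by
  ext x; rw [exp_eval]; rfl

lemma exd_eq (c : ℝ) : exd c = NormedSpace.exp (c • (π • (1:X) - xi)) := by
  ext x; rw [exp_eval, exd_apply]; simp [xi]

lemma expX_contDiff : ContDiff ℝ 1 (NormedSpace.exp : X → X) := by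
  rw [contDiff_iff_contDiffAt]
  intro f
  exact (NormedSpace.exp_analytic (𝕂 := ℝ) f).contDiffAt

lemma ex_contDiff : ContDiff ℝ 1 ex := by
  have : ex = fun c => NormedSpace.exp (c • xi) := funext ex_eq
  rw [this]
  exact expX_contDiff.comp (by fun_prop)

lemma exd_contDiff : ContDiff ℝ 1 exd := by
  have : exd = fun c => NormedSpace.exp (c • (π • (1:X) - xi)) := funext exd_eq
  rw [this]
  exact expX_contDiff.comp (by fun_prop)

lemma ex_hasDerivAt (c : ℝ) : HasDerivAt ex (xi * ex c) c := by
  have h := (ex_contDiff.differentiable (by norm_num) c).hasDerivAt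
  suffices e : xi * ex c = deriv ex c by rw [e]; exact h
  refine ContinuousMap.ext fun x => ?_
  have h2 := ((ContinuousMap.evalCLM ℝ x : X →L[ℝ] ℝ).hasFDerivAt.comp_hasDerivAt c h)
  have h3 : HasDerivAt (fun c => Real.exp (c * (x:ℝ))) (Real.exp (c * x) * (1 * x)) c :=
    ((hasDerivAt_id c).mul_const (x:ℝ)).exp
  have := h3.unique h2
  refine Eq.trans ?_ this
  change (x:ℝ) * Real.exp (c * x) = _
  ring

lemma exd_hasDerivAt (c : ℝ) : HasDerivAt exd ((π • (1:X) - xi) * exd c) c := by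
  have h := (exd_contDiff.differentiable (by norm_num) c).hasDerivAt
  suffices e : (π • (1:X) - xi) * exd c = deriv exd c by rw [e]; exact h
  refine ContinuousMap.ext fun x => ?_
  have h2 := ((ContinuousMap.evalCLM ℝ x : X →L[ℝ] ℝ).hasFDerivAt.comp_hasDerivAt c h)
  have h3 : HasDerivAt (fun c => Real.exp (c * (π - (x:ℝ)))) (Real.exp (c * (π - x)) * (1 * (π - x))) c :=
    ((hasDerivAt_id c).mul_const (π - (x:ℝ))).exp
  have := h3.unique h2
  refine Eq.trans ?_ this
  change (π * 1 - (x:ℝ)) * Real.exp (c * (π - x)) = _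
  ring

end Schiffer
end

set_option linter.unusedSectionVars false
set_option linter.unusedSimpArgs false
noncomputable section
namespace Schiffer

lemma ext_P (f : X) {x : ℝ} (hx : x ∈ Set.Icc (0:ℝ) π) : ext (P f) x = pr f x := by
  rw [ext_of_mem _ hx]; rfl

lemma ext_V (f : X) {x : ℝ} (hx : x ∈ Set.Icc (0:ℝ) π) : ext (V f) x = pr (P f) x := ext_P _ hx

lemma prP_hasDerivAt (f : X) {x : ℝ} (hx : x ∈ Set.Icc (0:ℝ) π) :
    HasDerivAt (pr (P f)) (pr f x) x := by
  rw [← ext_P f hx]; exact pr_hasDerivAt _ _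

lemma P_of_deriv (r : X) (W' : ℝ → ℝ)
    (h2 : ∀ x ∈ Set.Icc (0:ℝ) π, HasDerivAt W' (ext r x) x) (h0' : W' 0 = 0)
    {x : ℝ} (hx : x ∈ Set.Icc (0:ℝ) π) : pr r x = W' x := by
  rw [pr_eq_of_deriv r W' h2 hx, h0', sub_zero]

lemma V_of_deriv (r : X) (W W' : ℝ → ℝ) (h1 : ∀ x ∈ Set.Icc (0:ℝ) π, HasDerivAt W (W' x) x)
    (h2 : ∀ x ∈ Set.Icc (0:ℝ) π, HasDerivAt W' (ext r x) x) (h0 : W 0 = 0) (h0' : W' 0 = 0)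
    {x : ℝ} (hx : x ∈ Set.Icc (0:ℝ) π) : pr (P r) x = W x := by
  rw [pr_eq_of_deriv (P r) W (fun t ht => ?_) hx, h0, sub_zero]
  rw [ext_P r ht, P_of_deriv r W' h2 h0' ht]
  exact h1 t ht

lemma I1_eq' (f : X) : I1 f = pr (P f) π := rfl

lemma ext_ex (c : ℝ) {x : ℝ} (hx : x ∈ Set.Icc (0:ℝ) π) : ext (ex c) x = Real.exp (c * x) :=
  ext_mkX _ _ hx
lemma ext_exd (c : ℝ) {x : ℝ} (hx : x ∈ Set.Icc (0:ℝ) π) : ext (exd c) x = Real.exp (c * (π - x)) :=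
  ext_mkX _ _ hx

def cs (ω : ℝ) : X := mkX (fun x => Real.cos (ω * x)) (by fun_prop)
def sn (ω : ℝ) : X := mkX (fun x => Real.sin (ω * x)) (by fun_prop)
lemma ext_cs (c : ℝ) {x : ℝ} (hx : x ∈ Set.Icc (0:ℝ) π) : ext (cs c) x = Real.cos (c * x) :=
  ext_mkX _ _ hx
lemma ext_sn (c : ℝ) {x : ℝ} (hx : x ∈ Set.Icc (0:ℝ) π) : ext (sn c) x = Real.sin (c * x) :=
  ext_mkX _ _ hx

lemma hasDerivAt_cosm (ω x : ℝ) :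
    HasDerivAt (fun x => Real.cos (ω * x)) (-(ω * Real.sin (ω * x))) x := by
  have := ((hasDerivAt_id x).const_mul ω).cos
  simp only [id, mul_one] at this
  convert this using 1; ring
lemma hasDerivAt_sinm (ω x : ℝ) :
    HasDerivAt (fun x => Real.sin (ω * x)) (ω * Real.cos (ω * x)) x := by
  have := ((hasDerivAt_id x).const_mul ω).sin
  simp only [id, mul_one] at this
  convert this using 1; ring
lemma hasDerivAt_expm (ω x : ℝ) :
    HasDerivAt (fun x => Real.exp (ω * x)) (ω * Real.exp (ω * x)) x := by
  have := ((hasDerivAt_id x).const_mul ω).exp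
  simp only [id, mul_one] at this
  convert this using 1; ring

lemma pr_mul_hasDerivAt (f g : X) (x : ℝ) : HasDerivAt (pr (f * g)) (ext f x * ext g x) x := by
  rw [← ext_mul]; exact pr_hasDerivAt _ _

/-! ### Volterra equation -/

lemma I0_cos (r : X) (ω : ℝ) : I0 ((r + ω^2 • V r) * cs ω) =
    I0 r * Real.cos (ω * π) + ω * I1 r * Real.sin (ω * π) := by
  have := I0_eq_of_deriv ((r + ω^2 • V r) * cs ω)
    (fun x => pr r x * Real.cos (ω * x) + ω * pr (P r) x * Real.sin (ω * x)) (fun x hx => by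
      have h := ((pr_hasDerivAt r x).mul (hasDerivAt_cosm ω x)).add
        (((prP_hasDerivAt r hx).const_mul ω).mul (hasDerivAt_sinm ω x))
      refine h.congr_deriv ?_
      rw [ext_mul, ext_add, ext_smul, ext_cs ω hx, ext_V r hx]
      ring)
  rw [this, I0_eq, I1_eq']
  simp

lemma I0_sin (r : X) (ω : ℝ) : I0 ((r + ω^2 • V r) * sn ω) =
    I0 r * Real.sin (ω * π) - ω * I1 r * Real.cos (ω * π) := by
  have := I0_eq_of_deriv ((r + ω^2 • V r) * sn ω)
    (fun x => pr r x * Real.sin (ω * x) - ω * pr (P r) x * Real.cos (ω * x)) (fun x hx => by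
      have h := ((pr_hasDerivAt r x).mul (hasDerivAt_sinm ω x)).sub
        (((prP_hasDerivAt r hx).const_mul ω).mul (hasDerivAt_cosm ω x))
      refine h.congr_deriv ?_
      rw [ext_mul, ext_add, ext_smul, ext_sn ω hx, ext_V r hx]
      ring)
  rw [this, I0_eq, I1_eq']
  simp

lemma volterra_inj (ω : ℝ) (y : X) (h : y + ω^2 • V y = 0) : y = 0 := by
  rcases eq_or_ne ω 0 with rfl | hω
  · simpa using h
  have hy : ∀ x ∈ Set.Icc (0:ℝ) π, ext y x = - ω^2 * pr (P y) x := by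
    intro x hx
    have := congrArg (fun f => ext f x) h
    simp only [ext_add, ext_smul, ext_V y hx] at this
    have h0 : ext (0:X) x = 0 := rfl
    rw [h0] at this
    linarith
  have hE : ∀ x ∈ Set.Icc (0:ℝ) π, HasDerivAt (fun x => (pr y x)^2 + ω^2 * (pr (P y) x)^2) 0 x := by
    intro x hx
    have h1 := ((pr_hasDerivAt y x).pow 2).add (((prP_hasDerivAt y hx).pow 2).const_mul (ω^2))
    refine h1.congr_deriv ?_
    rw [hy x hx]
    simp
    ring
  have hc := constant_of_has_deriv_right_zero (f := fun x => (pr y x)^2 + ω^2 * (pr (P y) x)^2)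
    (a := 0) (b := π) (fun x hx => (hE x hx).continuousAt.continuousWithinAt)
    (fun x hx => (hE x (Ico_subset_Icc_self hx)).hasDerivWithinAt)
  refine ContinuousMap.ext fun x => ?_
  have h1 := hc x x.2
  simp only [pr_zero] at h1
  have h3 : pr (P y) x = 0 := by
    have : 0 < ω^2 := by positivity
    have h4 : ω^2 * (pr (P y) x)^2 ≤ 0 := by nlinarith [sq_nonneg (pr y (x:ℝ))]
    have h5 : (pr (P y) (x:ℝ))^2 ≤ 0 := by nlinarith
    exact pow_eq_zero_iff (two_ne_zero) |>.1 (le_antisymm h5 (sq_nonneg _))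
  rw [← ext_coe, hy x x.2, h3]; simp

lemma volterra_surj (ω : ℝ) (hω : ω ≠ 0) (f : X) : ∃ y : X, y + ω^2 • V y = f := by
  set G : X := ω⁻¹ • (sn ω * P (cs ω * f) - cs ω * P (sn ω * f)) with hG
  have hext : ∀ x ∈ Set.Icc (0:ℝ) π, ext (f - ω^2 • G) x = ext f x -
      ω * (Real.sin (ω*x) * pr (cs ω * f) x - Real.cos (ω*x) * pr (sn ω * f) x) := by
    intro x hx
    rw [hG, ext_sub, ext_smul, ext_smul, ext_sub, ext_mul, ext_mul, ext_cs _ hx, ext_sn _ hx,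
      ext_P _ hx, ext_P _ hx]
    field_simp
  refine ⟨f - ω^2 • G, ?_⟩
  have : V (f - ω^2 • G) = G := by
    refine ContinuousMap.ext fun x => ?_
    rw [← ext_coe, ← ext_coe, ext_V _ x.2]
    rw [V_of_deriv (f - ω^2 • G)
      (fun x => ω⁻¹ * (Real.sin (ω*x) * pr (cs ω * f) x - Real.cos (ω*x) * pr (sn ω * f) x))
      (fun x => Real.cos (ω*x) * pr (cs ω * f) x + Real.sin (ω*x) * pr (sn ω * f) x)
      ?_ ?_ (by simp) (by simp) x.2]
    · rw [hG, ext_smul, ext_sub, ext_mul, ext_mul, ext_cs _ x.2, ext_sn _ x.2, ext_P _ x.2, ext_P _ x.2]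
    · intro x hx
      have h := (((hasDerivAt_sinm ω x).mul (pr_mul_hasDerivAt (cs ω) f x)).sub
        ((hasDerivAt_cosm ω x).mul (pr_mul_hasDerivAt (sn ω) f x))).const_mul ω⁻¹
      refine h.congr_deriv ?_
      rw [ext_cs _ hx, ext_sn _ hx]
      field_simp
      ring
    · intro x hx
      have h := (((hasDerivAt_cosm ω x).mul (pr_mul_hasDerivAt (cs ω) f x)).add
        ((hasDerivAt_sinm ω x).mul (pr_mul_hasDerivAt (sn ω) f x)))
      refine h.congr_deriv ?_
      rw [hext x hx, ext_cs _ hx, ext_sn _ hx]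
      linear_combination (ext f x) * Real.sin_sq_add_cos_sq (ω * x)
  rw [this]; simp

/-! ### The Green operator -/

def mulX (g : X) : X →L[ℝ] X := ContinuousLinearMap.mul ℝ X g
@[simp] lemma mulX_apply (g f : X) : mulX g f = g * f := rfl

def cst : ℝ →L[ℝ] X := ContinuousLinearMap.toSpanSingleton ℝ (1:X)
lemma cst_apply (c : ℝ) : cst c = c • (1:X) := by simp [cst]

def K (ν : ℝ) : X →L[ℝ] X := (1/(2*ν)) • ((mulX (ex (-ν))).comp (P.comp (mulX (ex ν))) +
  (mulX (ex ν)).comp (cst.comp (I0.comp (mulX (ex (-ν)))) - P.comp (mulX (ex (-ν)))))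

lemma K_apply (ν : ℝ) (f : X) : K ν f = (1/(2*ν)) • (ex (-ν) * P (ex ν * f) +
    ex ν * (I0 (ex (-ν) * f) • (1:X) - P (ex (-ν) * f))) := by
  rw [← cst_apply]; rfl

lemma ext_K (ν : ℝ) (f : X) {x : ℝ} (hx : x ∈ Set.Icc (0:ℝ) π) :
    ext (K ν f) x = (1/(2*ν)) * (Real.exp (-ν*x) * pr (ex ν * f) x +
      Real.exp (ν * x) * (I0 (ex (-ν) * f) - pr (ex (-ν) * f) x)) := by
  have h1 : ext (1:X) x = 1 := rfl
  rw [K_apply, ext_smul, ext_add, ext_mul, ext_mul, ext_sub, ext_smul, ext_ex _ hx, ext_ex _ hx,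
    ext_P _ hx, ext_P _ hx, h1, mul_one]

lemma integral_exp_mul (c : ℝ) (hc : c ≠ 0) (a b : ℝ) :
    ∫ t in a..b, Real.exp (c * t) = (Real.exp (c * b) - Real.exp (c * a)) / c := by
  rw [intervalIntegral.integral_eq_sub_of_hasDerivAt (f := fun t => Real.exp (c*t) / c)]
  · ring
  · intro x _
    have := (hasDerivAt_expm c x).div_const c
    refine this.congr_deriv ?_
    field_simp
  · exact Continuous.intervalIntegrable (by fun_prop) _ _

lemma int_bound (c : ℝ) (hc : c ≠ 0) (f : X) {a b : ℝ} (hab : a ≤ b) (ha : 0 ≤ a) (hb : b ≤ π) :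
    |∫ t in a..b, ext (ex c * f) t| ≤ ‖f‖ * ((Real.exp (c * b) - Real.exp (c * a)) / c) := by
  have := intervalIntegral.norm_integral_le_of_norm_le (a := a) (b := b) (f := ext (ex c * f))
    (g := fun t => ‖f‖ * Real.exp (c * t)) (μ := volume) hab
    (Filter.Eventually.of_forall fun t ht => by
      rw [ext_mul, ext_ex c ⟨ha.trans ht.1.le, ht.2.trans hb⟩, norm_mul, mul_comm, Real.norm_eq_abs,
        Real.norm_eq_abs, abs_of_pos (Real.exp_pos _)]
      exact mul_le_mul_of_nonneg_right (ext_abs_le f t) (Real.exp_pos _).le)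
    (Continuous.intervalIntegrable (by fun_prop) _ _)
  rw [intervalIntegral.integral_const_mul, integral_exp_mul c hc] at this
  exact this

lemma K_norm_le {ν : ℝ} (hν : 0 < ν) : ‖K ν‖ ≤ 1/ν^2 := by
  refine ContinuousLinearMap.opNorm_le_bound _ (by positivity) (fun f => ?_)
  rw [ContinuousMap.norm_le _ (by positivity)]
  intro x
  obtain ⟨x, hx⟩ := x
  rw [← ext_of_mem, ext_K ν f hx, Real.norm_eq_abs, abs_mul, abs_of_pos (by positivity)]
  have h1 : |pr (ex ν * f) x| ≤ ‖f‖ * ((Real.exp (ν * x) - Real.exp (ν * 0)) / ν) :=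
    int_bound ν hν.ne' f hx.1 le_rfl hx.2
  have h2 : |I0 (ex (-ν) * f) - pr (ex (-ν) * f) x| ≤
      ‖f‖ * ((Real.exp (-ν * π) - Real.exp (-ν * x)) / (-ν)) := by
    have e : I0 (ex (-ν) * f) - pr (ex (-ν) * f) x = ∫ t in x..π, ext (ex (-ν) * f) t := by
      rw [I0_eq, pr, pr, intervalIntegral.integral_interval_sub_left]
      · exact (ext_continuous _).intervalIntegrable _ _
      · exact (ext_continuous _).intervalIntegrable _ _
    rw [e]
    exact int_bound (-ν) (neg_ne_zero.2 hν.ne') f hx.2 hx.1 le_rfl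
  have e1 : Real.exp (-ν*x) * Real.exp (ν*x) = 1 := by rw [← Real.exp_add]; simp
  calc 1/(2*ν) * |Real.exp (-ν*x) * pr (ex ν * f) x +
      Real.exp (ν * x) * (I0 (ex (-ν) * f) - pr (ex (-ν) * f) x)|
      ≤ 1/(2*ν) * (Real.exp (-ν*x) * (‖f‖ * ((Real.exp (ν * x) - Real.exp (ν * 0)) / ν)) +
        Real.exp (ν * x) * (‖f‖ * ((Real.exp (-ν * π) - Real.exp (-ν * x)) / (-ν)))) := by
        refine mul_le_mul_of_nonneg_left ?_ (by positivity)
        refine (abs_add_le _ _).trans ?_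
        rw [abs_mul, abs_mul, abs_of_pos (Real.exp_pos _), abs_of_pos (Real.exp_pos _)]
        gcongr
    _ = 1/ν^2 * ‖f‖ - ‖f‖/(2*ν^2) * (Real.exp (-ν*x) + Real.exp (ν*x) * Real.exp (-ν*π)) := by
        field_simp
        simp only [mul_zero, Real.exp_zero]
        have e2 : Real.exp (-(ν*x)) * Real.exp (ν*x) = 1 := by rw [← Real.exp_add]; simp
        linear_combination 2 * ‖f‖ * e2
    _ ≤ 1/ν^2 * ‖f‖ := by
        have : 0 ≤ ‖f‖/(2*ν^2) * (Real.exp (-ν*x) + Real.exp (ν*x) * Real.exp (-ν*π)) := by positivity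
        linarith

/-- moments -/
def m0 (ν : ℝ) : X →L[ℝ] ℝ := ν • I0.comp (mulX (ex (-ν)))
def mpi (ν : ℝ) : X →L[ℝ] ℝ := ν • I0.comp (mulX (exd (-ν)))
lemma m0_apply (ν : ℝ) (f : X) : m0 ν f = ν * I0 (ex (-ν) * f) := rfl
lemma mpi_apply (ν : ℝ) (f : X) : mpi ν f = ν * I0 (exd (-ν) * f) := rfl

lemma exd_eq_ex (c : ℝ) : exd c = Real.exp (c * π) • ex (-c) := by
  refine ContinuousMap.ext fun x => ?_
  change Real.exp _ = Real.exp _ * Real.exp _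
  rw [← Real.exp_add]; ring_nf

lemma I0_ex_bound (c : ℝ) (hc : c ≠ 0) (f : X) :
    |I0 (ex c * f)| ≤ ‖f‖ * ((Real.exp (c * π) - Real.exp (c * 0)) / c) :=
  int_bound c hc f pi_pos.le le_rfl le_rfl

lemma m0_norm_le {ν : ℝ} (hν : 0 < ν) : ‖m0 ν‖ ≤ 1 := by
  refine ContinuousLinearMap.opNorm_le_bound _ zero_le_one (fun f => ?_)
  rw [m0_apply, norm_mul, Real.norm_eq_abs, Real.norm_eq_abs, abs_of_pos hν, one_mul]
  have := I0_ex_bound (-ν) (neg_ne_zero.2 hν.ne') f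
  have h2 : ν * (‖f‖ * ((Real.exp (-ν * π) - Real.exp (-ν * 0)) / -ν)) =
      ‖f‖ * (1 - Real.exp (-ν*π)) := by
    field_simp; simp; ring
  have h3 : 0 ≤ ‖f‖ * Real.exp (-ν*π) := by positivity
  calc _ ≤ ν * (‖f‖ * ((Real.exp (-ν * π) - Real.exp (-ν * 0)) / -ν)) := by gcongr
    _ ≤ ‖f‖ := by rw [h2]; linarith

lemma mpi_norm_le {ν : ℝ} (hν : 0 < ν) : ‖mpi ν‖ ≤ 1 := by
  refine ContinuousLinearMap.opNorm_le_bound _ zero_le_one (fun f => ?_)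
  rw [mpi_apply, norm_mul, Real.norm_eq_abs, Real.norm_eq_abs, abs_of_pos hν, one_mul,
    exd_eq_ex, smul_mul_assoc, map_smul, smul_eq_mul, abs_mul, abs_of_pos (Real.exp_pos _), neg_neg]
  have := I0_ex_bound ν hν.ne' f
  have h2 : ν * (Real.exp (-ν*π) * (‖f‖ * ((Real.exp (ν * π) - Real.exp (ν * 0)) / ν))) =
      ‖f‖ * (1 - Real.exp (-ν*π)) := by
    have e2 : Real.exp (-(ν*π)) * Real.exp (ν*π) = 1 := by rw [← Real.exp_add]; simp
    field_simp; simp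
    linear_combination ‖f‖ * e2
  have h3 : 0 ≤ ‖f‖ * Real.exp (-ν*π) := by positivity
  calc _ ≤ ν * (Real.exp (-ν*π) * (‖f‖ * ((Real.exp (ν * π) - Real.exp (ν * 0)) / ν))) := by gcongr
    _ ≤ ‖f‖ := by rw [h2]; linarith

/-- vanishing moments: the solution has vanishing Cauchy data at both ends -/
lemma K_cauchy {ν : ℝ} (hν : 0 < ν) (ρ w : X) (h0 : m0 ν ρ = 0) (hπ : mpi ν ρ = 0)
    (hw : w = - K ν ρ) : w = V (ν^2 • w + ρ) ∧ I0 (ν^2 • w + ρ) = 0 ∧ I1 (ν^2 • w + ρ) = 0 := by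
  have h0' : I0 (ex (-ν) * ρ) = 0 := by
    rw [m0_apply] at h0; exact (mul_eq_zero.1 h0).resolve_left hν.ne'
  have hπ' : pr (ex ν * ρ) π = 0 := by
    rw [mpi_apply, exd_eq_ex, smul_mul_assoc, map_smul, neg_neg, smul_eq_mul] at hπ
    have := (mul_eq_zero.1 hπ).resolve_left hν.ne'
    exact (mul_eq_zero.1 this).resolve_left (Real.exp_pos _).ne'
  have h0'' : pr (ex (-ν) * ρ) π = 0 := h0'
  have hwx : ∀ x ∈ Set.Icc (0:ℝ) π, ext w x = (1/(2*ν)) *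
      (Real.exp (ν*x) * pr (ex (-ν) * ρ) x - Real.exp (-ν*x) * pr (ex ν * ρ) x) := by
    intro x hx
    have : ext (- K ν ρ) x = - ext (K ν ρ) x := rfl
    rw [hw, this, ext_K ν ρ hx, h0']
    ring
  have e1 : ∀ x, Real.exp (-ν*x) * Real.exp (ν*x) = 1 := fun x => by rw [← Real.exp_add]; simp
  have d1 : ∀ x ∈ Set.Icc (0:ℝ) π, HasDerivAt (fun x => (1/(2*ν)) *
      (Real.exp (ν*x) * pr (ex (-ν) * ρ) x - Real.exp (-ν*x) * pr (ex ν * ρ) x))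
      ((1/2) * (Real.exp (ν*x) * pr (ex (-ν) * ρ) x + Real.exp (-ν*x) * pr (ex ν * ρ) x)) x := by
    intro x hx
    have h := (((hasDerivAt_expm ν x).mul (pr_mul_hasDerivAt (ex (-ν)) ρ x)).sub
        ((hasDerivAt_expm (-ν) x).mul (pr_mul_hasDerivAt (ex ν) ρ x))).const_mul (1/(2*ν))
    refine h.congr_deriv ?_
    rw [ext_ex _ hx, ext_ex _ hx]
    field_simp
    ring
  have d2 : ∀ x ∈ Set.Icc (0:ℝ) π, HasDerivAt (fun x =>
      ((1/2) * (Real.exp (ν*x) * pr (ex (-ν) * ρ) x + Real.exp (-ν*x) * pr (ex ν * ρ) x)))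
      (ext (ν^2 • w + ρ) x) x := by
    intro x hx
    have h := (((hasDerivAt_expm ν x).mul (pr_mul_hasDerivAt (ex (-ν)) ρ x)).add
        ((hasDerivAt_expm (-ν) x).mul (pr_mul_hasDerivAt (ex ν) ρ x))).const_mul (1/2)
    refine h.congr_deriv ?_
    rw [ext_add, ext_smul, hwx x hx, ext_ex _ hx, ext_ex _ hx]
    have := e1 x
    field_simp at this ⊢
    linear_combination 2 * ext ρ x * this
  have hV : ∀ x ∈ Set.Icc (0:ℝ) π, pr (P (ν^2 • w + ρ)) x = _ := fun x hx =>
    V_of_deriv (ν^2 • w + ρ) _ _ d1 d2 (by simp) (by simp) hx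
  have hPi : (π:ℝ) ∈ Set.Icc (0:ℝ) π := ⟨pi_pos.le, le_rfl⟩
  refine ⟨?_, ?_, ?_⟩
  · refine ContinuousMap.ext fun x => ?_
    rw [← ext_coe, ← ext_coe, ext_V _ x.2, hwx x x.2, hV x x.2]
  · rw [I0_eq, P_of_deriv _ _ d2 (by simp) hPi, h0'', hπ']; simp
  · rw [I1_eq', hV π hPi, h0'', hπ']; simp

end Schiffer
end

set_option linter.unusedSectionVars false
set_option linter.unusedSimpArgs false
noncomputable section
namespace Schiffer

/-! ### The nonlinear map -/

def kk (n : ℕ) : ℝ := (n:ℝ) + 2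
lemma kk_ge (n : ℕ) : 2 ≤ kk n := by unfold kk; have : (0:ℝ) ≤ n := by positivity
                                     linarith
lemma kk_pos (n : ℕ) : 0 < kk n := by linarith [kk_ge n]
def nu (n : ℕ) : ℝ := Real.sqrt (3 * kk n ^ 2 - 4)
lemma nu_sq (n : ℕ) : nu n ^ 2 = 3 * kk n ^ 2 - 4 := by
  unfold nu; rw [Real.sq_sqrt]; nlinarith [kk_ge n]
lemma nu_pos (n : ℕ) : 0 < nu n := by
  unfold nu; apply Real.sqrt_pos.2; nlinarith [kk_ge n]

def JJ : L1 X →L[ℝ] L1 X := diag (fun n => (1 / kk n ^ 2) • ContinuousLinearMap.id ℝ X) 1 (fun n => by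
  have h : 1 / kk n ^ 2 ≤ 1 := by
    rw [div_le_one (by have := kk_pos n; positivity)]; nlinarith [kk_ge n]
  have h0 : 0 ≤ 1 / kk n ^ 2 := by positivity
  rw [norm_smul, Real.norm_eq_abs, abs_of_nonneg h0]
  exact mul_le_one₀ h (norm_nonneg _) ContinuousLinearMap.norm_id_le)
lemma JJ_apply (f : L1 X) (n : ℕ) : JJ f n = (1 / kk n ^ 2) • f n := rfl

def BB : L1 X →L[ℝ] L1 X := (3:ℝ) • ContinuousLinearMap.id ℝ _ - (4:ℝ) • JJ
lemma BB_apply (f : L1 X) (n : ℕ) : BB f n = (3:ℝ) • f n - (4:ℝ) • (1 / kk n ^ 2) • f n := rfl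

def KK : L1 X →L[ℝ] L1 X := diag (fun n => (kk n ^ 2) • K (nu n)) 1 (fun n => by
  rw [norm_smul]
  have h := K_norm_le (nu_pos n)
  have h0 : 0 ≤ kk n ^ 2 := by positivity
  have h1 := nu_sq n
  rw [Real.norm_eq_abs, abs_of_nonneg h0]
  calc kk n ^ 2 * ‖K (nu n)‖ ≤ kk n ^ 2 * (1 / nu n ^ 2) := by gcongr
    _ ≤ 1 := by
      rw [h1, mul_one_div, div_le_one (by nlinarith [kk_ge n])]; nlinarith [kk_ge n])
lemma KK_apply (f : L1 X) (n : ℕ) : KK f n = (kk n ^ 2) • K (nu n) (f n) := rfl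

def mm0 : L1 X →L[ℝ] L1 ℝ := diag (fun n => m0 (nu n)) 1 (fun n => m0_norm_le (nu_pos n))
def mmpi : L1 X →L[ℝ] L1 ℝ := diag (fun n => mpi (nu n)) 1 (fun n => mpi_norm_le (nu_pos n))
lemma mm0_apply (f : L1 X) (n : ℕ) : mm0 f n = m0 (nu n) (f n) := rfl
lemma mmpi_apply (f : L1 X) (n : ℕ) : mmpi f n = mpi (nu n) (f n) := rfl

def hv (a d : L1 X) : L1 X := (2:ℝ) • (a + d)
def Nv (a d : L1 X) : L1 X := Mm a a + Mm d d + (2:ℝ) • Mp a d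
def Pm (f g : L1 X) : L1 X := (1/2:ℝ) • (Mp f g + Mm f g)
def Rv (s : ℝ) (w0 : X) (w' a d : L1 X) : L1 X :=
  Pm (hv a d) w' + Mp (sgl 0 w0) (Nv a d) + s • Pm (Nv a d) w'

abbrev ZT := ℝ × ℝ × ℝ × X × X
abbrev MT := L1 X × L1 ℝ × L1 ℝ
abbrev PT := L1 X × L1 X × L1 X
abbrev ET := ZT × MT
abbrev FT := (X × ℝ × X × ℝ × ℝ) × MT

def avec (τ : ℝ) (α : L1 X) : L1 X := sgl 1 (ex (-τ)) + sh α
def dvec (τ D1 : ℝ) (δ : L1 X) : L1 X := D1 • sgl 1 (exd (-τ)) + sh δ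
def wvec (w1 : X) (ω : L1 X) : L1 X := sgl 1 w1 + sh (JJ ω)

/-- the remainder as function of everything -/
def RR (s : ℝ) (z : ZT) (m : PT) : L1 X :=
  Rv s z.2.2.2.1 (wvec z.2.2.2.2 m.1) (avec z.2.1 m.2.1) (dvec z.2.1 z.2.2.1 m.2.2)

def HH (z : ZT) (m : PT) : L1 X := hv (avec z.2.1 m.2.1) (dvec z.2.1 z.2.2.1 m.2.2)

def r0F (s ε : ℝ) (z : ZT) (m : PT) : X :=
  -(z.1 • (ex (2*ε*z.2.1) * (z.2.2.2.1 + s^2 • coord 0 (RR s z m))))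
def r1F (s ε : ℝ) (z : ZT) (m : PT) : X :=
  z.2.1^2 • z.2.2.2.2 - z.1 • (ex (2*ε*z.2.1) *
    (z.2.2.2.2 + coord 1 (HH z m) * z.2.2.2.1 + s • coord 1 (RR s z m)))
def rMF (s ε : ℝ) (z : ZT) (m : PT) : L1 X :=
  z.2.1^2 • m.1 - z.1 • Mp (sgl 0 (ex (2*ε*z.2.1)))
    (JJ m.1 + Mp (sgl 0 z.2.2.2.1) (dr (HH z m)) + s • dr (RR s z m))
def rhoF (s ε : ℝ) (z : ZT) (m : PT) : L1 X := rMF s ε z m - BB m.1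

def Psi (q : ℝ × ℝ × ZT × PT) : FT :=
  ((q.2.2.1.2.2.2.1 - 1 - V (r0F q.1 q.2.1 q.2.2.1 q.2.2.2), I0 (r0F q.1 q.2.1 q.2.2.1 q.2.2.2),
    q.2.2.1.2.2.2.2 - V (r1F q.1 q.2.1 q.2.2.1 q.2.2.2), I0 (r1F q.1 q.2.1 q.2.2.1 q.2.2.2),
    I1 (r1F q.1 q.2.1 q.2.2.1 q.2.2.2)),
   (q.2.2.2.1 + KK (rhoF q.1 q.2.1 q.2.2.1 q.2.2.2), mm0 (rhoF q.1 q.2.1 q.2.2.1 q.2.2.2),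
    mmpi (rhoF q.1 q.2.1 q.2.2.1 q.2.2.2)))

attribute [fun_prop] ex_contDiff exd_contDiff

section CD
variable {G : Type} [NormedAddCommGroup G] [NormedSpace ℝ G]

lemma cd_clm {V W : Type} [NormedAddCommGroup V] [NormedSpace ℝ V] [NormedAddCommGroup W]
    [NormedSpace ℝ W] (T : V →L[ℝ] W) {f : G → V} (hf : ContDiff ℝ 1 f) :
    ContDiff ℝ 1 (fun x => T (f x)) := T.contDiff.comp hf

lemma cd_bil {U V W : Type} [NormedAddCommGroup V] [NormedSpace ℝ V] [NormedAddCommGroup W]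
    [NormedSpace ℝ W] [NormedAddCommGroup U] [NormedSpace ℝ U] (T : U →L[ℝ] V →L[ℝ] W)
    {f : G → U} {g : G → V} (hf : ContDiff ℝ 1 f) (hg : ContDiff ℝ 1 g) :
    ContDiff ℝ 1 (fun x => T (f x) (g x)) := (cd_clm T hf).clm_apply hg

lemma cd_smul {V : Type} [NormedAddCommGroup V] [NormedSpace ℝ V] {s : G → ℝ} {f : G → V}
    (hs : ContDiff ℝ 1 s) (hf : ContDiff ℝ 1 f) : ContDiff ℝ 1 (fun x => s x • f x) := hs.smul hf
lemma cd_mul {f g : G → X}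
    (hs : ContDiff ℝ 1 f) (hf : ContDiff ℝ 1 g) : ContDiff ℝ 1 (fun x => f x * g x) := hs.mul hf

lemma cd_hv {a d : G → L1 X} (ha : ContDiff ℝ 1 a) (hd : ContDiff ℝ 1 d) :
    ContDiff ℝ 1 (fun x => hv (a x) (d x)) := by
  unfold hv; exact (ha.add hd).const_smul _
lemma cd_Pm {a d : G → L1 X} (ha : ContDiff ℝ 1 a) (hd : ContDiff ℝ 1 d) :
    ContDiff ℝ 1 (fun x => Pm (a x) (d x)) := by
  unfold Pm; exact ((cd_bil Mp ha hd).add (cd_bil Mm ha hd)).const_smul _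
lemma cd_Nv {a d : G → L1 X} (ha : ContDiff ℝ 1 a) (hd : ContDiff ℝ 1 d) :
    ContDiff ℝ 1 (fun x => Nv (a x) (d x)) := by
  unfold Nv; exact ((cd_bil Mm ha ha).add (cd_bil Mm hd hd)).add ((cd_bil Mp ha hd).const_smul _)
lemma cd_Rv {s : G → ℝ} {w0 : G → X} {w' a d : G → L1 X} (hs : ContDiff ℝ 1 s) (hw0 : ContDiff ℝ 1 w0)
    (hw' : ContDiff ℝ 1 w') (ha : ContDiff ℝ 1 a) (hd : ContDiff ℝ 1 d) :
    ContDiff ℝ 1 (fun x => Rv (s x) (w0 x) (w' x) (a x) (d x)) := by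
  unfold Rv
  exact ((cd_Pm (cd_hv ha hd) hw').add (cd_bil Mp (cd_clm (sgl 0) hw0) (cd_Nv ha hd))).add
    (hs.smul (cd_Pm (cd_Nv ha hd) hw'))
lemma cd_avec {t : G → ℝ} {a : G → L1 X} (ht : ContDiff ℝ 1 t) (ha : ContDiff ℝ 1 a) :
    ContDiff ℝ 1 (fun x => avec (t x) (a x)) := by
  unfold avec
  exact (cd_clm (sgl 1) (ex_contDiff.comp ht.neg)).add (cd_clm sh ha)
lemma cd_dvec {t D : G → ℝ} {a : G → L1 X} (ht : ContDiff ℝ 1 t) (hD : ContDiff ℝ 1 D)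
    (ha : ContDiff ℝ 1 a) : ContDiff ℝ 1 (fun x => dvec (t x) (D x) (a x)) := by
  unfold dvec
  exact (hD.smul (cd_clm (sgl 1) (exd_contDiff.comp ht.neg))).add (cd_clm sh ha)
lemma cd_wvec {w : G → X} {a : G → L1 X} (ht : ContDiff ℝ 1 w) (ha : ContDiff ℝ 1 a) :
    ContDiff ℝ 1 (fun x => wvec (w x) (a x)) := by
  unfold wvec
  exact (cd_clm (sgl 1) ht).add (cd_clm sh (cd_clm JJ ha))
end CD

abbrev QT := ℝ × ℝ × ZT × PT

lemma cd_RR : ContDiff ℝ 1 (fun q : QT => RR q.1 q.2.2.1 q.2.2.2) := by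
  unfold RR
  exact cd_Rv (by fun_prop) (by fun_prop) (cd_wvec (by fun_prop) (by fun_prop))
    (cd_avec (by fun_prop) (by fun_prop)) (cd_dvec (by fun_prop) (by fun_prop) (by fun_prop))
lemma cd_HH : ContDiff ℝ 1 (fun q : QT => HH q.2.2.1 q.2.2.2) := by
  unfold HH
  exact cd_hv (cd_avec (by fun_prop) (by fun_prop)) (cd_dvec (by fun_prop) (by fun_prop) (by fun_prop))
lemma cd_e : ContDiff ℝ 1 (fun q : QT => ex (2*q.2.1*q.2.2.1.2.1)) :=
  ex_contDiff.comp (by fun_prop)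
lemma cS : ContDiff ℝ 1 (fun q : QT => q.1) := by fun_prop
lemma cS2 : ContDiff ℝ 1 (fun q : QT => q.1^2) := by fun_prop
lemma cL : ContDiff ℝ 1 (fun q : QT => q.2.2.1.1) := by fun_prop
lemma cT2 : ContDiff ℝ 1 (fun q : QT => q.2.2.1.2.1^2) := by fun_prop
lemma cW0 : ContDiff ℝ 1 (fun q : QT => q.2.2.1.2.2.2.1) := by fun_prop
lemma cW1 : ContDiff ℝ 1 (fun q : QT => q.2.2.1.2.2.2.2) := by fun_prop
lemma cM : ContDiff ℝ 1 (fun q : QT => q.2.2.2.1) := by fun_prop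

lemma cd_r0F : ContDiff ℝ 1 (fun q : QT => r0F q.1 q.2.1 q.2.2.1 q.2.2.2) := by
  unfold r0F
  exact (cd_smul cL (cd_mul cd_e (cW0.add (cd_smul cS2 (cd_clm _ cd_RR))))).neg
lemma cd_r1F : ContDiff ℝ 1 (fun q : QT => r1F q.1 q.2.1 q.2.2.1 q.2.2.2) := by
  unfold r1F
  exact (cd_smul cT2 cW1).sub (cd_smul cL (cd_mul cd_e ((cW1.add (cd_mul (cd_clm _ cd_HH) cW0)).add
    (cd_smul cS (cd_clm _ cd_RR)))))
lemma cd_rMF : ContDiff ℝ 1 (fun q : QT => rMF q.1 q.2.1 q.2.2.1 q.2.2.2) := by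
  unfold rMF
  exact (cd_smul cT2 cM).sub (cd_smul cL (cd_bil Mp (cd_clm _ cd_e)
   (((cd_clm JJ cM).add (cd_bil Mp (cd_clm _ cW0)
     (cd_clm dr cd_HH))).add (cd_smul cS (cd_clm dr cd_RR)))))
lemma cd_rhoF : ContDiff ℝ 1 (fun q : QT => rhoF q.1 q.2.1 q.2.2.1 q.2.2.2) := by
  unfold rhoF
  exact cd_rMF.sub (cd_clm BB (by fun_prop))
lemma cd_Psi : ContDiff ℝ 1 Psi := by
  unfold Psi
  exact ((ContDiff.sub (by fun_prop) (cd_clm V cd_r0F)).prodMk ((cd_clm I0 cd_r0F).prodMk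
    ((ContDiff.sub (by fun_prop) (cd_clm V cd_r1F)).prodMk ((cd_clm I0 cd_r1F).prodMk
    (cd_clm I1 cd_r1F))))).prodMk ((ContDiff.add (by fun_prop) (cd_clm KK cd_rhoF)).prodMk
    ((cd_clm mm0 cd_rhoF).prodMk (cd_clm mmpi cd_rhoF)))

/-! ### The multiplier families -/

lemma norm_X_le {f : X} {C : ℝ} (hC : 0 ≤ C) (h : ∀ x ∈ Set.Icc (0:ℝ) π, |ext f x| ≤ C) : ‖f‖ ≤ C := by
  rw [ContinuousMap.norm_le _ hC]
  intro x
  rw [← ext_coe]; exact h x x.2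

lemma ex_norm_le {c : ℝ} (hc : c ≤ 0) : ‖ex c‖ ≤ 1 := norm_X_le zero_le_one (fun x hx => by
  rw [ext_ex c hx, abs_of_pos (Real.exp_pos _)]
  exact Real.exp_le_one_iff.2 (mul_nonpos_of_nonpos_of_nonneg hc hx.1))
lemma exd_norm_le {c : ℝ} (hc : c ≤ 0) : ‖exd c‖ ≤ 1 := norm_X_le zero_le_one (fun x hx => by
  rw [ext_exd c hx, abs_of_pos (Real.exp_pos _)]
  exact Real.exp_le_one_iff.2 (mul_nonpos_of_nonpos_of_nonneg hc (sub_nonneg.2 hx.2)))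

/-- `|e^{-kτx} - e^{-kτ'x}| ≤ |τ - τ'|` for `τ, τ' ≥ 1`. -/
lemma exp_lip {y τ τ' : ℝ} (hy : 0 ≤ y) (h : 1 ≤ τ) (h' : 1 ≤ τ') :
    |Real.exp (-τ*y) - Real.exp (-τ'*y)| ≤ |τ - τ'| := by
  wlog hle : τ ≤ τ' generalizing τ τ'
  · rw [abs_sub_comm, abs_sub_comm τ]; exact this h' h (le_of_not_ge hle)
  have h1 : Real.exp (-τ'*y) ≤ Real.exp (-τ*y) := Real.exp_le_exp.2 (by nlinarith)
  rw [abs_of_nonneg (by linarith), abs_sub_comm, abs_of_nonneg (by linarith)]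
  have h2 : Real.exp (-τ'*y) = Real.exp (-τ*y) * Real.exp (-((τ'-τ)*y)) := by
    rw [← Real.exp_add]; congr 1; ring
  have h3 : 1 - (τ'-τ)*y ≤ Real.exp (-((τ'-τ)*y)) := by
    have := Real.add_one_le_exp (-((τ'-τ)*y)); linarith
  have h4 : y * Real.exp (-τ*y) ≤ 1 := by
    have h5 : y ≤ Real.exp (τ*y) := by
      have := Real.add_one_le_exp (τ*y); nlinarith
    have h6 : Real.exp (τ*y) * Real.exp (-τ*y) = 1 := by rw [← Real.exp_add]; simp
    calc _ ≤ Real.exp (τ*y) * Real.exp (-τ*y) := by gcongr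
      _ = 1 := h6
  have h7 := Real.exp_pos (-τ*y)
  rw [h2]
  nlinarith

lemma ex_lip {k τ τ' : ℝ} (hk : 0 ≤ k) (h : 1 ≤ τ) (h' : 1 ≤ τ') :
    ‖ex (-(k*τ)) - ex (-(k*τ'))‖ ≤ |τ - τ'| := norm_X_le (abs_nonneg _) (fun x hx => by
  rw [ext_sub, ext_ex _ hx, ext_ex _ hx]
  have := exp_lip (mul_nonneg hk hx.1) h h'
  convert this using 4 <;> ring)
lemma exd_lip {k τ τ' : ℝ} (hk : 0 ≤ k) (h : 1 ≤ τ) (h' : 1 ≤ τ') :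
    ‖exd (-(k*τ)) - exd (-(k*τ'))‖ ≤ |τ - τ'| := norm_X_le (abs_nonneg _) (fun x hx => by
  rw [ext_sub, ext_exd _ hx, ext_exd _ hx]
  have := exp_lip (mul_nonneg hk (sub_nonneg.2 hx.2)) h h'
  convert this using 4 <;> ring)

/-- diagonal multipliers from a bounded sequence in `X` -/
def dm (m : ℕ → X) (C : ℝ) (h : ∀ n, ‖m n‖ ≤ C) : L1 ℝ →L[ℝ] L1 X :=
  diag (fun n => ContinuousLinearMap.toSpanSingleton ℝ (m n)) C (fun n => by
    rw [ContinuousLinearMap.norm_toSpanSingleton]; exact h n)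
lemma dm_apply (m : ℕ → X) (C : ℝ) (h : ∀ n, ‖m n‖ ≤ C) (A : L1 ℝ) (n : ℕ) :
    dm m C h A n = A n • m n := rfl

def Ta (τ : ℝ) : L1 ℝ →L[ℝ] L1 X := dm (fun n => ex (-(kk n * max τ 1))) 1 (fun n => ex_norm_le (by
  have := kk_pos n
  have h : 0 < max τ 1 := lt_of_lt_of_le one_pos (le_max_right _ _)
  have := mul_pos this h
  linarith))
def Td (τ : ℝ) : L1 ℝ →L[ℝ] L1 X := dm (fun n => exd (-(kk n * max τ 1))) 1 (fun n => exd_norm_le (by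
  have := kk_pos n
  have h : 0 < max τ 1 := lt_of_lt_of_le one_pos (le_max_right _ _)
  have := mul_pos this h
  linarith))
lemma Ta_apply {τ : ℝ} (h : 1 ≤ τ) (A : L1 ℝ) (n : ℕ) : Ta τ A n = A n • ex (-(kk n * τ)) := by
  unfold Ta; rw [dm_apply, max_eq_left h]
lemma Td_apply {τ : ℝ} (h : 1 ≤ τ) (A : L1 ℝ) (n : ℕ) : Td τ A n = A n • exd (-(kk n * τ)) := by
  unfold Td; rw [dm_apply, max_eq_left h]

lemma dm_lip {m m' : ℕ → X} {C C' L : ℝ} (h : ∀ n, ‖m n‖ ≤ C) (h' : ∀ n, ‖m' n‖ ≤ C')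
    (hL : ∀ n, ‖m n - m' n‖ ≤ L) (hL0 : 0 ≤ L) : ‖dm m C h - dm m' C' h'‖ ≤ L := by
  have : dm m C h - dm m' C' h' = dm (fun n => m n - m' n) L hL := by
    refine ContinuousLinearMap.ext fun A => L1.ext fun n => ?_
    change A n • m n - A n • m' n = A n • (m n - m' n)
    rw [smul_sub]
  rw [this]
  exact diag_norm_le _ _ _ hL0

lemma max_lip (τ τ' : ℝ) : |max τ 1 - max τ' 1| ≤ |τ - τ'| := abs_max_sub_max_le_abs _ _ _

lemma Ta_lip (τ τ' : ℝ) : ‖Ta τ - Ta τ'‖ ≤ |τ - τ'| :=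
  (dm_lip _ _ (fun n => ex_lip (kk_pos n).le (le_max_right _ _) (le_max_right _ _))
    (abs_nonneg _)).trans (max_lip _ _)
lemma Td_lip (τ τ' : ℝ) : ‖Td τ - Td τ'‖ ≤ |τ - τ'| :=
  (dm_lip _ _ (fun n => exd_lip (kk_pos n).le (le_max_right _ _) (le_max_right _ _))
    (abs_nonneg _)).trans (max_lip _ _)

/-- Strict differentiability of `(τ, A) ↦ T τ A` at `A = 0`. -/
lemma strict_lip {V W : Type} [NormedAddCommGroup V] [NormedSpace ℝ V] [NormedAddCommGroup W]
    [NormedSpace ℝ W] (T : ℝ → V →L[ℝ] W) (hT : ∀ τ τ', ‖T τ - T τ'‖ ≤ |τ - τ'|) (τ0 : ℝ) :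
    HasStrictFDerivAt (fun p : ℝ × V => T p.1 p.2) ((T τ0).comp (ContinuousLinearMap.snd ℝ ℝ V))
      (τ0, 0) := by
  rw [hasStrictFDerivAt_iff_isLittleO, Asymptotics.isLittleO_iff]
  intro c hc
  have : ∀ᶠ p : (ℝ × V) × (ℝ × V) in nhds ((τ0, 0), (τ0, 0)),
      ‖p.1.1 - τ0‖ < c/2 ∧ ‖p.2.2‖ < c/2 := by
    refine Filter.Eventually.and ?_ ?_
    · have : Continuous fun p : (ℝ × V) × (ℝ × V) => ‖p.1.1 - τ0‖ := by fun_prop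
      exact this.continuousAt.eventually_lt_const (by simpa using hc)
    · have : Continuous fun p : (ℝ × V) × (ℝ × V) => ‖p.2.2‖ := by fun_prop
      exact this.continuousAt.eventually_lt_const (by simpa using hc)
  filter_upwards [this] with ⟨⟨τ, A⟩, ⟨τ', A'⟩⟩ ⟨h1, h2⟩
  simp only at h1 h2
  have e : T τ A - T τ' A' - ((T τ0).comp (ContinuousLinearMap.snd ℝ ℝ V)) ((τ, A) - (τ', A')) =
      (T τ - T τ0) (A - A') + (T τ - T τ') A' := by
    simp only [ContinuousLinearMap.comp_apply, Prod.mk_sub_mk, ContinuousLinearMap.coe_snd', map_sub,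
      _root_.sub_apply]
    abel
  rw [e]
  have hA : ‖A - A'‖ ≤ ‖(τ, A) - (τ', A')‖ := norm_snd_le ((τ, A) - (τ', A'))
  have ht : ‖τ - τ'‖ ≤ ‖(τ, A) - (τ', A')‖ := norm_fst_le ((τ, A) - (τ', A'))
  calc _ ≤ ‖(T τ - T τ0) (A - A')‖ + ‖(T τ - T τ') A'‖ := norm_add_le _ _
    _ ≤ ‖τ - τ0‖ * ‖A - A'‖ + ‖τ - τ'‖ * ‖A'‖ := by
      gcongr
      · exact (T τ - T τ0).le_of_opNorm_le (hT _ _) _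
      · exact (T τ - T τ').le_of_opNorm_le (hT _ _) _
    _ ≤ c/2 * ‖(τ, A) - (τ', A')‖ + ‖(τ, A) - (τ', A')‖ * (c/2) := by gcongr
    _ = _ := by ring

def iota (p : (ℝ × ℝ) × ET) : QT :=
  (p.1.1, p.1.2, p.2.1, p.2.2.1, Ta p.2.1.2.1 p.2.2.2.1, Td p.2.1.2.1 p.2.2.2.2)

def Phi (p : (ℝ × ℝ) × ET) : FT := Psi (iota p)

lemma iota_strict (p0 : ℝ × ℝ) (z : ZT) : ∃ L : (ℝ × ℝ) × ET →L[ℝ] QT, HasStrictFDerivAt iota L (p0,(z,0)) := by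
  have ca : ContDiff ℝ 1 (fun p : (ℝ × ℝ) × ET => (p.2.1.2.1, p.2.2.2.1)) := by fun_prop
  have cd : ContDiff ℝ 1 (fun p : (ℝ × ℝ) × ET => (p.2.1.2.1, p.2.2.2.2)) := by fun_prop
  have ha := (strict_lip Ta Ta_lip z.2.1).comp (f := fun p : (ℝ × ℝ) × ET => (p.2.1.2.1, p.2.2.2.1))
    (p0,(z,0)) (ca.contDiffAt.hasStrictFDerivAt (by norm_num))
  have hd := (strict_lip Td Td_lip z.2.1).comp (f := fun p : (ℝ × ℝ) × ET => (p.2.1.2.1, p.2.2.2.2))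
    (p0,(z,0)) (cd.contDiffAt.hasStrictFDerivAt (by norm_num))
  have h1 : ContDiff ℝ 1 (fun p : (ℝ × ℝ) × ET => p.1.1) := by fun_prop
  have h2 : ContDiff ℝ 1 (fun p : (ℝ × ℝ) × ET => p.1.2) := by fun_prop
  have h3 : ContDiff ℝ 1 (fun p : (ℝ × ℝ) × ET => p.2.1) := by fun_prop
  have h4 : ContDiff ℝ 1 (fun p : (ℝ × ℝ) × ET => p.2.2.1) := by fun_prop
  exact ⟨_, (h1.contDiffAt.hasStrictFDerivAt (by norm_num)).prodMk
    ((h2.contDiffAt.hasStrictFDerivAt (by norm_num)).prodMk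
    ((h3.contDiffAt.hasStrictFDerivAt (by norm_num)).prodMk
    ((h4.contDiffAt.hasStrictFDerivAt (by norm_num)).prodMk (ha.prodMk hd))))⟩

lemma Phi_strict (p0 : ℝ × ℝ) (z : ZT) : ∃ L : (ℝ × ℝ) × ET →L[ℝ] FT, HasStrictFDerivAt Phi L (p0,(z,0)) := by
  obtain ⟨L, hL⟩ := iota_strict p0 z
  exact ⟨_, (cd_Psi.contDiffAt.hasStrictFDerivAt (by norm_num)).comp _ hL⟩

end Schiffer
end

set_option linter.unusedSectionVars false
set_option linter.unusedSimpArgs false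
noncomputable section
namespace Schiffer

/-! ### Solvability of the linear blocks -/

lemma cs_one_pi : Real.cos (1 * π) = -1 := by simp
lemma I0_cs1 (r : X) : I0 ((r + V r) * cs 1) = - I0 r := by
  have := I0_cos r 1
  simpa using this
lemma I0_sn1 (r : X) : I0 ((r + V r) * sn 1) = I1 r := by
  have := I0_sin r 1
  simpa using this
lemma I0_cs2 (r : X) : I0 ((r + (4:ℝ) • V r) * cs 2) = I0 r := by
  have := I0_cos r 2
  rw [show ((2:ℝ)^2) = 4 by norm_num, Real.cos_two_pi, Real.sin_two_pi] at this
  simpa using this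

lemma volt1_inj (y y' : X) (h : y + V y = y' + V y') : y = y' := by
  have := volterra_inj 1 (y - y') (by
    rw [map_sub, one_pow, one_smul]
    have := sub_eq_zero.2 h
    rw [← this]; abel)
  exact sub_eq_zero.1 this
lemma volt4_inj (y y' : X) (h : y + (4:ℝ) • V y = y' + (4:ℝ) • V y') : y = y' := by
  have := volterra_inj 2 (y - y') (by
    rw [map_sub, show ((2:ℝ)^2) = 4 by norm_num, smul_sub]
    have := sub_eq_zero.2 h
    rw [← this]; abel)
  exact sub_eq_zero.1 this
lemma volt1_surj (f : X) : ∃ y : X, y + V y = f := by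
  simpa using volterra_surj 1 one_ne_zero f
lemma volt4_surj (f : X) : ∃ y : X, y + (4:ℝ) • V y = f := by
  have := volterra_surj 2 two_ne_zero f
  rwa [show ((2:ℝ)^2) = 4 by norm_num] at this

lemma block0 (w : X) (hw : I0 (w * cs 2) ≠ 0) (f : X) (g : ℝ) :
    ∃! p : ℝ × X, p.2 - V (-(p.1 • w + (4:ℝ) • p.2)) = f ∧ I0 (-(p.1 • w + (4:ℝ) • p.2)) = g := by
  have key : ∀ p : ℝ × X, p.2 - V (-(p.1 • w + (4:ℝ) • p.2)) = f →
      (-(p.1 • w + (4:ℝ) • p.2)) + (4:ℝ) • V (-(p.1 • w + (4:ℝ) • p.2)) =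
        -(p.1 • w + (4:ℝ) • f) := by
    intro p h
    rw [← h]
    generalize V (-(p.1 • w + (4:ℝ) • p.2)) = v
    module
  have key2 : ∀ p : ℝ × X, p.2 - V (-(p.1 • w + (4:ℝ) • p.2)) = f →
      I0 (-(p.1 • w + (4:ℝ) • p.2)) = - (p.1 * I0 (w * cs 2) + 4 * I0 (f * cs 2)) := by
    intro p h
    rw [← I0_cs2, key p h, neg_mul, map_neg, add_mul, map_add, smul_mul_assoc, smul_mul_assoc,
      map_smul, map_smul]
    rfl
  set l : ℝ := -(g + 4 * I0 (f * cs 2)) / I0 (w * cs 2) with hl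
  obtain ⟨r, hr⟩ := volt4_surj (-(l • w + (4:ℝ) • f))
  have hsol : -(l • w + (4:ℝ) • (f + V r)) = r := by
    rw [smul_add, ← add_assoc, neg_add, ← hr]; abel
  refine ⟨(l, f + V r), ⟨?_, ?_⟩, ?_⟩
  · simp only; rw [hsol]; abel
  · rw [key2]
    · simp only [hl]; field_simp; ring
    · simp only; rw [hsol]; abel
  · rintro ⟨l', y⟩ ⟨h1, h2⟩
    have h3 := key2 (l', y) h1
    have h4 := key (l', y) h1
    rw [h2] at h3
    simp only at h1 h3 h4
    have hl' : l' = l := by rw [hl]; field_simp; linarith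
    rw [hl'] at h4 h1
    rw [← hr] at h4
    have h5 := volt4_inj _ _ h4
    rw [h5] at h1
    rw [← h1, hl', sub_add_cancel]

lemma block1 (Rt Rd : X) (h1 : I0 (Rt * cs 1) = 0) (h2 : I0 (Rt * sn 1) ≠ 0) (h3 : I0 (Rd * cs 1) ≠ 0)
    (N f : X) (g g' : ℝ) :
    ∃! p : ℝ × ℝ × X, p.2.2 - V (-p.2.2 + N + p.1 • Rt + p.2.1 • Rd) = f ∧
      I0 (-p.2.2 + N + p.1 • Rt + p.2.1 • Rd) = g ∧ I1 (-p.2.2 + N + p.1 • Rt + p.2.1 • Rd) = g' := by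
  have key : ∀ p : ℝ × ℝ × X, p.2.2 - V (-p.2.2 + N + p.1 • Rt + p.2.1 • Rd) = f →
      (-p.2.2 + N + p.1 • Rt + p.2.1 • Rd) + V (-p.2.2 + N + p.1 • Rt + p.2.1 • Rd) =
        N + p.1 • Rt + p.2.1 • Rd - f := by
    intro p h
    rw [← h]; abel
  have key2 : ∀ p : ℝ × ℝ × X, p.2.2 - V (-p.2.2 + N + p.1 • Rt + p.2.1 • Rd) = f →
      I0 (-p.2.2 + N + p.1 • Rt + p.2.1 • Rd) = - (p.2.1 * I0 (Rd * cs 1) + I0 ((N-f) * cs 1)) ∧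
      I1 (-p.2.2 + N + p.1 • Rt + p.2.1 • Rd) = p.1 * I0 (Rt * sn 1) + p.2.1 * I0 (Rd * sn 1)
        + I0 ((N-f) * sn 1) := by
    intro p h
    have e : N + p.1 • Rt + p.2.1 • Rd - f = p.1 • Rt + p.2.1 • Rd + (N - f) := by abel
    constructor
    · rw [← neg_neg (I0 _), ← I0_cs1, key p h, e, add_mul, add_mul, map_add, map_add,
        smul_mul_assoc, smul_mul_assoc, map_smul, map_smul, h1]
      simp
    · rw [← I0_sn1, key p h, e, add_mul, add_mul, map_add, map_add,
        smul_mul_assoc, smul_mul_assoc, map_smul, map_smul]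
      rfl
  set d : ℝ := -(g + I0 ((N-f) * cs 1)) / I0 (Rd * cs 1) with hd
  set t : ℝ := (g' - d * I0 (Rd * sn 1) - I0 ((N-f) * sn 1)) / I0 (Rt * sn 1) with ht
  obtain ⟨r, hr⟩ := volt1_surj (N + t • Rt + d • Rd - f)
  have hsol : -(f + V r) + N + t • Rt + d • Rd = r := by
    calc -(f + V r) + N + t • Rt + d • Rd = (N + t • Rt + d • Rd - f) - V r := by abel
      _ = r := by rw [← hr]; abel
  refine ⟨(t, d, f + V r), ⟨?_, ?_, ?_⟩, ?_⟩
  · simp only; rw [hsol]; abel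
  · rw [(key2 _ ?_).1]
    · simp only [hd]; field_simp; ring
    · simp only; rw [hsol]; abel
  · rw [(key2 _ ?_).2]
    · simp only [ht]; field_simp; ring
    · simp only; rw [hsol]; abel
  · rintro ⟨t', d', y⟩ ⟨e1, e2, e3⟩
    obtain ⟨e4, e5⟩ := key2 (t', d', y) e1
    have h4 := key (t', d', y) e1
    rw [e2] at e4
    rw [e3] at e5
    simp only at e1 e4 e5 h4
    have hd' : d' = d := by rw [hd]; field_simp; linarith
    rw [hd'] at e5 h4 e1
    have ht' : t' = t := by rw [ht]; field_simp; linarith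
    rw [ht'] at h4 e1
    rw [← hr] at h4
    have h5 := volt1_inj _ _ h4
    rw [h5] at e1
    rw [← e1, hd', ht', sub_add_cancel]

/-! ### Integrals -/

lemma I0_ex_cs (c ω : ℝ) (h : c^2 + ω^2 ≠ 0) : I0 (ex c * cs ω) =
    (Real.exp (c*π) * (c * Real.cos (ω*π) + ω * Real.sin (ω*π)) - c) / (c^2+ω^2) := by
  rw [I0_eq_of_deriv _ (fun x => Real.exp (c*x) * (c * Real.cos (ω*x) + ω * Real.sin (ω*x)) / (c^2+ω^2))]
  · simp; ring
  · intro x hx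
    have h1 := ((hasDerivAt_expm c x).mul (((hasDerivAt_cosm ω x).const_mul c).add
      ((hasDerivAt_sinm ω x).const_mul ω))).div_const (c^2+ω^2)
    refine h1.congr_deriv ?_
    rw [ext_mul, ext_ex _ hx, ext_cs _ hx]
    simp only [Pi.add_apply]
    field_simp
    ring

lemma I0_ex_cs2 (c : ℝ) : I0 (ex c * cs 2) = c * (Real.exp (c*π) - 1) / (c^2+4) := by
  rw [I0_ex_cs c 2 (by positivity), Real.cos_two_pi, Real.sin_two_pi]
  norm_num; ring

lemma ex_mul_ex (c d : ℝ) : ex c * ex d = ex (c + d) := by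
  refine ContinuousMap.ext fun x => ?_
  change Real.exp _ * Real.exp _ = Real.exp _
  rw [← Real.exp_add]; ring_nf

def pk (n : ℕ) : ℝ := nu n * ((nu n + √3 * kk n) * (1 - Real.exp (-(nu n + √3 * kk n)*π)) /
  ((nu n + √3 * kk n)^2+4))
def qk (n : ℕ) : ℝ := nu n * ((√3 * kk n - nu n) * (Real.exp (-nu n*π) - Real.exp (-(√3 * kk n)*π)) /
  ((√3 * kk n - nu n)^2+4))

lemma mom_a0 (n : ℕ) : m0 (nu n) (cs 2 * ex (-(kk n * √3))) = pk n := by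
  rw [m0_apply, show ex (-nu n) * (cs 2 * ex (-(kk n * √3))) = ex (-nu n) * ex (-(kk n * √3)) * cs 2 by ring,
    ex_mul_ex, I0_ex_cs2, pk]
  congr 1
  rw [show -nu n + -(kk n * √3) = -(nu n + √3 * kk n) by ring]
  ring
lemma mom_d0 (n : ℕ) : m0 (nu n) (cs 2 * exd (-(kk n * √3))) = qk n := by
  rw [m0_apply, exd_eq_ex, show ex (-nu n) * (cs 2 * (Real.exp (-(kk n * √3) * π) • ex (- -(kk n * √3)))) =
    Real.exp (-(kk n * √3) * π) • (ex (-nu n) * ex (- -(kk n * √3)) * cs 2) by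
      rw [mul_smul_comm, mul_smul_comm]; congr 1; ring,
    ex_mul_ex, map_smul, I0_ex_cs2, qk, smul_eq_mul]
  congr 1
  rw [show -nu n + -(-(kk n * √3)) = √3 * kk n - nu n by ring, ← mul_div_assoc]
  congr 1
  have : Real.exp (-nu n * π) = Real.exp (-(√3 * kk n)*π) * Real.exp ((√3 * kk n - nu n) * π) := by
    rw [← Real.exp_add]; congr 1; ring
  rw [this, mul_comm (kk n)]; ring
lemma mom_api (n : ℕ) : mpi (nu n) (cs 2 * ex (-(kk n * √3))) = qk n := by
  rw [mpi_apply, exd_eq_ex, show (Real.exp (-nu n * π) • ex (- -nu n)) * (cs 2 * ex (-(kk n * √3))) =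
    Real.exp (-nu n * π) • (ex (- -nu n) * ex (-(kk n * √3)) * cs 2) by
      rw [smul_mul_assoc]; congr 1; ring,
    ex_mul_ex, map_smul, I0_ex_cs2, qk, smul_eq_mul]
  congr 1
  rw [show - -nu n + -(kk n * √3) = -(√3 * kk n - nu n) by ring, ← mul_div_assoc, neg_sq]
  congr 1
  have : Real.exp (-(√3 * kk n)*π) = Real.exp (-nu n * π) * Real.exp (-(√3 * kk n - nu n) * π) := by
    rw [← Real.exp_add]; congr 1; ring
  rw [this]; ring
lemma mom_dpi (n : ℕ) : mpi (nu n) (cs 2 * exd (-(kk n * √3))) = pk n := by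
  rw [mpi_apply, exd_eq_ex, exd_eq_ex, show (Real.exp (-nu n * π) • ex (- -nu n)) *
      (cs 2 * (Real.exp (-(kk n * √3) * π) • ex (- -(kk n * √3)))) =
    (Real.exp (-nu n * π) * Real.exp (-(kk n * √3) * π)) • (ex (- -nu n) * ex (- -(kk n * √3)) * cs 2) by
      rw [smul_mul_assoc, mul_smul_comm, mul_smul_comm, smul_smul]; congr 1; ring,
    ex_mul_ex, map_smul, I0_ex_cs2, pk, smul_eq_mul]
  congr 1
  rw [show - -nu n + -(-(kk n * √3)) = nu n + √3 * kk n by ring, ← mul_div_assoc, ← Real.exp_add,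
    show -nu n * π + -(kk n * √3) * π = -(nu n + √3 * kk n)*π by ring]
  congr 1
  have : Real.exp (-(nu n + √3 * kk n)*π) * Real.exp ((nu n + √3 * kk n)*π) = 1 := by
    rw [← Real.exp_add, show -(nu n + √3 * kk n)*π + (nu n + √3 * kk n)*π = (0:ℝ) by ring, Real.exp_zero]
  linear_combination (nu n + √3 * kk n) * this

lemma exp_neg_le {y : ℝ} (hy : 0 ≤ y) : Real.exp (-y) ≤ 1/(1+y) := by
  rw [Real.exp_neg, ← one_div]
  apply one_div_le_one_div_of_le (by linarith)
  have := Real.add_one_le_exp y; linarith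

lemma pq_bound (n : ℕ) : 0 ≤ qk n ∧ 1/5 ≤ pk n - qk n := by
  have hk := kk_ge n
  have hν := nu_pos n
  have hs := nu_sq n
  have h3 : √3^2 = 3 := Real.sq_sqrt (by norm_num)
  have h3p : 0 < √3 := by positivity
  set ν := nu n
  set m := √3 * kk n with hm
  have hm2 : m^2 = ν^2 + 4 := by rw [hm, mul_pow, h3, hs]; ring
  have hmp : 0 < m := by positivity
  have hlt : ν < m := by nlinarith
  have hν8 : 8 ≤ ν^2 := by rw [hs]; nlinarith
  have hν28 : 2.8 ≤ ν := by nlinarith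
  have hm15 : m ≤ 1.25 * ν := by nlinarith
  have hσδ : (m - ν) * (ν + m) = 4 := by nlinarith
  have hpi := Real.pi_gt_three
  have hδ : 0 < m - ν := by linarith
  have hδ1 : m - ν ≤ 1 := by nlinarith
  have e1 : Real.exp (-m*π) ≤ Real.exp (-ν*π) := Real.exp_le_exp.2 (by nlinarith)
  have e2 : Real.exp (-ν*π) ≤ 1/9 := by
    have := exp_neg_le (y := ν*π) (by positivity)
    rw [neg_mul]
    refine this.trans (one_div_le_one_div_of_le (by norm_num) ?_)
    nlinarith
  have e3 : Real.exp (-(ν+m)*π) ≤ 1/9 := by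
    refine le_trans (Real.exp_le_exp.2 ?_) e2
    nlinarith
  have e4 := Real.exp_pos (-m*π)
  have hq : qk n ≤ 1/18 := by
    have : qk n = (ν * (m - ν)) * (Real.exp (-ν*π) - Real.exp (-m*π)) / ((m-ν)^2+4) := by
      unfold qk; rw [← mul_div_assoc]; congr 1; ring
    rw [this, div_le_iff₀ (by positivity)]
    have h1 : ν * (m - ν) ≤ 2 := by nlinarith
    have h0 : 0 ≤ ν * (m-ν) := by positivity
    calc _ ≤ 2 * (1/9 : ℝ) := by
          apply mul_le_mul h1 (by linarith) (by linarith) (by norm_num)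
      _ ≤ _ := by nlinarith
  have hp : 0.3 ≤ pk n := by
    have : pk n = (ν * (ν+m)) * (1 - Real.exp (-(ν+m)*π)) / ((ν+m)^2+4) := by
      unfold pk; rw [← mul_div_assoc]; congr 1; ring
    rw [this, le_div_iff₀ (by positivity)]
    have h0 : 0 ≤ ν * (ν+m) := by positivity
    calc _ ≤ (ν * (ν+m)) * (8/9) := by nlinarith
      _ ≤ _ := by
        apply mul_le_mul_of_nonneg_left _ h0; linarith
  refine ⟨?_, by linarith⟩
  unfold qk
  have : 0 ≤ Real.exp (-ν*π) - Real.exp (-m*π) := by linarith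
  positivity

lemma L1.mul_mem (A : L1 ℝ) (c : ℕ → ℝ) (C : ℝ) (h : ∀ n, |c n| ≤ C) : Summable fun n => ‖c n * A n‖ := by
  refine Summable.of_nonneg_of_le (fun _ => norm_nonneg _) (fun n => ?_) ((L1.summable A).mul_left C)
  rw [norm_mul]; gcongr; exact h n

def drho (A D : L1 ℝ) : L1 X := -((8:ℝ) • Mp (sgl 0 (cs 2)) (Ta (√3) A + Td (√3) D))

lemma one_le_sqrt3 : (1:ℝ) ≤ √3 := by
  rw [show (1:ℝ) = √1 by simp]; exact Real.sqrt_le_sqrt (by norm_num)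

lemma drho_apply (A D : L1 ℝ) (n : ℕ) : drho A D n =
    -((8:ℝ) • (A n • (cs 2 * ex (-(kk n * √3))) + D n • (cs 2 * exd (-(kk n * √3))))) := by
  have h := ml_apply (cs 2) (Ta (√3) A + Td (√3) D) n
  unfold ml at h
  unfold drho
  rw [L1.neg_apply, L1.smul_apply, h, L1.add_apply, Ta_apply one_le_sqrt3, Td_apply one_le_sqrt3, mul_add,
    mul_smul_comm, mul_smul_comm]

lemma mm0_drho (A D : L1 ℝ) (n : ℕ) : mm0 (drho A D) n = -8 * (A n * pk n + D n * qk n) := by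
  rw [mm0_apply, drho_apply, map_neg, map_smul, map_add, map_smul, map_smul, mom_a0, mom_d0]
  simp only [smul_eq_mul]; ring
lemma mmpi_drho (A D : L1 ℝ) (n : ℕ) : mmpi (drho A D) n = -8 * (A n * qk n + D n * pk n) := by
  rw [mmpi_apply, drho_apply, map_neg, map_smul, map_add, map_smul, map_smul, mom_api, mom_dpi]
  simp only [smul_eq_mul]; ring

lemma blockM (F : L1 X) (G G' : L1 ℝ) : ∃! p : MT,
    p.1 + KK (drho p.2.1 p.2.2) = F ∧ mm0 (drho p.2.1 p.2.2) = G ∧ mmpi (drho p.2.1 p.2.2) = G' := by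
  have hb1 : ∀ n, |1 / (pk n + qk n)| ≤ 5 := fun n => by
    obtain ⟨h1, h2⟩ := pq_bound n
    rw [abs_of_pos (by apply one_div_pos.2; linarith), div_le_iff₀ (by linarith)]; linarith
  have hb2 : ∀ n, |1 / (pk n - qk n)| ≤ 5 := fun n => by
    obtain ⟨h1, h2⟩ := pq_bound n
    rw [abs_of_pos (by apply one_div_pos.2; linarith), div_le_iff₀ (by linarith)]; linarith
  set S : L1 ℝ := L1.mk _ (L1.mul_mem (G + G') _ 5 hb1) with hS
  set T : L1 ℝ := L1.mk _ (L1.mul_mem (G - G') _ 5 hb2) with hT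
  set A : L1 ℝ := (-(1/16):ℝ) • (S + T) with hA
  set D : L1 ℝ := (-(1/16):ℝ) • (S - T) with hD
  have hAn : ∀ n, A n = -(1/16) * ((G n + G' n)/(pk n + qk n) + (G n - G' n)/(pk n - qk n)) := fun n => by
    simp only [hA, hS, hT, L1.smul_apply, L1.add_apply, L1.sub_apply, L1.mk_apply, smul_eq_mul]; ring
  have hDn : ∀ n, D n = -(1/16) * ((G n + G' n)/(pk n + qk n) - (G n - G' n)/(pk n - qk n)) := fun n => by
    simp only [hD, hS, hT, L1.smul_apply, L1.add_apply, L1.sub_apply, L1.mk_apply, smul_eq_mul]; ring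
  refine ⟨(F - KK (drho A D), A, D), ⟨by simp, ?_, ?_⟩, ?_⟩
  · ext n
    rw [mm0_drho, hAn, hDn]
    obtain ⟨h1, h2⟩ := pq_bound n
    have h3 : pk n + qk n ≠ 0 := by linarith
    have h4 : pk n - qk n ≠ 0 := by linarith
    field_simp; ring
  · ext n
    rw [mmpi_drho, hAn, hDn]
    obtain ⟨h1, h2⟩ := pq_bound n
    have h3 : pk n + qk n ≠ 0 := by linarith
    have h4 : pk n - qk n ≠ 0 := by linarith
    field_simp; ring
  · rintro ⟨ω, A', D'⟩ ⟨h1, h2, h3⟩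
    simp only at h1 h2 h3
    have hsum : ∀ n, A' n + D' n = -(1/8) * ((G n + G' n)/(pk n + qk n)) ∧
        A' n - D' n = -(1/8) * ((G n - G' n)/(pk n - qk n)) := by
      intro n
      have e1 := mm0_drho A' D' n
      have e2 := mmpi_drho A' D' n
      rw [h2] at e1
      rw [h3] at e2
      obtain ⟨h1, h2⟩ := pq_bound n
      have h3 : pk n + qk n ≠ 0 := by linarith
      have h4 : pk n - qk n ≠ 0 := by linarith
      constructor
      · field_simp; linear_combination e1 + e2
      · field_simp; linear_combination e1 - e2
    have hA' : A' = A := by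
      ext n; rw [hAn]; obtain ⟨e1, e2⟩ := hsum n; linarith
    have hD' : D' = D := by
      ext n; rw [hDn]; obtain ⟨e1, e2⟩ := hsum n; linarith
    subst hA' hD'
    rw [← h1]; simp

end Schiffer
end

set_option linter.unusedSectionVars false
set_option linter.unusedSimpArgs false
noncomputable section
namespace Schiffer

/-! ### Base point and linearization -/

def c1 : ℝ := 4 * (Real.exp (-√3 * π) - 1) / √3
def xf : X := (1/√3) • (exd (-√3) - ex (-√3))
def w1s : X := c1 • sn 1 - (2:ℝ) • (sn 2 * xf)
def Zs : ZT := (4, √3, 1, cs 2, w1s)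

lemma sq3 : √3 * √3 = 3 := Real.mul_self_sqrt (by norm_num)
lemma sq3' : √3 ^ 2 = 3 := Real.sq_sqrt (by norm_num)
lemma sq3_pos : 0 < √3 := by positivity
lemma sq3_ne : √3 ≠ 0 := sq3_pos.ne'

lemma ex_zero : ex 0 = 1 := by
  refine ContinuousMap.ext fun x => ?_
  rw [ex_apply, zero_mul, Real.exp_zero]; rfl

lemma ml_one (f : L1 X) : Mp (sgl 0 1) f = f := by
  refine L1.ext fun n => ?_
  have := ml_apply (1:X) f n
  rw [one_mul] at this
  exact this

lemma HH_one (z : ZT) (m : PT) : coord 1 (HH z m) = (2:ℝ) • (ex (-z.2.1) + z.2.2.1 • exd (-z.2.1)) := by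
  unfold HH hv avec dvec
  simp [sgl_apply]
lemma HH_zero (z : ZT) (m : PT) : coord 0 (HH z m) = 0 := by
  unfold HH hv avec dvec
  simp [sgl_apply]
lemma HH_dr (z : ZT) (m : PT) : dr (HH z m) = (2:ℝ) • (m.2.1 + m.2.2) := by
  unfold HH hv avec dvec
  refine L1.ext fun n => ?_
  simp [sgl_apply]

lemma r0F_base (z : ZT) (m : PT) : r0F 0 0 z m = -(z.1 • z.2.2.2.1) := by
  unfold r0F; simp [ex_zero]
lemma r1F_base (z : ZT) (m : PT) : r1F 0 0 z m = z.2.1^2 • z.2.2.2.2 - z.1 •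
    (z.2.2.2.2 + (2:ℝ) • (ex (-z.2.1) + z.2.2.1 • exd (-z.2.1)) * z.2.2.2.1) := by
  unfold r1F; rw [HH_one]; simp [ex_zero]
lemma rhoF_base (z : ZT) (m : PT) : rhoF 0 0 z m = (z.2.1^2-3) • m.1 - (z.1 - 4) • JJ m.1 -
    z.1 • Mp (sgl 0 z.2.2.2.1) ((2:ℝ) • (m.2.1 + m.2.2)) := by
  unfold rhoF rMF BB
  rw [HH_dr]
  simp only [mul_zero, zero_mul, ex_zero, ml_one, zero_smul, add_zero, _root_.sub_apply,
    _root_.smul_apply, ContinuousLinearMap.id_apply]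
  module

def sol (r0 r1 : X) (ρ : L1 X) (y0 y1 : X) (ω : L1 X) : FT :=
  ((y0 - V r0, I0 r0, y1 - V r1, I0 r1, I1 r1), (ω + KK ρ, mm0 ρ, mmpi ρ))

lemma Phi_eq (s ε : ℝ) (z : ZT) (m : MT) : Phi ((s, ε), (z, m)) =
    sol (r0F s ε z (m.1, Ta z.2.1 m.2.1, Td z.2.1 m.2.2)) (r1F s ε z (m.1, Ta z.2.1 m.2.1, Td z.2.1 m.2.2))
      (rhoF s ε z (m.1, Ta z.2.1 m.2.1, Td z.2.1 m.2.2)) (z.2.2.2.1 - 1) z.2.2.2.2 m.1 := by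
  simp only [Phi, iota, Psi, sol]

lemma has_sol {r0 r1 : ℝ → X} {ρ : ℝ → L1 X} {y0 y1 : ℝ → X} {ω : ℝ → L1 X}
    {r0' r1' : X} {ρ' : L1 X} {y0' y1' : X} {ω' : L1 X} {x : ℝ}
    (h1 : HasDerivAt r0 r0' x) (h2 : HasDerivAt r1 r1' x) (h3 : HasDerivAt ρ ρ' x)
    (h4 : HasDerivAt y0 y0' x) (h5 : HasDerivAt y1 y1' x) (h6 : HasDerivAt ω ω' x) :
    HasDerivAt (fun h => sol (r0 h) (r1 h) (ρ h) (y0 h) (y1 h) (ω h)) (sol r0' r1' ρ' y0' y1' ω') x :=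
  ((h4.sub (V.hasFDerivAt.comp_hasDerivAt x h1)).prodMk ((I0.hasFDerivAt.comp_hasDerivAt x h1).prodMk
    ((h5.sub (V.hasFDerivAt.comp_hasDerivAt x h2)).prodMk ((I0.hasFDerivAt.comp_hasDerivAt x h2).prodMk
    (I1.hasFDerivAt.comp_hasDerivAt x h2))))).prodMk
  ((h6.add (KK.hasFDerivAt.comp_hasDerivAt x h3)).prodMk ((mm0.hasFDerivAt.comp_hasDerivAt x h3).prodMk
    (mmpi.hasFDerivAt.comp_hasDerivAt x h3)))

/-! base equation -/

lemma exd_d (x : ℝ) : HasDerivAt (fun x => Real.exp (-√3 * (π - x))) (√3 * Real.exp (-√3 * (π - x))) x := by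
  have h : HasDerivAt (fun x : ℝ => -√3 * (π - x)) √3 x := by
    have := ((hasDerivAt_id x).const_sub π).const_mul (-√3)
    simpa using this
  refine h.exp.congr_deriv (by ring)

lemma ext_xf {x : ℝ} (hx : x ∈ Set.Icc (0:ℝ) π) : ext xf x = 1/√3 * (Real.exp (-√3 * (π - x)) - Real.exp (-√3*x)) := by
  unfold xf; rw [ext_smul, ext_sub, ext_ex _ hx, ext_exd _ hx]

def w1f (x : ℝ) : ℝ := c1 * Real.sin (1*x) - 2 * (Real.sin (2*x) *
    (1/√3 * (Real.exp (-√3 * (π - x)) - Real.exp (-√3*x))))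
def w1f' (x : ℝ) : ℝ := c1 * Real.cos (1*x) - 4 * Real.cos (2*x) *
    (1/√3 * (Real.exp (-√3 * (π - x)) - Real.exp (-√3*x))) - 2 * Real.sin (2*x) *
    (Real.exp (-√3 * (π - x)) + Real.exp (-√3*x))

lemma w1f_d (x : ℝ) : HasDerivAt w1f (w1f' x) x := by
  have h := ((hasDerivAt_sinm 1 x).const_mul c1).sub (((hasDerivAt_sinm 2 x).mul
    (((exd_d x).sub (hasDerivAt_expm (-√3) x)).const_mul (1/√3))).const_mul 2)
  refine h.congr_deriv ?_
  unfold w1f'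
  simp only [Pi.sub_apply]
  have := sq3_ne
  field_simp
  ring
lemma w1f'_d (x : ℝ) : HasDerivAt w1f' (-w1f x - 8 * (Real.exp (-√3 * (π - x)) + Real.exp (-√3*x)) * Real.cos (2*x)) x := by
  have h := (((hasDerivAt_cosm 1 x).const_mul c1).sub (((hasDerivAt_cosm 2 x).const_mul 4).mul
    (((exd_d x).sub (hasDerivAt_expm (-√3) x)).const_mul (1/√3)))).sub
     (((hasDerivAt_sinm 2 x).const_mul 2).mul ((exd_d x).add (hasDerivAt_expm (-√3) x)))
  refine h.congr_deriv ?_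
  unfold w1f
  simp only [Pi.sub_apply, Pi.add_apply]
  have := sq3_ne
  have h3 := sq3'
  generalize Real.exp (-√3 * (π - x)) = a
  generalize Real.exp (-√3 * x) = b
  generalize hS : Real.sin (2*x) = S
  generalize hC : Real.cos (2*x) = C
  field_simp
  linear_combination (-2*S*(a-b)) * h3

lemma ext_w1s {x : ℝ} (hx : x ∈ Set.Icc (0:ℝ) π) : ext w1s x = w1f x := by
  unfold w1s w1f
  rw [ext_sub, ext_smul, ext_smul, ext_mul, ext_sn _ hx, ext_sn _ hx, ext_xf hx]

lemma X_ext {f g : X} (h : ∀ x ∈ Set.Icc (0:ℝ) π, ext f x = ext g x) : f = g := by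
  refine ContinuousMap.ext fun x => ?_
  rw [← ext_coe, ← ext_coe]; exact h x x.2

def r1b : X := -w1s - (4:ℝ) • ((2:ℝ) • (ex (-√3) + exd (-√3)) * cs 2)

lemma w1f_zero : w1f 0 = 0 := by unfold w1f; simp
lemma w1f_pi : w1f π = 0 := by unfold w1f; simp
lemma w1f'_zero : w1f' 0 = 0 := by unfold w1f' c1; simp; ring
lemma w1f'_pi : w1f' π = 0 := by unfold w1f' c1; simp; ring

lemma ext_r1b {x : ℝ} (hx : x ∈ Set.Icc (0:ℝ) π) : ext r1b x =
    -w1f x - 8 * (Real.exp (-√3 * (π - x)) + Real.exp (-√3*x)) * Real.cos (2*x) := by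
  unfold r1b
  rw [ext_sub, ext_smul, ext_mul, ext_smul, ext_add, ext_ex _ hx, ext_exd _ hx, ext_cs _ hx, ← ext_w1s hx]
  change -ext w1s x - _ = _
  ring

lemma base1 : w1s - V r1b = 0 ∧ I0 r1b = 0 ∧ I1 r1b = 0 := by
  have hd : ∀ x ∈ Set.Icc (0:ℝ) π, HasDerivAt w1f' (ext r1b x) x := fun x hx => by
    rw [ext_r1b hx]; exact w1f'_d x
  have hd0 : ∀ x ∈ Set.Icc (0:ℝ) π, HasDerivAt w1f (w1f' x) x := fun x _ => w1f_d x
  refine ⟨?_, ?_, ?_⟩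
  · rw [sub_eq_zero]
    refine X_ext fun x hx => ?_
    rw [ext_V _ hx, V_of_deriv _ w1f w1f' hd0 hd w1f_zero w1f'_zero hx, ext_w1s hx]
  · rw [I0_eq, P_of_deriv _ w1f' hd w1f'_zero ⟨pi_pos.le, le_rfl⟩, w1f'_pi]
  · rw [I1_eq', V_of_deriv _ w1f w1f' hd0 hd w1f_zero w1f'_zero ⟨pi_pos.le, le_rfl⟩, w1f_pi]

lemma base0 : cs 2 - 1 - V (-((4:ℝ) • cs 2)) = 0 ∧ I0 (-((4:ℝ) • cs 2)) = 0 := by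
  have he : ∀ x ∈ Set.Icc (0:ℝ) π, ext (-((4:ℝ) • cs 2)) x = -(4 * Real.cos (2*x)) := fun x hx => by
    change -(4 * ext (cs 2) x) = _
    rw [ext_cs _ hx]
  have h1 : ∀ x ∈ Set.Icc (0:ℝ) π, HasDerivAt (fun x => Real.cos (2*x) - 1) (-(2*Real.sin (2*x))) x :=
    fun x _ => (hasDerivAt_cosm 2 x).sub_const 1
  have h2 : ∀ x ∈ Set.Icc (0:ℝ) π, HasDerivAt (fun x => -(2*Real.sin (2*x))) (ext (-((4:ℝ) • cs 2)) x) x :=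
    fun x hx => by
      rw [he x hx]
      exact (((hasDerivAt_sinm 2 x).const_mul 2).neg).congr_deriv (by ring)
  constructor
  · rw [sub_eq_zero]
    refine X_ext fun x hx => ?_
    rw [ext_V _ hx, V_of_deriv _ _ _ h1 h2 (by simp) (by simp) hx, ext_sub, ext_cs _ hx]
    rfl
  · rw [I0_eq, P_of_deriv _ _ h2 (by simp) ⟨pi_pos.le, le_rfl⟩, Real.sin_two_pi]; simp

lemma Phi_base : Phi ((0,0),(Zs,0)) = 0 := by
  rw [show (Zs, (0 : MT)) = (Zs, ((0 : L1 X), (0 : L1 ℝ), (0 : L1 ℝ))) from rfl, Phi_eq]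
  have e0 : r0F 0 0 Zs ((0:L1 X), Ta Zs.2.1 0, Td Zs.2.1 0) = -((4:ℝ) • cs 2) := r0F_base _ _
  have e1 : r1F 0 0 Zs ((0:L1 X), Ta Zs.2.1 0, Td Zs.2.1 0) = r1b := by
    rw [r1F_base]
    change √3^2 • w1s - (4:ℝ) • (w1s + (2:ℝ) • (ex (-√3) + (1:ℝ) • exd (-√3)) * cs 2) = r1b
    rw [sq3', one_smul, r1b]; module
  have e2 : rhoF 0 0 Zs ((0:L1 X), Ta Zs.2.1 0, Td Zs.2.1 0) = 0 := by
    rw [rhoF_base]; simp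
  simp only
  rw [e0, e1, e2]
  unfold sol
  have hz : Zs.2.2.2.1 = cs 2 := rfl
  have hz1 : Zs.2.2.2.2 = w1s := rfl
  rw [hz, hz1, base0.1, base0.2, base1.1, base1.2.1, base1.2.2]
  simp only [map_zero, add_zero]
  rfl

/-! derivative along lines -/

def h1s : X := (2:ℝ) • (ex (-√3) + exd (-√3))
def q1s : X := w1s + h1s * cs 2
def Rtau : X := (2*√3) • w1s + (8:ℝ) • ((xi * ex (-√3) + (π • (1:X) - xi) * exd (-√3)) * cs 2)
def RD : X := -((8:ℝ) • (exd (-√3) * cs 2))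

def dr1 (l t d : ℝ) (y0 y1 : X) : X := -y1 + (-(l • q1s + (4:ℝ) • (h1s * y0))) + t • Rtau + d • RD

lemma hasDerivAt_smul_self {V : Type} [NormedAddCommGroup V] [NormedSpace ℝ V] (σ : ℝ → V)
    (hσ : ContinuousAt σ 0) : HasDerivAt (fun h => h • σ h) (σ 0) 0 := by
  rw [hasDerivAt_iff_tendsto_slope]
  have : Filter.Tendsto σ (nhdsWithin 0 {0}ᶜ) (nhds (σ 0)) := hσ.tendsto.mono_left nhdsWithin_le_nhds
  refine this.congr' ?_
  filter_upwards [self_mem_nhdsWithin] with h hh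
  have hh : h ≠ 0 := hh
  simp [slope, smul_smul, hh]

lemma cont_T {W : Type} [NormedAddCommGroup W] [NormedSpace ℝ W] (T : ℝ → W →L[ℝ] L1 X)
    (hT : ∀ τ τ', ‖T τ - T τ'‖ ≤ |τ - τ'|) : Continuous T := by
  refine LipschitzWith.continuous (K := 1) (LipschitzWith.of_dist_le_mul fun x y => ?_)
  rw [dist_eq_norm, Real.dist_eq, NNReal.coe_one, one_mul]; exact hT x y

lemma line_deriv (l t d : ℝ) (y0 y1 : X) (ω : L1 X) (A D : L1 ℝ) :
    HasDerivAt (fun h : ℝ => Phi ((0,0), ((4 + h*l, √3 + h*t, 1 + h*d, cs 2 + h•y0, w1s + h•y1),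
      (h•ω, h•A, h•D)))) (sol (-(l • cs 2 + (4:ℝ) • y0)) (dr1 l t d y0 y1) (drho A D) y0 y1 ω) 0 := by
  have lin : ∀ a b : ℝ, HasDerivAt (fun h : ℝ => a + h*b) b 0 := fun a b => by
    have := ((hasDerivAt_id (0:ℝ)).mul_const b).const_add a
    simpa using this
  have linX : ∀ a b : X, HasDerivAt (fun h : ℝ => a + h•b) b 0 := fun a b => by
    have := ((hasDerivAt_id (0:ℝ)).smul_const b).const_add a
    simpa using this
  have linW : HasDerivAt (fun h : ℝ => h•ω) ω 0 := by
    have := ((hasDerivAt_id (0:ℝ)).smul_const ω)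
    simpa using this
  have H0 : HasDerivAt (fun h : ℝ => -((4+h*l) • (cs 2 + h•y0))) (-(l • cs 2 + (4:ℝ) • y0)) 0 := by
    refine (((lin 4 l).smul (linX (cs 2) y0)).neg).congr_deriv ?_
    simp [add_comm]
  have Hτ : HasDerivAt (fun h : ℝ => ex (-(√3 + h*t))) ((-t) • (xi * ex (-√3))) 0 := by
    have := (ex_hasDerivAt (-(√3 + 0*t))).scomp (0:ℝ) (lin √3 t).neg
    exact this.congr_deriv (by simp)
  have Hτ' : HasDerivAt (fun h : ℝ => exd (-(√3 + h*t))) ((-t) • ((π • (1:X) - xi) * exd (-√3))) 0 := by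
    have := (exd_hasDerivAt (-(√3 + 0*t))).scomp (0:ℝ) (lin √3 t).neg
    exact this.congr_deriv (by simp)
  have Hd : HasDerivAt (fun h : ℝ => (1 + h*d) • exd (-(√3 + h*t)))
      ((-t) • ((π • (1:X) - xi) * exd (-√3)) + d • exd (-√3)) 0 :=
    ((lin 1 d).smul Hτ').congr_deriv (by simp)
  have Hh : HasDerivAt (fun h : ℝ => (2:ℝ) • (ex (-(√3 + h*t)) + (1 + h*d) • exd (-(√3 + h*t))))
      ((2:ℝ) • ((-t) • (xi * ex (-√3)) + ((-t) • ((π • (1:X) - xi) * exd (-√3)) + d • exd (-√3)))) 0 :=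
    (Hτ.add Hd).const_smul (2:ℝ)
  have Hm : HasDerivAt (fun h : ℝ => (2:ℝ) • (ex (-(√3 + h*t)) + (1 + h*d) • exd (-(√3 + h*t))) * (cs 2 + h•y0))
      ((2:ℝ) • ((-t) • (xi * ex (-√3)) + ((-t) • ((π • (1:X) - xi) * exd (-√3)) + d • exd (-√3))) * cs 2
        + (2:ℝ) • (ex (-√3) + exd (-√3)) * y0) 0 :=
    (Hh.mul (linX (cs 2) y0)).congr_deriv (by simp)
  have Hs : HasDerivAt (fun h : ℝ => (w1s + h•y1) + (2:ℝ) • (ex (-(√3 + h*t)) + (1 + h*d) • exd (-(√3 + h*t))) * (cs 2 + h•y0))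
      (y1 + ((2:ℝ) • ((-t) • (xi * ex (-√3)) + ((-t) • ((π • (1:X) - xi) * exd (-√3)) + d • exd (-√3))) * cs 2
        + (2:ℝ) • (ex (-√3) + exd (-√3)) * y0)) 0 := (linX w1s y1).add Hm
  have H1 : HasDerivAt (fun h : ℝ => (√3 + h*t)^2 • (w1s + h•y1) - (4 + h*l) •
    ((w1s + h•y1) + (2:ℝ) • (ex (-(√3 + h*t)) + (1 + h*d) • exd (-(√3 + h*t))) * (cs 2 + h•y0)))
     (dr1 l t d y0 y1) 0 := by
    refine ((((lin √3 t).pow 2).smul (linX w1s y1)).sub ((lin 4 l).smul Hs)).congr_deriv ?_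
    simp only [Pi.pow_apply, zero_mul, zero_smul, add_zero, Pi.add_apply, Pi.smul_apply, sq3', one_smul,
      Pi.smul_apply', Nat.cast_ofNat, pow_one, Nat.add_one_sub_one]
    unfold dr1 q1s h1s Rtau RD
    simp only [smul_add, smul_neg, smul_sub, add_mul, neg_mul, sub_mul, smul_mul_assoc, mul_add, mul_sub,
      neg_smul, one_smul, one_mul]
    module
  have H3 : HasDerivAt (fun h : ℝ => ((√3 + h*t)^2-3) • (h•ω) - ((4+h*l) - 4) • JJ (h•ω) -
    (4+h*l) • Mp (sgl 0 (cs 2 + h•y0)) ((2:ℝ) • (Ta (√3 + h*t) (h•A) + Td (√3 + h*t) (h•D)))) (drho A D) 0 := by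
    have hc : Continuous (fun h : ℝ => ((√3 + h*t)^2-3) • ω - ((4+h*l) - 4) • JJ ω -
      (4+h*l) • Mp (sgl 0 (cs 2 + h•y0)) ((2:ℝ) • (Ta (√3 + h*t) A + Td (√3 + h*t) D))) := by
      have c1 := (cont_T Ta Ta_lip).comp (show Continuous fun h : ℝ => √3 + h*t by fun_prop)
      have c2 := (cont_T Td Td_lip).comp (show Continuous fun h : ℝ => √3 + h*t by fun_prop)
      have c3 : Continuous fun h : ℝ => (2:ℝ) • (Ta (√3 + h*t) A + Td (√3 + h*t) D) := by
        have d1 : Continuous fun h : ℝ => Ta (√3 + h*t) A := c1.clm_apply continuous_const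
        have d2 : Continuous fun h : ℝ => Td (√3 + h*t) D := c2.clm_apply continuous_const
        fun_prop
      have c4 : Continuous fun h : ℝ => Mp (sgl 0 (cs 2 + h•y0)) :=
        Mp.continuous.comp ((sgl 0).continuous.comp (by fun_prop))
      have c5 := c4.clm_apply c3
      exact (Continuous.sub (by fun_prop) (by fun_prop)).sub ((by fun_prop : Continuous fun h : ℝ => 4+h*l).smul c5)
    have := hasDerivAt_smul_self _ hc.continuousAt
    refine (this.congr_deriv ?_).congr_of_eventuallyEq (Filter.Eventually.of_forall fun h => ?_)
    · simp only [zero_mul, zero_smul, add_zero, sq3', sub_self, zero_sub]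
      unfold drho
      rw [map_smul, smul_smul]; norm_num
    · simp only [map_smul, map_add, smul_add, smul_sub]
      simp only [smul_smul]
      module
  have := has_sol H0 H1 H3 ((linX (cs 2) y0).sub_const 1) (linX w1s y1) linW
  refine this.congr_of_eventuallyEq (Filter.Eventually.of_forall fun h => ?_)
  simp only
  rw [Phi_eq, r0F_base, r1F_base, rhoF_base]

end Schiffer
end

set_option linter.unusedSectionVars false
set_option linter.unusedSimpArgs false
noncomputable section
namespace Schiffer

/-! ### Nondegeneracy -/

lemma I0_cs2_cs2 : I0 (cs 2 * cs 2) = π/2 := by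
  rw [I0_eq_of_deriv _ (fun x => x/2 + Real.sin (4*x)/8)]
  · rw [show (4:ℝ) * π = 2*π + 2*π by ring, Real.sin_add_two_pi]; simp
  · intro x hx
    refine (((hasDerivAt_id x).div_const 2).add ((hasDerivAt_sinm 4 x).div_const 8)).congr_deriv ?_
    rw [ext_mul, ext_cs _ hx, show 4*x = 2*(2*x) by ring, Real.cos_two_mul]; ring

def et (x : ℝ) : ℝ := (x * Real.exp (-√3*x) - (π - x) * Real.exp (-√3*(π-x)))/√3 -
  (Real.exp (-√3*(π-x)) - Real.exp (-√3*x))/3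
def xe (x : ℝ) : ℝ := x * Real.exp (-√3*x) + (π - x) * Real.exp (-√3*(π-x))

lemma et_d (x : ℝ) : HasDerivAt et (-xe x) x := by
  have h1 := (hasDerivAt_id x).mul (hasDerivAt_expm (-√3) x)
  have h2 := ((hasDerivAt_id x).const_sub π).mul (exd_d x)
  have h := ((h1.sub h2).div_const √3).sub (((exd_d x).sub (hasDerivAt_expm (-√3) x)).div_const 3)
  refine h.congr_deriv ?_
  unfold xe
  simp only [id]
  have := sq3_ne
  have h3 := sq3'
  generalize Real.exp (-√3 * (π - x)) = a
  generalize Real.exp (-√3 * x) = b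
  field_simp
  linear_combination (-(a+b)) * h3

lemma xe_d (x : ℝ) : HasDerivAt xe (Real.exp (-√3*x) - Real.exp (-√3*(π-x)) - √3 *
    (x * Real.exp (-√3*x) - (π - x) * Real.exp (-√3*(π-x)))) x := by
  have h1 := (hasDerivAt_id x).mul (hasDerivAt_expm (-√3) x)
  have h2 := ((hasDerivAt_id x).const_sub π).mul (exd_d x)
  refine (h1.add h2).congr_deriv ?_
  simp only [id]
  ring

def pf (x : ℝ) : ℝ := -2 * Real.sin (2*x) * et x
def pf' (x : ℝ) : ℝ := -4 * Real.cos (2*x) * et x + 2 * Real.sin (2*x) * xe x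
lemma pf_d (x : ℝ) : HasDerivAt pf (pf' x) x := by
  refine (((hasDerivAt_sinm 2 x).const_mul (-2)).mul (et_d x)).congr_deriv ?_
  unfold pf'; ring

lemma ext_Rtau {x : ℝ} (hx : x ∈ Set.Icc (0:ℝ) π) : ext Rtau x = 2*√3 * w1f x + 8 * (xe x * Real.cos (2*x)) := by
  unfold Rtau xe
  rw [ext_add, ext_smul, ext_smul, ext_mul, ext_add, ext_mul, ext_mul, ext_w1s hx, ext_ex _ hx, ext_exd _ hx,
    ext_cs _ hx, ext_sub, ext_smul]
  have h1 : ext xi x = x := ext_mkX _ _ hx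
  have h2 : ext (1:X) x = 1 := rfl
  rw [h1, h2, mul_one]

lemma pf'_d {x : ℝ} (hx : x ∈ Set.Icc (0:ℝ) π) :
    HasDerivAt pf' (ext Rtau x - 2*√3*c1 * Real.sin (1*x) - pf x) x := by
  refine ((((hasDerivAt_cosm 2 x).const_mul (-4)).mul (et_d x)).add
    (((hasDerivAt_sinm 2 x).const_mul 2).mul (xe_d x))).congr_deriv ?_
  rw [ext_Rtau hx]
  unfold pf et xe w1f
  have := sq3_ne
  have h3 := sq3'
  generalize Real.exp (-√3 * (π - x)) = a
  generalize Real.exp (-√3 * x) = b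
  generalize hS : Real.sin (2*x) = S
  generalize hC : Real.cos (2*x) = C
  field_simp
  ring_nf
  rw [h3]
  ring

lemma et_sum : et 0 + et π = 0 := by unfold et; simp; ring

lemma I0_Rtau_cs : I0 (Rtau * cs 1) = 0 := by
  rw [I0_eq_of_deriv _ (fun x => pf' x * Real.cos (1*x) + pf x * Real.sin (1*x) + √3*c1 * Real.sin (1*x)^2)]
  · have h := et_sum
    unfold pf' pf; simp; linarith
  · intro x hx
    refine ((((pf'_d hx).mul (hasDerivAt_cosm 1 x)).add ((pf_d x).mul (hasDerivAt_sinm 1 x))).add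
      (((hasDerivAt_sinm 1 x).pow 2).const_mul (√3*c1))).congr_deriv ?_
    rw [ext_mul, ext_cs _ hx]
    simp only [Nat.cast_ofNat, Nat.add_one_sub_one, pow_one]
    ring

lemma I0_Rtau_sn : I0 (Rtau * sn 1) = √3 * c1 * π := by
  rw [I0_eq_of_deriv _ (fun x => pf' x * Real.sin (1*x) - pf x * Real.cos (1*x) + √3*c1 * (x - Real.sin (1*x) * Real.cos (1*x)))]
  · unfold pf' pf; simp
  · intro x hx
    refine ((((pf'_d hx).mul (hasDerivAt_sinm 1 x)).sub ((pf_d x).mul (hasDerivAt_cosm 1 x))).add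
      (((hasDerivAt_id x).sub ((hasDerivAt_sinm 1 x).mul (hasDerivAt_cosm 1 x))).const_mul (√3*c1))).congr_deriv ?_
    rw [ext_mul, ext_sn _ hx]
    have := Real.sin_sq_add_cos_sq (1*x)
    linear_combination (-√3*c1)*this

lemma c1_neg : c1 < 0 := by
  unfold c1
  have : Real.exp (-√3*π) < 1 := by
    rw [← Real.exp_zero]
    exact Real.exp_lt_exp.2 (by have := sq3_pos; have := pi_pos; nlinarith)
  apply div_neg_of_neg_of_pos _ sq3_pos; linarith

lemma I0_RD : I0 (RD * cs 1) ≠ 0 := by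
  have e : RD * cs 1 = -((4 * Real.exp (-√3*π)) • (ex (√3) * cs 3 + ex (√3) * cs 1)) := by
    refine X_ext fun x hx => ?_
    unfold RD
    change -(8 * (ext (exd (-√3)) x * ext (cs 2) x)) * ext (cs 1) x =
      -((4 * Real.exp (-√3*π)) * (ext (ex (√3)) x * ext (cs 3) x + ext (ex (√3)) x * ext (cs 1) x))
    rw [ext_exd _ hx, ext_ex _ hx, ext_cs _ hx, ext_cs _ hx, ext_cs _ hx,
      show -√3 * (π - x) = -√3*π + √3*x by ring, Real.exp_add, one_mul, Real.cos_three_mul, Real.cos_two_mul]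
    ring
  rw [e, map_neg, map_smul, map_add, I0_ex_cs _ _ (by positivity), I0_ex_cs _ _ (by positivity),
    show (3:ℝ) * π = π + 2*π by ring, Real.cos_add_two_pi, Real.sin_add_two_pi, one_mul, Real.cos_pi, Real.sin_pi]
  have h1 := sq3_pos
  have h2 := Real.exp_pos (√3*π)
  have h3 := Real.exp_pos (-√3*π)
  have h4 : 0 < Real.exp (√3*π) * √3 + √3 := by positivity
  have h5 : (Real.exp (√3*π) * (√3 * -1 + 3 * 0) - √3) / (√3^2+3^2) < 0 :=
    div_neg_of_neg_of_pos (by linarith) (by positivity)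
  have h6 : (Real.exp (√3*π) * (√3 * -1 + 1 * 0) - √3) / (√3^2+1^2) < 0 :=
    div_neg_of_neg_of_pos (by linarith) (by positivity)
  have h7 : (4 * Real.exp (-√3*π)) • ((Real.exp (√3*π) * (√3 * -1 + 3 * 0) - √3) / (√3^2+3^2) +
    (Real.exp (√3*π) * (√3 * -1 + 1 * 0) - √3) / (√3^2+1^2)) < 0 := by
    rw [smul_eq_mul]
    apply mul_neg_of_pos_of_neg (by positivity); linarith
  intro h
  rw [neg_eq_zero] at h
  exact h7.ne h

lemma lin_bij (L : ET → FT) (hL : ∀ (l t d : ℝ) (y0 y1 : X) (ω : L1 X) (A D : L1 ℝ),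
    L ((l, t, d, y0, y1), (ω, A, D)) =
      sol (-(l • cs 2 + (4:ℝ) • y0)) (dr1 l t d y0 y1) (drho A D) y0 y1 ω) :
    Function.Bijective L := by
  rw [Function.bijective_iff_existsUnique]
  rintro ⟨⟨f0, g0, f1, g1, g1'⟩, ⟨F, G, G'⟩⟩
  obtain ⟨⟨l, y0⟩, ⟨a1, a2⟩, ua⟩ := block0 (cs 2) (by rw [I0_cs2_cs2]; positivity) f0 g0
  obtain ⟨⟨t, d, y1⟩, ⟨b1, b2, b3⟩, ub⟩ := block1 Rtau RD I0_Rtau_cs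
    (by rw [I0_Rtau_sn]
        exact mul_ne_zero (mul_ne_zero sq3_ne c1_neg.ne) pi_ne_zero) I0_RD
    (-(l • q1s + (4:ℝ) • (h1s * y0))) f1 g1 g1'
  obtain ⟨⟨ω, A, D⟩, ⟨d1, d2, d3⟩, ud⟩ := blockM F G G'
  simp only at a1 a2 b1 b2 b3 d1 d2 d3
  refine ⟨((l, t, d, y0, y1), (ω, A, D)), ?_, ?_⟩
  · beta_reduce
    rw [hL]
    unfold sol dr1
    rw [a1, a2, b1, b2, b3, d1, d2, d3]
  · rintro ⟨⟨l', t', d', y0', y1'⟩, ⟨ω', A', D'⟩⟩ h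
    replace h : L ((l', t', d', y0', y1'), (ω', A', D')) = ((f0, g0, f1, g1, g1'), (F, G, G')) := h
    rw [hL] at h
    unfold sol at h
    simp only [Prod.mk.injEq] at h
    obtain ⟨⟨e1, e2, e3, e4, e5⟩, e6, e7, e8⟩ := h
    have hA := ua (l', y0') ⟨e1, e2⟩
    simp only [Prod.mk.injEq] at hA
    obtain ⟨rfl, rfl⟩ := hA
    have hB := ub (t', d', y1') ⟨e3, e4, e5⟩
    simp only [Prod.mk.injEq] at hB
    obtain ⟨rfl, rfl, rfl⟩ := hB
    have hC := ud (ω', A', D') ⟨e6, e7, e8⟩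
    simp only [Prod.mk.injEq] at hC
    obtain ⟨rfl, rfl, rfl⟩ := hC
    rfl

lemma Phi_nondeg : ∃ L : (ℝ × ℝ) × ET →L[ℝ] FT, HasStrictFDerivAt Phi L ((0,0),(Zs,0)) ∧
    Function.Bijective (fun e : ET => L (0, e)) := by
  obtain ⟨L, hL⟩ := Phi_strict (0,0) Zs
  refine ⟨L, hL, lin_bij _ ?_⟩
  intro l t d y0 y1 ω A D
  have h1 := line_deriv l t d y0 y1 ω A D
  set v : ET := ((l, t, d, y0, y1), (ω, A, D)) with hv
  have h2 : HasDerivAt (fun h : ℝ => (((0:ℝ),(0:ℝ)), (Zs, (0:MT)) + h • v)) (0, v) 0 := by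
    have := (((hasDerivAt_id (0:ℝ)).smul_const v).const_add ((Zs, (0:MT)) : ET))
    have := (hasDerivAt_const (0:ℝ) ((0:ℝ),(0:ℝ))).prodMk this
    simpa using this
  have h3 : HasFDerivAt Phi L (((0:ℝ),(0:ℝ)), (Zs, (0:MT)) + (0:ℝ) • v) := by
    rw [zero_smul, add_zero]; exact hL.hasFDerivAt
  have h4 := h3.comp_hasDerivAt (0:ℝ) h2
  refine (HasDerivAt.unique h4 (h1.congr_of_eventuallyEq (Filter.Eventually.of_forall fun h => ?_)))
  simp only [Function.comp, hv, Zs, Prod.smul_mk, Prod.mk_add_mk, smul_eq_mul]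
  congr 2
  rw [zero_add]

end Schiffer
end

set_option linter.unusedSectionVars false
set_option linter.unusedSimpArgs false
noncomputable section
namespace Schiffer

/-! ### Abstract implicit function statement -/

lemma ift {P E F : Type} [NormedAddCommGroup P] [NormedSpace ℝ P] [NormedAddCommGroup E] [NormedSpace ℝ E]
    [NormedAddCommGroup F] [NormedSpace ℝ F] [CompleteSpace P] [CompleteSpace E] [CompleteSpace F]
    (f : P × E → F) (L : P × E →L[ℝ] F) (e0 : E) (hL : HasStrictFDerivAt f L (0, e0))
    (hb : Function.Bijective fun e : E => L (0, e)) (h0 : f (0, e0) = 0) :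
    ∃ C > (0:ℝ), ∃ η0 > (0:ℝ), ∀ η > (0:ℝ), η < η0 → ∃ δ > (0:ℝ), ∃ U : P → E,
      (∀ p : P, ‖p‖ < δ → f (p, U p) = 0 ∧ ‖U p - e0‖ < η) ∧
      (∀ p p' : P, ‖p‖ < δ → ‖p'‖ < δ → ∀ e e' : E, ‖e - e0‖ < η → ‖e' - e0‖ < η →
        ‖e - e'‖ ≤ C * max ‖p - p'‖ ‖f (p, e) - f (p', e')‖) := by
  let G : P × E → P × F := fun q => (q.1, f q)
  let T : P × E →L[ℝ] P × F := (ContinuousLinearMap.fst ℝ P E).prod L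
  have hT : ∀ q : P × E, T q = (q.1, L q) := fun q => rfl
  have hLs : ∀ q : P × E, L q = L (q.1, 0) + L (0, q.2) := fun q => by
    rw [← map_add]; simp
  have hker : T.ker = ⊥ := by
    refine LinearMap.ker_eq_bot'.2 ?_
    rintro ⟨p, e⟩ h
    have h1 : (p, L (p, e)) = (0 : P × F) := h
    have hp : p = 0 := congrArg Prod.fst h1
    subst hp
    have he : L (0, e) = 0 := congrArg Prod.snd h1
    have : e = 0 := hb.1 (by simp only; rw [he]; exact (map_zero L).symm)
    rw [this]; rfl
  have hran : T.range = ⊤ := by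
    refine LinearMap.range_eq_top.2 ?_
    rintro ⟨p, y⟩
    obtain ⟨e, he⟩ := hb.2 (y - L (p, 0))
    refine ⟨(p, e), ?_⟩
    change (p, L (p, e)) = (p, y)
    rw [hLs (p, e)]; simp only at he ⊢; rw [he]; simp
  let Te : (P × E) ≃L[ℝ] P × F := ContinuousLinearEquiv.ofBijective T hker hran
  have hTe : (Te : P × E →L[ℝ] P × F) = T := ContinuousLinearEquiv.coe_ofBijective T hker hran
  have hG : HasStrictFDerivAt G (Te : P × E →L[ℝ] P × F) (0, e0) := by
    rw [hTe]; exact hasStrictFDerivAt_fst.prodMk hL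
  have hG0 : G (0, e0) = (0, 0) := by simp only [G, h0]
  obtain ⟨C0, hC0, hC⟩ : ∃ C0 > (0:ℝ), ∀ v, ‖v‖ ≤ C0 * ‖Te v‖ := by
    refine ⟨‖(Te.symm : P × F →L[ℝ] P × E)‖ + 1, by positivity, fun v => ?_⟩
    have := (Te.symm : P × F →L[ℝ] P × E).le_opNorm (Te v)
    simp only [ContinuousLinearEquiv.coe_coe, ContinuousLinearEquiv.symm_apply_apply] at this
    nlinarith [norm_nonneg (Te v)]
  have hs := (hasStrictFDerivAt_iff_isLittleO.1 hG).def (c := 1/(2*C0)) (by positivity)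
  rw [nhds_prod_eq, Filter.eventually_prod_self_iff'] at hs
  obtain ⟨N, hN, hN2⟩ := hs
  obtain ⟨η0, hη0, hball⟩ := Metric.mem_nhds_iff.1 hN
  refine ⟨2*C0, by positivity, η0, hη0, fun η hη hηlt => ?_⟩
  have hr := hG.eventually_right_inverse
  have ht := hG.localInverse_tendsto
  rw [hG0] at hr ht
  have hc : Filter.Tendsto (fun p : P => (p, (0:F))) (nhds 0) (nhds (0, 0)) := by
    have : Continuous (fun p : P => (p, (0:F))) := by fun_prop
    exact this.tendsto' _ _ rfl
  have h1 := hc.eventually hr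
  have h2 := (ht.comp hc).eventually (Metric.ball_mem_nhds _ hη)
  obtain ⟨δ, hδ, hd⟩ := Metric.eventually_nhds_iff.1 (h1.and h2)
  refine ⟨min δ η0, by positivity, fun p => (hG.localInverse G Te (0, e0) (p, 0)).2, fun p hp => ?_, ?_⟩
  · obtain ⟨ha, hb⟩ := hd (y := p) (by rw [dist_zero_right]; exact hp.trans_le (min_le_left _ _))
    have h3 := congrArg Prod.fst ha
    have h4 := congrArg Prod.snd ha
    simp only [G] at h3 h4
    have h5 : (p, (hG.localInverse G Te (0, e0) (p, 0)).2) = hG.localInverse G Te (0, e0) (p, 0) := by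
      ext1
      · exact h3.symm
      · rfl
    refine ⟨by rw [h5]; exact h4, ?_⟩
    have := hb
    simp only [Function.comp] at this
    rw [dist_eq_norm] at this
    exact (norm_snd_le _).trans_lt this
  · intro p p' hp hp' e e' he he'
    have hm : ∀ (p : P) (e : E), ‖p‖ < min δ η0 → ‖e - e0‖ < η → (p, e) ∈ N := fun p e hp he => by
      refine hball ?_
      rw [mem_ball_iff_norm, Prod.norm_def]
      refine max_lt ?_ (he.trans hηlt)
      simpa using hp.trans_le (min_le_right _ _)
    have h3 := hN2 _ (hm p e hp he) _ (hm p' e' hp' he')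
    simp only at h3
    have h4 := hC ((p, e) - (p', e'))
    have h5 : ‖Te ((p, e) - (p', e'))‖ ≤ ‖G (p, e) - G (p', e')‖ + 1/(2*C0) * ‖(p, e) - (p', e')‖ := by
      have := norm_sub_norm_le (Te ((p, e) - (p', e'))) (G (p, e) - G (p', e'))
      rw [norm_sub_rev (Te _)] at this
      simp only [ContinuousLinearEquiv.coe_coe] at h3
      linarith
    have h6 : ‖(p, e) - (p', e')‖ ≤ 2 * C0 * ‖G (p, e) - G (p', e')‖ := by
      have h7 := mul_le_mul_of_nonneg_left h5 hC0.le
      have h8 : C0 * (1/(2*C0) * ‖(p, e) - (p', e')‖) = ‖(p, e) - (p', e')‖ / 2 := by field_simp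
      rw [mul_add, h8] at h7
      linarith
    exact (norm_snd_le ((p, e) - (p', e'))).trans h6

/-! ### structure at `s = 0` -/

lemma Phi_Z (ε : ℝ) (z : ZT) (m : MT) : (Phi ((0, ε), (z, m))).1 = (Phi ((0, ε), (z, 0))).1 := by
  rw [Phi_eq, Phi_eq]
  simp only [sol, r0F, r1F, HH_one]
  simp

lemma Phi_M (ε : ℝ) (z : ZT) : (Phi ((0, ε), (z, 0))).2 = 0 := by
  rw [Phi_eq]
  have : rhoF 0 ε z (0, 0, 0) = 0 := by
    simp only [rhoF, rMF, HH_dr]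
    simp
  have h2 : (((0:MT).1, Ta z.2.1 (0:MT).2.1, Td z.2.1 (0:MT).2.2) : PT) = (0,0,0) := by
    simp
  rw [h2, this]
  simp [sol]

lemma Mp_sgl (i j : ℕ) (u v : X) : Mp (sgl i u) (sgl j v) = sgl (i+j) ((1:ℝ) • (u * v)) := bil_sgl _ _ _ _ _ _ _
lemma Mm_sgl (u v : X) : Mm (sgl 1 u) (sgl 1 v) = sgl 0 ((1/4:ℝ) • (u * v)) := by
  refine (bil_sgl (fun i j => i - j + (j - i)) (fun i j => (1/4:ℝ)^(min i j)) (fun _ _ => quarter_le _) 1 1 u v).trans ?_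
  simp

lemma Rv_one (w u v w1 : X) : coord 1 (Rv 0 w (sgl 1 w1) (sgl 1 u) (sgl 1 v)) = 0 := by
  simp only [Rv, Pm, hv, Nv]
  rw [← map_add, ← map_smul]
  simp only [Mp_sgl, Mm_sgl, map_add, zero_smul, map_smul, coord_apply, sgl_apply, L1.add_apply, L1.smul_apply]
  simp [sgl_apply, Mp_sgl, Mm_sgl]

lemma RR_one (z : ZT) : coord 1 (RR 0 z (0,0,0)) = 0 := by
  have e1 : RR 0 z (0,0,0) = Rv 0 z.2.2.2.1 (sgl 1 z.2.2.2.2) (sgl 1 (ex (-z.2.1)))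
    (sgl 1 (z.2.2.1 • exd (-z.2.1))) := by
    simp [RR, avec, dvec, wvec]
  rw [e1]
  exact Rv_one _ _ _ _

lemma cont_aux (c : ℝ) (e : X) (σ : ℝ → X) (h : Continuous σ) : Continuous fun t : ℝ => -(c • (e * σ t)) := by
  exact ((continuous_const.mul h).const_smul c).neg

lemma Phi_s (ε : ℝ) (z : ZT) : HasDerivAt (fun h : ℝ => (Phi ((h, ε), (z, 0))).1) 0 0 := by
  have hR : Continuous fun h : ℝ => RR h z (0,0,0) := by
    have h1 : Continuous fun h : ℝ => ((h, (0:ℝ), z, ((0:L1 X),(0:L1 X),(0:L1 X))) : QT) :=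
      continuous_id.prodMk continuous_const
    have h2 := cd_RR.continuous.comp h1
    simpa only [Function.comp_def] using h2
  have c0 : Continuous fun h : ℝ => -(z.1 • (ex (2*ε*z.2.1) * (h • coord 0 (RR h z (0,0,0))))) := by
    exact cont_aux _ _ (fun h => h • coord 0 (RR h z (0,0,0))) (continuous_id.smul ((coord 0).continuous.comp hR))
  have c1 : Continuous fun h : ℝ => -(z.1 • (ex (2*ε*z.2.1) * (coord 1 (RR h z (0,0,0))))) := by
    exact cont_aux _ _ (fun h => coord 1 (RR h z (0,0,0))) ((coord 1).continuous.comp hR)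
  have d0 := (hasDerivAt_smul_self _ c0.continuousAt).const_add (-(z.1 • (ex (2*ε*z.2.1) * z.2.2.2.1)))
  have d1 := (hasDerivAt_smul_self _ c1.continuousAt).const_add (z.2.1^2 • z.2.2.2.2 - z.1 • (ex (2*ε*z.2.1) *
    (z.2.2.2.2 + coord 1 (HH z (0,0,0)) * z.2.2.2.1)))
  have := (ContinuousLinearMap.fst ℝ (X × ℝ × X × ℝ × ℝ) MT).hasFDerivAt.comp_hasDerivAt (0:ℝ)
    (has_sol d0 d1 (hasDerivAt_const (0:ℝ) (0:L1 X)) (hasDerivAt_const (0:ℝ) (z.2.2.2.1 - 1))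
    (hasDerivAt_const (0:ℝ) z.2.2.2.2) (hasDerivAt_const (0:ℝ) (0:L1 X)))
  rw [RR_one] at this
  refine (this.congr_deriv ?_).congr_of_eventuallyEq (Filter.Eventually.of_forall fun h => ?_)
  · simp [sol]
  · simp only [Function.comp_def]
    rw [Phi_eq]
    have h2 : (((0:MT).1, Ta z.2.1 (0:MT).2.1, Td z.2.1 (0:MT).2.2) : PT) = (0,0,0) := by
      simp
    rw [h2]
    have e0 : r0F h ε z (0,0,0) = -(z.1 • (ex (2*ε*z.2.1) * z.2.2.2.1)) +
      h • -(z.1 • (ex (2*ε*z.2.1) * (h • coord 0 (RR h z (0,0,0))))) := by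
      unfold r0F
      rw [mul_add, pow_two, mul_smul_comm, mul_smul_comm]
      module
    have e1 : r1F h ε z (0,0,0) = z.2.1^2 • z.2.2.2.2 - z.1 • (ex (2*ε*z.2.1) *
        (z.2.2.2.2 + coord 1 (HH z (0,0,0)) * z.2.2.2.1)) +
      h • -(z.1 • (ex (2*ε*z.2.1) * (coord 1 (RR h z (0,0,0))))) := by
      unfold r1F
      rw [mul_add _ _ (h • _), mul_smul_comm]
      module
    simp only [sol, Function.comp_def]
    rw [e0, e1]
    rfl

theorem thmA : ∀ η > (0:ℝ), ∃ ε0 > (0:ℝ), ∀ ε : ℝ, 0 < ε → ε < ε0 → ∃ s0 > (0:ℝ), ∃ U : ℝ → ET,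
    (∀ s, |s| < s0 → Phi ((s, ε), U s) = 0 ∧ ‖U s - (Zs, 0)‖ < η) ∧ (U 0).2 = 0 ∧
    ContinuousAt U 0 ∧
    (∀ c > (0:ℝ), ∃ δ > (0:ℝ), ∀ s, |s| < δ → |(U s).1.2.1 - (U 0).1.2.1| ≤ c * |s|) := by
  intro η hη
  obtain ⟨L, hL, hb⟩ := Phi_nondeg
  obtain ⟨C, hC, η0, hη0, H⟩ := ift Phi L (Zs, 0) hL hb Phi_base
  obtain ⟨δ, hδ, U, h1, h2⟩ := H (min η (η0/2)) (by positivity)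
    ((min_le_right _ _).trans_lt (by linarith))
  refine ⟨δ, hδ, fun ε hε0 hε => ⟨δ, hδ, fun s => U (s, ε), fun s hs => ?_, ?_⟩⟩
  · have := h1 (s, ε) (by rw [Prod.norm_def]; exact max_lt hs (by simpa [abs_of_pos hε0] using hε))
    exact ⟨this.1, this.2.trans_le (min_le_left _ _)⟩
  have hn : ∀ s : ℝ, |s| < δ → ‖((s, ε) : ℝ × ℝ)‖ < δ := fun s hs => by
    rw [Prod.norm_def]; exact max_lt hs (by simpa [abs_of_pos hε0] using hε)
  have hz : |(0:ℝ)| < δ := by simpa using hδ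
  have hproj : ∀ s : ℝ, |s| < δ → ‖((U (s, ε)).1, (0:MT)) - (Zs, 0)‖ < min η (η0/2) := fun s hs => by
    refine lt_of_le_of_lt ?_ (h1 _ (hn s hs)).2
    have e1 : ((U (s, ε)).1, (0:MT)) - (Zs, 0) = ((U (s, ε) - (Zs, 0)).1, 0) := by
      refine Prod.ext rfl ?_
      simp
    rw [e1, Prod.norm_def]
    refine max_le (norm_fst_le (U (s, ε) - (Zs, 0))) ?_
    rw [norm_zero]; exact norm_nonneg _
  have hM0 : (U (0, ε)).2 = 0 := by
    have h3 := h2 (0, ε) (0, ε) (hn 0 hz) (hn 0 hz) (U (0, ε)) ((U (0, ε)).1, 0) (h1 _ (hn 0 hz)).2 (hproj 0 hz)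
    have h4 : Phi ((0, ε), ((U (0, ε)).1, 0)) = 0 := by
      refine Prod.ext ?_ (Phi_M _ _)
      rw [← Phi_Z ε _ (U (0, ε)).2]
      exact congrArg Prod.fst (h1 _ (hn 0 hz)).1
    rw [(h1 _ (hn 0 hz)).1, h4] at h3
    simp only [sub_self, norm_zero, max_self, mul_zero] at h3
    have h5 := norm_le_zero_iff.1 h3
    exact congrArg Prod.snd (sub_eq_zero.1 h5)
  have hlip : ∀ s : ℝ, |s| < δ → ‖U (s, ε) - U (0, ε)‖ ≤ C * |s| := fun s hs => by
    have h3 := h2 (s, ε) (0, ε) (hn s hs) (hn 0 hz) (U (s, ε)) (U (0, ε)) (h1 _ (hn s hs)).2 (h1 _ (hn 0 hz)).2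
    rw [(h1 _ (hn 0 hz)).1, (h1 _ (hn s hs)).1] at h3
    simpa [Prod.norm_def] using h3
  have hcont : ContinuousAt (fun s : ℝ => U (s, ε)) 0 := by
    rw [ContinuousAt, tendsto_iff_norm_sub_tendsto_zero]
    refine squeeze_zero' (Filter.Eventually.of_forall fun _ => norm_nonneg _) (g := fun s : ℝ => C * |s|) ?_ ?_
    · filter_upwards [Metric.ball_mem_nhds (0:ℝ) hδ] with s hs
      exact hlip s (by simpa using hs)
    · have : Continuous fun s : ℝ => C * |s| := by fun_prop
      exact this.tendsto' _ _ (by simp)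
  refine ⟨hM0, hcont, fun c hc => ?_⟩
  have hU0 : U (0, ε) = ((U (0, ε)).1, 0) := Prod.ext rfl hM0
  obtain ⟨L', hL'⟩ := Phi_strict (0, ε) (U (0, ε)).1
  rw [← hU0] at hL'
  have hs := (hasStrictFDerivAt_iff_isLittleO.1 hL').def (c := c / C) (by positivity)
  have hc1 : Filter.Tendsto (fun s : ℝ => (((s, ε), U (s, ε)), (((0:ℝ), ε), U (s, ε)))) (nhds 0)
      (nhds (((0, ε), U (0, ε)), ((0, ε), U (0, ε)))) := by
    have k1 : Filter.Tendsto (fun s : ℝ => (s, ε)) (nhds 0) (nhds (0, ε)) := by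
      have : Continuous (fun s : ℝ => (s, ε)) := by fun_prop
      exact this.tendsto' _ _ rfl
    exact (k1.prodMk_nhds hcont).prodMk_nhds (tendsto_const_nhds.prodMk_nhds hcont)
  obtain ⟨δ', hδ', hd⟩ := Metric.eventually_nhds_iff.1 (hc1.eventually hs)
  have hL1 : (L' ((1, 0), 0)).1 = 0 := by
    have k1 := Phi_s ε (U (0, ε)).1
    rw [← hU0] at k1
    have k2 : HasDerivAt (fun h : ℝ => ((h, ε), U (0, ε))) ((1, 0), 0) 0 :=
      ((hasDerivAt_id (0:ℝ)).prodMk (hasDerivAt_const _ _)).prodMk (hasDerivAt_const _ _)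
    have k3 := (ContinuousLinearMap.fst ℝ (X × ℝ × X × ℝ × ℝ) MT).hasFDerivAt.comp_hasDerivAt (0:ℝ)
      (hL'.hasFDerivAt.comp_hasDerivAt (0:ℝ) k2)
    exact k3.unique k1
  refine ⟨min δ δ', by positivity, fun s hss => ?_⟩
  have hsδ : |s| < δ := hss.trans_le (min_le_left _ _)
  have k1 := hd (y := s) (by simpa using hss.trans_le (min_le_right _ _))
  simp only at k1
  have k2 : ((s, ε), U (s, ε)) - (((0:ℝ), ε), U (s, ε)) = s • (((1, 0), 0) : (ℝ × ℝ) × ET) := by simp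
  rw [k2, map_smul, (h1 _ (hn s hsδ)).1, zero_sub] at k1
  have k3 : ‖s • (((1, 0), 0) : (ℝ × ℝ) × ET)‖ = |s| := by
    rw [norm_smul]; simp [Prod.norm_def]
  rw [k3] at k1
  have k4 := (norm_fst_le _).trans k1
  rw [Prod.fst_sub, Prod.smul_fst, hL1, smul_zero, sub_zero, Prod.fst_neg, norm_neg] at k4
  have k5 := h2 (0, ε) (0, ε) (hn 0 hz) (hn 0 hz) ((U (s, ε)).1, 0) (U (0, ε)) (hproj s hsδ) (h1 _ (hn 0 hz)).2
  rw [(h1 _ (hn 0 hz)).1] at k5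
  simp only [sub_self, norm_zero, sub_zero] at k5
  rw [max_eq_right (norm_nonneg _), Prod.norm_def (Phi _), Phi_M, norm_zero,
    max_eq_left (norm_nonneg _), ← Phi_Z ε _ (U (s, ε)).2] at k5
  have k6 : |(U (s, ε)).1.2.1 - (U (0, ε)).1.2.1| ≤ ‖((U (s, ε)).1, (0:MT)) - U (0, ε)‖ :=
    ((norm_fst_le (((U (s, ε)).1, (0:MT)) - U (0, ε)).1.2).trans (norm_snd_le _)).trans (norm_fst_le _)
  calc _ ≤ _ := k6
    _ ≤ _ := k5
    _ ≤ C * (c / C * |s|) := by gcongr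
    _ = _ := by field_simp

end Schiffer
end

set_option linter.unusedSectionVars false
set_option linter.unusedSimpArgs false
noncomputable section
namespace Schiffer

/-! ### Series of separated functions -/

/-- `c` has a summable bound, `f` has a uniform quadratic bound. -/
structure Good (c f : ℕ → ℝ → ℝ) (u : ℕ → ℝ) (N : ℝ) : Prop where
  cc : ∀ k, Continuous (c k)
  cf : ∀ k, Continuous (f k)
  su : Summable u
  bc : ∀ k y, |c k y| ≤ u k
  bf : ∀ k x, |f k x| ≤ N * (1 + x^2)

def TT (c f : ℕ → ℝ → ℝ) (x y : ℝ) : ℝ := ∑' k, c k y * f k x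

namespace Good
variable {c f c' f' : ℕ → ℝ → ℝ} {u u' : ℕ → ℝ} {N N' : ℝ}

lemma bd (h : Good c f u N) (k : ℕ) (x y : ℝ) : ‖c k y * f k x‖ ≤ u k * (N * (1 + x^2)) := by
  rw [Real.norm_eq_abs, abs_mul]
  have := h.bc k y
  have := h.bf k x
  gcongr
  exact (abs_nonneg _).trans (h.bc k y)

lemma summable (h : Good c f u N) (x y : ℝ) : Summable fun k => c k y * f k x :=
  Summable.of_norm_bounded (h.su.mul_right _) (fun k => h.bd k x y)

lemma continuous (h : Good c f u N) : Continuous fun p : ℝ × ℝ => TT c f p.1 p.2 := by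
  have e : (fun p : ℝ × ℝ => TT c f p.1 p.2) = fun p : ℝ × ℝ => (1 + p.1^2) * ∑' k, c k p.2 * (f k p.1 / (1 + p.1^2)) := by
    funext p
    unfold TT
    rw [← tsum_mul_left]
    refine tsum_congr fun k => ?_
    have : 1 + p.1^2 ≠ 0 := by positivity
    field_simp
  rw [e]
  refine (by fun_prop : Continuous fun p : ℝ × ℝ => 1 + p.1^2).mul ?_
  refine continuous_tsum (u := fun k => u k * N) (fun k => ?_) (h.su.mul_right _) (fun k p => ?_)
  · have h1 := (h.cc k).comp (continuous_snd (X := ℝ) (Y := ℝ))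
    have h2 := (h.cf k).comp (continuous_fst (X := ℝ) (Y := ℝ))
    exact h1.mul (h2.div (by fun_prop) (fun p => by positivity))
  · have h1 : 0 < 1 + p.1^2 := by positivity
    have := h.bd k p.1 p.2
    rw [← mul_div_assoc, norm_div, Real.norm_of_nonneg h1.le, div_le_iff₀ h1]
    linarith

lemma hx (h : Good c f u N) (h' : Good c f' u' N') (hd : ∀ k x, HasDerivAt (f k) (f' k x) x) (x y : ℝ) :
    HasDerivAt (fun x => TT c f x y) (TT c f' x y) x := by
  refine hasDerivAt_tsum_of_isPreconnected (u := fun k => u' k * (N' * (1 + (|x|+1)^2))) (t := Set.Ioo (-(|x|+1)) (|x|+1))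
    (h'.su.mul_right _) isOpen_Ioo isPreconnected_Ioo (fun k z _ => (hd k z).const_mul (c k y)) (fun k z hz => ?_)
    (y₀ := x) ?_ (h.summable x y) ?_
  · refine (h'.bd k z y).trans ?_
    have h1 : z^2 ≤ (|x|+1)^2 := by
      rw [sq_le_sq, abs_of_pos (by positivity : 0 < |x|+1)]
      exact (abs_lt.2 hz).le
    have h2 : 0 ≤ u' k := (abs_nonneg _).trans (h'.bc k y)
    have h3 : 0 ≤ N' := by have := (abs_nonneg _).trans (h'.bf k 0); simpa using this
    gcongr
  · constructor
    · linarith [neg_abs_le x]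
    · linarith [le_abs_self x]
  · constructor
    · linarith [neg_abs_le x]
    · linarith [le_abs_self x]

lemma hy (h : Good c f u N) (h' : Good c' f u' N') (hd : ∀ k x, HasDerivAt (c k) (c' k x) x) (x y : ℝ) :
    HasDerivAt (fun y => TT c f x y) (TT c' f x y) y :=
  hasDerivAt_tsum (u := fun k => u' k * (N' * (1 + x^2))) (h'.su.mul_right _)
    (fun k z => (hd k z).mul_const (f k x)) (fun k z => h'.bd k x z) (y₀ := y) (h.summable x y) y

end Good

/-- total derivative from continuous partial derivatives, on `ℂ` -/
lemma fderiv_of_partial (f fx fy : ℝ → ℝ → ℝ) (hx : ∀ x y, HasDerivAt (fun x => f x y) (fx x y) x)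
    (hy : ∀ x y, HasDerivAt (fun y => f x y) (fy x y) y) (cx : Continuous fun p : ℝ × ℝ => fx p.1 p.2)
    (cy : Continuous fun p : ℝ × ℝ => fy p.1 p.2) (ζ : ℂ) :
    HasFDerivAt (fun ζ : ℂ => f ζ.re ζ.im) (fx ζ.re ζ.im • Complex.reCLM + fy ζ.re ζ.im • Complex.imCLM) ζ := by
  have h := hasStrictFDerivAt_uncurry_coprod (𝕜 := ℝ) (u := (ζ.re, ζ.im)) (f := f)
    (f₁ := fun x y => ContinuousLinearMap.toSpanSingleton ℝ (fx x y))
    (f₂ := fun x y => ContinuousLinearMap.toSpanSingleton ℝ (fy x y))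
    (Filter.Eventually.of_forall fun v => (hx v.1 v.2).hasFDerivAt)
    (Filter.Eventually.of_forall fun v => (hy v.1 v.2).hasFDerivAt)
    (((ContinuousLinearMap.toSpanSingletonCLE (𝕜 := ℝ) (E := ℝ)).continuous.comp cx).continuousAt)
    (((ContinuousLinearMap.toSpanSingletonCLE (𝕜 := ℝ) (E := ℝ)).continuous.comp cy).continuousAt)
  have h2 := h.hasFDerivAt.comp (f := fun ζ : ℂ => (ζ.re, ζ.im)) ζ
    ((Complex.reCLM.prod Complex.imCLM).hasFDerivAt)
  refine (h2.congr_fderiv ?_)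
  ext v
  change v.re • fx ζ.re ζ.im + v.im • fy ζ.re ζ.im = fx ζ.re ζ.im • v.re + fy ζ.re ζ.im • v.im
  simp [mul_comm]

end Schiffer
end

set_option linter.unusedSectionVars false
set_option linter.unusedSimpArgs false
noncomputable section
namespace Schiffer

def wtot (s : ℝ) (z : ZT) (ω : L1 X) : L1 X := sgl 0 z.2.2.2.1 + s • wvec z.2.2.2.2 ω
def wdd (s : ℝ) (z : ZT) (ω : L1 X) : L1 X := s • (sgl 1 z.2.2.2.2 + sh ω)
def qtot (s ε : ℝ) (z : ZT) (m : PT) : L1 X := sgl 0 (r0F s ε z m) + s • (sgl 1 (r1F s ε z m) + sh (rMF s ε z m))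

lemma Mp_apply (u : X) (f : L1 X) (k : ℕ) : Mp (sgl 0 u) f k = u * f k := ml_apply u f k

lemma q_eq (s ε : ℝ) (z : ZT) (m : PT) : qtot s ε z m = z.2.1^2 • wdd s z m.1 - z.1 • Mp (sgl 0 (ex (2*ε*z.2.1)))
    (wtot s z m.1 + s • Mp (sgl 0 z.2.2.2.1) (HH z m) + s^2 • RR s z m) := by
  have h0 := HH_zero z m
  rw [coord_apply] at h0
  refine L1.ext fun k => ?_
  match k with
  | 0 =>
    simp only [qtot, wdd, wtot, wvec, r0F, r1F, rMF, L1.add_apply, L1.smul_apply, L1.sub_apply, Mp_apply, sgl_apply,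
      sh_apply_zero, coord_apply, h0]
    ext x
    simp
  | 1 =>
    simp only [qtot, wdd, wtot, wvec, r0F, r1F, rMF, L1.add_apply, L1.smul_apply, L1.sub_apply, Mp_apply, sgl_apply,
      sh_apply_one, coord_apply]
    ext x
    simp
    ring
  | n+2 =>
    simp only [qtot, wdd, wtot, wvec, r0F, r1F, rMF, L1.add_apply, L1.smul_apply, L1.sub_apply, Mp_apply, sgl_apply,
      sh_apply_add, coord_apply, dr_apply]
    ext x
    simp
    ring

lemma evs_sgl0 (x : Set.Icc (0:ℝ) π) (Y : ℝ) (v : X) : evs x Y (sgl 0 v) = 0 := by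
  rw [evs_apply, tsum_eq_single 0]
  · simp
  · intro j hj; simp [sgl_apply, hj]

lemma evc_sgl0 (x : Set.Icc (0:ℝ) π) (Y : ℝ) (v : X) : evc x Y (sgl 0 v) = v x := by
  rw [evc_sgl]; simp

lemma evc_ml (x : Set.Icc (0:ℝ) π) (Y : ℝ) (v : X) (f : L1 X) : evc x Y (Mp (sgl 0 v) f) = v x * evc x Y f := by
  rw [evc_Mp, evs_sgl0, evc_sgl0]; ring

lemma evc_Pm (x : Set.Icc (0:ℝ) π) (Y : ℝ) (f g : L1 X) : evc x Y (Pm f g) = evc x Y f * evc x Y g := by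
  rw [Pm, map_smul, map_add, evc_Mp, evc_Mm, smul_eq_mul]; ring

/-- the pde at the level of evaluations -/
lemma evc_q (s ε : ℝ) (z : ZT) (m : PT) (x : Set.Icc (0:ℝ) π) (Y : ℝ) :
    evc x Y (qtot s ε z m) = z.2.1^2 * evc x Y (wdd s z m.1) - z.1 * Real.exp (2*ε*z.2.1*x) *
      ((1 + s * (evc x Y (avec z.2.1 m.2.1) + evc x Y (dvec z.2.1 z.2.2.1 m.2.2)))^2
        + (s * (evs x Y (dvec z.2.1 z.2.2.1 m.2.2) - evs x Y (avec z.2.1 m.2.1)))^2) * evc x Y (wtot s z m.1) := by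
  rw [q_eq, map_sub, map_smul, map_smul, evc_ml, map_add, map_add, map_smul, map_smul, evc_ml, RR, Rv, HH]
  simp only [map_add, map_smul, evc_Pm, evc_ml, smul_eq_mul, ex_apply]
  rw [wtot, map_add, map_smul, evc_sgl0]
  simp only [hv, Nv, map_add, map_smul, evc_Mp, evc_Mm, smul_eq_mul]
  ring

/-- complex series -/
def SS (τ : ℝ) (A D : ℕ → ℝ) (ζ : ℂ) : ℂ :=
  ∑' k : ℕ, (1/2:ℂ)^k * (A k * Complex.exp (-(k*τ) * ζ) + D k * Complex.exp (-(k*τ) * (π - ζ)))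

def Ac (m : MT) : L1 ℝ := sgl 1 1 + sh m.2.1
def Dc (z : ZT) (m : MT) : L1 ℝ := sgl 1 z.2.2.1 + sh m.2.2

lemma avec_apply {τ : ℝ} (h : 1 ≤ τ) (m : MT) (k : ℕ) (x : Set.Icc (0:ℝ) π) :
    avec τ (Ta τ m.2.1) k x = Ac m k * Real.exp (-(k*τ) * x) := by
  match k with
  | 0 => simp [avec, Ac, sgl_apply]
  | 1 => simp [avec, Ac, sgl_apply, ex_apply]
  | n+2 => simp [avec, Ac, sgl_apply, Ta_apply h, ex_apply, kk]

lemma dvec_apply {z : ZT} (h : 1 ≤ z.2.1) (m : MT) (k : ℕ) (x : Set.Icc (0:ℝ) π) :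
    dvec z.2.1 z.2.2.1 (Td z.2.1 m.2.2) k x = Dc z m k * Real.exp (-(k*z.2.1) * (π - x)) := by
  match k with
  | 0 => simp [dvec, Dc, sgl_apply]
  | 1 => simp [dvec, Dc, sgl_apply, exd_apply]
  | n+2 => simp [dvec, Dc, sgl_apply, Td_apply h, exd_apply, kk]

lemma SS_eq {z : ZT} (h : 1 ≤ z.2.1) (m : MT) (x : Set.Icc (0:ℝ) π) (y : ℝ) (ζ : ℂ) (hx : ζ.re = x) (hy : ζ.im = y) :
    SS z.2.1 (Ac m) (Dc z m) ζ = ((evc x (z.2.1*y) (avec z.2.1 (Ta z.2.1 m.2.1)) +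
      evc x (z.2.1*y) (dvec z.2.1 z.2.2.1 (Td z.2.1 m.2.2)) : ℝ) : ℂ) +
      ((evs x (z.2.1*y) (dvec z.2.1 z.2.2.1 (Td z.2.1 m.2.2)) - evs x (z.2.1*y) (avec z.2.1 (Ta z.2.1 m.2.1)) : ℝ) : ℂ) * Complex.I := by
  set a := avec z.2.1 (Ta z.2.1 m.2.1)
  set d := dvec z.2.1 z.2.2.1 (Td z.2.1 m.2.2)
  set Y := z.2.1*y
  have S1 := (ev_summable x a (fun k => Real.cos (k*Y)) (fun k => abs_cos_le_one _)).of_norm.hasSum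
  have S2 := (ev_summable x d (fun k => Real.cos (k*Y)) (fun k => abs_cos_le_one _)).of_norm.hasSum
  have S3 := (ev_summable x a (fun k => Real.sin (k*Y)) (fun k => abs_sin_le_one _)).of_norm.hasSum
  have S4 := (ev_summable x d (fun k => Real.sin (k*Y)) (fun k => abs_sin_le_one _)).of_norm.hasSum
  have H1 := Complex.hasSum_ofReal.2 (S1.add S2)
  have H2 := (Complex.hasSum_ofReal.2 (S4.sub S3)).mul_right Complex.I
  have hz : ζ = (x:ℝ) + (y:ℝ) * Complex.I := by rw [← hx, ← hy]; exact (Complex.re_add_im ζ).symm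
  refine Eq.trans (tsum_congr fun k => ?_) (H1.add H2).tsum_eq
  have ea : Complex.exp (-(k*z.2.1) * ζ) = Real.exp (-(k*z.2.1) * x) * (Real.cos (k*Y) - Real.sin (k*Y) * Complex.I) := by
    have : -((k:ℂ)*z.2.1) * ζ = ((-(k*z.2.1) * x : ℝ) : ℂ) + ((-(k*Y) : ℝ) : ℂ) * Complex.I := by
      rw [hz]; simp only [Y]; push_cast; ring
    rw [this, Complex.exp_add, Complex.exp_mul_I, ← Complex.ofReal_exp, ← Complex.ofReal_cos, ← Complex.ofReal_sin,
      Real.cos_neg, Real.sin_neg]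
    push_cast; ring
  have ed : Complex.exp (-(k*z.2.1) * (π - ζ)) = Real.exp (-(k*z.2.1) * (π - x)) * (Real.cos (k*Y) + Real.sin (k*Y) * Complex.I) := by
    have : -((k:ℂ)*z.2.1) * (π - ζ) = ((-(k*z.2.1) * (π - x) : ℝ) : ℂ) + ((k*Y : ℝ) : ℂ) * Complex.I := by
      rw [hz]; simp only [Y]; push_cast; ring
    rw [this, Complex.exp_add, Complex.exp_mul_I, ← Complex.ofReal_exp, ← Complex.ofReal_cos, ← Complex.ofReal_sin]
  have h1 := avec_apply h m k x
  have h2 := dvec_apply h m k x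
  rw [ea, ed]
  simp only [a, d, h1, h2]
  push_cast
  ring

/-! ### The function W -/

def cc0 (τ : ℝ) (k : ℕ) (y : ℝ) : ℝ := (1/2:ℝ)^k * Real.cos (k*(τ*y))
def cc1 (τ : ℝ) (k : ℕ) (y : ℝ) : ℝ := (1/2:ℝ)^k * (-Real.sin (k*(τ*y)) * (k*τ))
def cc2 (τ : ℝ) (k : ℕ) (y : ℝ) : ℝ := (1/2:ℝ)^k * (-(Real.cos (k*(τ*y)) * (k*τ)) * (k*τ))
def ff0 (q : L1 X) (k : ℕ) (x : ℝ) : ℝ := (if k = 0 then 1 else 0) + ∫ t in (0:ℝ)..x, pr (q k) t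
def ff1 (q : L1 X) (k : ℕ) (x : ℝ) : ℝ := pr (q k) x
def ff2 (q : L1 X) (k : ℕ) (x : ℝ) : ℝ := ext (q k) x
def uu (τ : ℝ) (k : ℕ) : ℝ := (1/2:ℝ)^k * (1 + k*τ)^2

lemma cc0_d (τ : ℝ) (k : ℕ) (y : ℝ) : HasDerivAt (cc0 τ k) (cc1 τ k y) y := by
  have h : HasDerivAt (fun y : ℝ => (k:ℝ)*(τ*y)) (k*τ) y := by
    simpa using ((hasDerivAt_id y).const_mul τ).const_mul (k:ℝ)
  exact h.cos.const_mul _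
lemma cc1_d (τ : ℝ) (k : ℕ) (y : ℝ) : HasDerivAt (cc1 τ k) (cc2 τ k y) y := by
  have h : HasDerivAt (fun y : ℝ => (k:ℝ)*(τ*y)) (k*τ) y := by
    simpa using ((hasDerivAt_id y).const_mul τ).const_mul (k:ℝ)
  exact ((h.sin.neg).mul_const _).const_mul _
lemma ff0_d (q : L1 X) (k : ℕ) (x : ℝ) : HasDerivAt (ff0 q k) (ff1 q k x) x := by
  have := intervalIntegral.integral_hasDerivAt_right ((pr_continuous (q k)).intervalIntegrable 0 x)
    ((pr_continuous (q k)).stronglyMeasurableAtFilter _ _) (pr_continuous (q k)).continuousAt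
  exact this.const_add _
lemma ff1_d (q : L1 X) (k : ℕ) (x : ℝ) : HasDerivAt (ff1 q k) (ff2 q k x) x := pr_hasDerivAt _ _

lemma uu_summable (τ : ℝ) : Summable (uu τ) := by
  have h (j : ℕ) := summable_pow_mul_geometric_of_norm_lt_one (R := ℝ) j (r := 1/2) (by norm_num)
  refine (((h 0).add ((h 1).mul_left (2*τ))).add ((h 2).mul_left (τ^2))).congr fun k => ?_
  simp only [uu]; ring

lemma good_f {q : L1 X} : (∀ k x, |ff0 q k x| ≤ (1+‖q‖) * (1+x^2)) ∧ (∀ k x, |ff1 q k x| ≤ (1+‖q‖) * (1+x^2)) ∧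
    (∀ k x, |ff2 q k x| ≤ (1+‖q‖) * (1+x^2)) := by
  have hq := norm_nonneg q
  have hk (k : ℕ) := L1.norm_apply_le q k
  refine ⟨fun k x => ?_, fun k x => ?_, fun k x => ?_⟩
  · have h := intervalIntegral.norm_integral_le_of_norm_le_const (a := 0) (b := x) (f := pr (q k))
      (C := ‖q‖ * |x|) (fun t ht => by
        refine (pr_abs_le _ _).trans ?_
        have : |t| ≤ |x| := by
          have := Set.uIoc_subset_uIcc ht
          simpa using Set.abs_sub_left_of_mem_uIcc this
        gcongr
        exact hk k)
    have h2 : |if k = 0 then (1:ℝ) else 0| ≤ 1 := by split_ifs <;> simp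
    rw [ff0]
    refine (abs_add_le _ _).trans ?_
    rw [Real.norm_eq_abs, sub_zero, mul_assoc, ← sq, sq_abs] at h
    nlinarith [sq_nonneg x]
  · refine (pr_abs_le _ _).trans ?_
    have : |x| ≤ 1 + x^2 := by rw [← sq_abs]; nlinarith [sq_nonneg (|x|-1)]
    have := hk k
    gcongr
    linarith
  · refine (ext_abs_le _ _).trans ((hk k).trans ?_)
    nlinarith [sq_nonneg x]

lemma good_c {τ : ℝ} (hτ : 0 ≤ τ) : (∀ k y, |cc0 τ k y| ≤ uu τ k) ∧ (∀ k y, |cc1 τ k y| ≤ uu τ k) ∧ (∀ k y, |cc2 τ k y| ≤ uu τ k) := by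
  refine ⟨fun k y => ?_, fun k y => ?_, fun k y => ?_⟩
  all_goals
    have h0 : 0 ≤ (k:ℝ)*τ := by positivity
    have hc := abs_cos_le_one (k*(τ*y))
    have hs := abs_sin_le_one (k*(τ*y))
    have hp : 0 ≤ (1/2:ℝ)^k := by positivity
    simp only [cc0, cc1, cc2, uu, abs_mul, abs_neg, abs_of_nonneg hp, abs_of_nonneg h0]
    gcongr
  · nlinarith
  · nlinarith
  · nlinarith [mul_nonneg h0 h0, mul_le_mul_of_nonneg_right hc (mul_nonneg h0 h0)]

lemma good_mk {τ : ℝ} (hτ : 0 ≤ τ) (q : L1 X) :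
    Good (cc0 τ) (ff0 q) (uu τ) (1+‖q‖) ∧ Good (cc0 τ) (ff1 q) (uu τ) (1+‖q‖) ∧ Good (cc0 τ) (ff2 q) (uu τ) (1+‖q‖) ∧
    Good (cc1 τ) (ff0 q) (uu τ) (1+‖q‖) ∧ Good (cc1 τ) (ff1 q) (uu τ) (1+‖q‖) ∧ Good (cc2 τ) (ff0 q) (uu τ) (1+‖q‖) := by
  obtain ⟨c0, c1, c2⟩ := good_c hτ
  obtain ⟨f0, f1, f2⟩ := good_f (q := q)
  have k0 : ∀ k, Continuous (cc0 τ k) := fun k => continuous_iff_continuousAt.2 fun x => (cc0_d τ k x).continuousAt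
  have k1 : ∀ k, Continuous (cc1 τ k) := fun k => continuous_iff_continuousAt.2 fun x => (cc1_d τ k x).continuousAt
  have k2 : ∀ k, Continuous (cc2 τ k) := fun k => by unfold cc2; fun_prop
  have j0 : ∀ k, Continuous (ff0 q k) := fun k => continuous_iff_continuousAt.2 fun x => (ff0_d q k x).continuousAt
  have j1 : ∀ k, Continuous (ff1 q k) := fun k => continuous_iff_continuousAt.2 fun x => (ff1_d q k x).continuousAt
  have j2 : ∀ k, Continuous (ff2 q k) := fun k => ext_continuous _
  have u := uu_summable τ
  exact ⟨⟨k0, j0, u, c0, f0⟩, ⟨k0, j1, u, c0, f1⟩, ⟨k0, j2, u, c0, f2⟩, ⟨k1, j0, u, c1, f0⟩, ⟨k1, j1, u, c1, f1⟩, ⟨k2, j0, u, c2, f0⟩⟩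

/-- a function on the plane with its first and second derivatives -/
structure WD where
  W : ℂ → ℝ
  Wx : ℂ → ℝ
  Wy : ℂ → ℝ
  Wxx : ℂ → ℝ
  Wxy : ℂ → ℝ
  Wyy : ℂ → ℝ
  h0 : ∀ ζ, HasFDerivAt W (Wx ζ • Complex.reCLM + Wy ζ • Complex.imCLM) ζ
  hx : ∀ ζ, HasFDerivAt Wx (Wxx ζ • Complex.reCLM + Wxy ζ • Complex.imCLM) ζ
  hy : ∀ ζ, HasFDerivAt Wy (Wxy ζ • Complex.reCLM + Wyy ζ • Complex.imCLM) ζ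
  cxx : Continuous Wxx
  cxy : Continuous Wxy
  cyy : Continuous Wyy

lemma good_contC {c f : ℕ → ℝ → ℝ} {u : ℕ → ℝ} {N : ℝ} (h : Good c f u N) : Continuous fun ζ : ℂ => TT c f ζ.re ζ.im := by
  have hc : Continuous fun ζ : ℂ => (ζ.re, ζ.im) := Complex.continuous_re.prodMk Complex.continuous_im
  have h2 := h.continuous
  exact Continuous.comp (g := fun p : ℝ × ℝ => TT c f p.1 p.2) h2 hc

def mkWD {τ : ℝ} (hτ : 0 ≤ τ) (q : L1 X) : WD :=
  have g := good_mk hτ q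
  { W := fun ζ => TT (cc0 τ) (ff0 q) ζ.re ζ.im
    Wx := fun ζ => TT (cc0 τ) (ff1 q) ζ.re ζ.im
    Wy := fun ζ => TT (cc1 τ) (ff0 q) ζ.re ζ.im
    Wxx := fun ζ => TT (cc0 τ) (ff2 q) ζ.re ζ.im
    Wxy := fun ζ => TT (cc1 τ) (ff1 q) ζ.re ζ.im
    Wyy := fun ζ => TT (cc2 τ) (ff0 q) ζ.re ζ.im
    h0 := fderiv_of_partial (TT (cc0 τ) (ff0 q)) (TT (cc0 τ) (ff1 q)) (TT (cc1 τ) (ff0 q)) (g.1.hx g.2.1 (ff0_d q)) (g.1.hy g.2.2.2.1 (cc0_d τ)) g.2.1.continuous g.2.2.2.1.continuous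
    hx := fderiv_of_partial (TT (cc0 τ) (ff1 q)) (TT (cc0 τ) (ff2 q)) (TT (cc1 τ) (ff1 q)) (g.2.1.hx g.2.2.1 (ff1_d q)) (g.2.1.hy g.2.2.2.2.1 (cc0_d τ)) g.2.2.1.continuous
      g.2.2.2.2.1.continuous
    hy := fderiv_of_partial (TT (cc1 τ) (ff0 q)) (TT (cc1 τ) (ff1 q)) (TT (cc2 τ) (ff0 q)) (g.2.2.2.1.hx g.2.2.2.2.1 (ff0_d q)) (g.2.2.2.1.hy g.2.2.2.2.2 (cc1_d τ))
      g.2.2.2.2.1.continuous g.2.2.2.2.2.continuous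
    cxx := good_contC (g.2.2.1)
    cxy := good_contC (g.2.2.2.2.1)
    cyy := good_contC (g.2.2.2.2.2) }

lemma ff0_eq (q : L1 X) (k : ℕ) (x : ℝ) (hx : x ∈ Set.Icc (0:ℝ) π) : ff0 q k x = (if k = 0 then 1 else 0) + V (q k) ⟨x, hx⟩ := by
  rw [ff0, V_eq, P_apply, pr]
  congr 1
  refine intervalIntegral.integral_congr fun t ht => ?_
  rw [Set.uIcc_of_le hx.1] at ht
  exact (ext_P _ ⟨ht.1, ht.2.trans hx.2⟩).symm

structure WProp (D : WD) (s ε : ℝ) (z : ZT) (m : MT) : Prop where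
  per : ∀ ζ : ℂ, D.W (ζ + (2*π/z.2.1 : ℝ) * Complex.I) = D.W ζ
  one : ∀ ζ : ℂ, ζ.re = 0 → D.W ζ = 1
  bx : ∀ ζ : ℂ, ζ.re = 0 ∨ ζ.re = π → D.Wx ζ = 0
  bY : ∀ ζ : ℂ, ζ.re = 0 ∨ ζ.re = π → D.Wy ζ = 0
  pde : ∀ ζ : ℂ, 0 ≤ ζ.re → ζ.re ≤ π → D.Wxx ζ + D.Wyy ζ + z.1 * Real.exp (2*ε*z.2.1*ζ.re) *
    Complex.normSq (1 + s * SS z.2.1 (Ac m) (Dc z m) ζ) * D.W ζ = 0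

lemma thmB {s ε : ℝ} {z : ZT} {m : MT} (hP : Phi ((s, ε), (z, m)) = 0) (hτ : 1 ≤ z.2.1) : ∃ D : WD, WProp D s ε z m := by
  rw [Phi_eq] at hP
  set M : PT := (m.1, Ta z.2.1 m.2.1, Td z.2.1 m.2.2) with hM
  set q := qtot s ε z M with hq
  simp only [sol, Prod.mk_eq_zero] at hP
  obtain ⟨⟨e0, i0, e1, i1, j1⟩, eω, p0, pπ⟩ := hP
  have hn (n : ℕ) : (1 / kk n ^ 2) • m.1 n = V (rMF s ε z M n) ∧ I0 (rMF s ε z M n) = 0 ∧ I1 (rMF s ε z M n) = 0 := by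
    have hk := kk_pos n
    have h1 : m.1 n + kk n ^ 2 • K (nu n) (rhoF s ε z M n) = 0 := by
      have := congrArg (fun f : L1 X => f n) eω
      simpa [KK_apply] using this
    have h2 : m0 (nu n) (rhoF s ε z M n) = 0 := by
      have := congrArg (fun f : L1 ℝ => f n) p0
      simpa [mm0_apply] using this
    have h3 : mpi (nu n) (rhoF s ε z M n) = 0 := by
      have := congrArg (fun f : L1 ℝ => f n) pπ
      simpa [mmpi_apply] using this
    have h4 : (1 / kk n ^ 2) • m.1 n = - K (nu n) (rhoF s ε z M n) := by
      rw [eq_neg_of_add_eq_zero_left h1, smul_neg, smul_smul]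
      rw [one_div, inv_mul_cancel₀ (by positivity), one_smul]
    have h5 := K_cauchy (nu_pos n) _ _ h2 h3 h4
    have h6 : nu n ^ 2 • (1 / kk n ^ 2) • m.1 n + rhoF s ε z M n = rMF s ε z M n := by
      rw [nu_sq, rhoF, L1.sub_apply, BB_apply]
      simp only [hM]
      ext x
      simp
      field_simp
      ring
    rwa [h6] at h5
  have hV (k : ℕ) : wtot s z m.1 k = (if k = 0 then 1 else 0) + V (q k) := by
    match k with
    | 0 =>
      have : z.2.2.2.1 = 1 + V (r0F s ε z M) := by
        have := sub_eq_zero.1 e0; rw [← this]; abel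
      simpa [wtot, wvec, hq, qtot, sgl_apply] using this
    | 1 =>
      have := sub_eq_zero.1 e1
      simp [wtot, wvec, hq, qtot, sgl_apply]
      rw [← this]
    | n+2 =>
      have := (hn n).1
      simp only [one_div] at this
      simp [wtot, wvec, hq, qtot, sgl_apply, JJ_apply]
      rw [← this]
  have hI0 (k : ℕ) : I0 (q k) = 0 := by
    match k with
    | 0 => simpa [hq, qtot, sgl_apply] using i0
    | 1 => simp [hq, qtot, sgl_apply, i1]
    | n+2 => simp [hq, qtot, sgl_apply, (hn n).2.1]
  have hI1 (k : ℕ) (hk : k ≠ 0) : I1 (q k) = 0 := by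
    match k with
    | 0 => exact absurd rfl hk
    | 1 => simp [hq, qtot, sgl_apply, j1]
    | n+2 => simp [hq, qtot, sgl_apply, (hn n).2.2]
  have hdd (k : ℕ) : wdd s z m.1 k = (k:ℝ)^2 • wtot s z m.1 k := by
    match k with
    | 0 => simp [wdd, wtot, wvec, sgl_apply]
    | 1 => simp [wdd, wtot, wvec, sgl_apply]
    | n+2 =>
      have hk := kk_pos n
      simp [wdd, wtot, wvec, sgl_apply, JJ_apply]
      rw [smul_comm, smul_smul ((n+2:ℝ)^2)]
      unfold kk
      rw [mul_inv_cancel₀ (by positivity), one_smul]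
  have hτ0 : 0 ≤ z.2.1 := by linarith
  have hf0 (x : Set.Icc (0:ℝ) π) (k : ℕ) : ff0 q k x = wtot s z m.1 k x := by
    rw [ff0_eq _ _ _ x.2, hV k]
    split_ifs <;> simp
  refine ⟨mkWD hτ0 q, ?_, ?_, ?_, ?_, ?_⟩
  · intro ζ
    refine tsum_congr fun k => ?_
    have e1 : (ζ + (2*π/z.2.1 : ℝ) * Complex.I).re = ζ.re := by simp
    have e2 : (ζ + (2*π/z.2.1 : ℝ) * Complex.I).im = ζ.im + 2*π/z.2.1 := by simp
    rw [e1, e2, cc0, cc0]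
    have : (k:ℝ) * (z.2.1 * (ζ.im + 2*π/z.2.1)) = k * (z.2.1 * ζ.im) + k * (2*π) := by field_simp
    rw [this, Real.cos_add_nat_mul_two_pi]
  · intro ζ h
    change TT _ _ _ _ = _
    rw [TT, tsum_eq_single 0, h]
    · simp [cc0, ff0]
    · intro k hk
      simp [ff0, hk, h]
  · intro ζ h
    refine (tsum_congr fun k => ?_).trans tsum_zero
    rcases h with h | h
    · rw [h]; simp [ff1]
    · rw [h, ff1, ← I0_eq, hI0, mul_zero]
  · intro ζ h
    refine (tsum_congr fun k => ?_).trans tsum_zero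
    rcases eq_or_ne k 0 with rfl | hk
    · simp [cc1]
    rcases h with h | h
    · rw [h]; simp [ff0, hk]
    · have := hI1 k hk
      rw [I1_eq] at this
      rw [h, ff0_eq _ _ π ⟨pi_pos.le, le_rfl⟩]
      rw [if_neg hk, zero_add]
      exact mul_eq_zero_of_right _ this
  · intro ζ h0 hπ
    set x : Set.Icc (0:ℝ) π := ⟨ζ.re, h0, hπ⟩ with hx
    have hW : (mkWD hτ0 q).W ζ = evc x (z.2.1 * ζ.im) (wtot s z m.1) :=
      tsum_congr fun k => by rw [cc0]; congr 1; exact hf0 x k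
    have hxx : (mkWD hτ0 q).Wxx ζ = evc x (z.2.1 * ζ.im) q :=
      tsum_congr fun k => by rw [cc0]; congr 1; exact ext_coe (q k) x
    have hyy : (mkWD hτ0 q).Wyy ζ = - (z.2.1^2 * evc x (z.2.1 * ζ.im) (wdd s z m.1)) := by
      rw [evc_apply, ← tsum_mul_left, ← tsum_neg]
      refine tsum_congr fun k => ?_
      have : ff0 q k ζ.re = wtot s z m.1 k x := hf0 x k
      rw [cc2, this, hdd]
      simp
      ring
    rw [hW, hxx, hyy, hq, evc_q, SS_eq hτ m x ζ.im ζ rfl rfl]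
    have : (1 + (s:ℂ) * (((evc x (z.2.1*ζ.im) (avec z.2.1 M.2.1) + evc x (z.2.1*ζ.im) (dvec z.2.1 z.2.2.1 M.2.2) : ℝ) : ℂ) +
      ((evs x (z.2.1*ζ.im) (dvec z.2.1 z.2.2.1 M.2.2) - evs x (z.2.1*ζ.im) (avec z.2.1 M.2.1) : ℝ) : ℂ) * Complex.I)) =
      ((1 + s * (evc x (z.2.1*ζ.im) (avec z.2.1 M.2.1) + evc x (z.2.1*ζ.im) (dvec z.2.1 z.2.2.1 M.2.2)) : ℝ) : ℂ) +
      ((s * (evs x (z.2.1*ζ.im) (dvec z.2.1 z.2.2.1 M.2.2) - evs x (z.2.1*ζ.im) (avec z.2.1 M.2.1)) : ℝ) : ℂ) * Complex.I := by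
      push_cast; ring
    rw [this, Complex.normSq_add_mul_I]
    have hx2 : ((x : Set.Icc (0:ℝ) π) : ℝ) = ζ.re := rfl
    rw [hx2]
    simp only [hM]
    ring

end Schiffer
end

set_option linter.unusedSectionVars false
set_option linter.unusedSimpArgs false
noncomputable section
namespace Schiffer

/-! ### Abstract geometry -/

def strip : Set ℂ := {ζ | -(1/8:ℝ) < ζ.re ∧ ζ.re < π + 1/8}

lemma strip_open : IsOpen strip :=
  (isOpen_lt continuous_const Complex.continuous_re).inter (isOpen_lt Complex.continuous_re continuous_const)

lemma strip_convex : Convex ℝ strip :=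
  (convex_halfSpace_re_gt (-(1/8:ℝ))).inter (convex_halfSpace_re_lt (π+1/8))

structure Geo (κ : ℝ) (l : ℕ) (G : ℂ → ℂ) : Prop where
  kpos : 0 < κ
  lpos : 0 < l
  diff : DifferentiableOn ℂ G strip
  bd : ∀ ζ ∈ strip, ‖deriv G ζ‖ ≤ κ/4
  per : ∀ ζ, G (ζ + (2*π/(l*κ) : ℝ) * Complex.I) = G ζ

def cl (a : ℝ) : ℝ := max (-(1/16)) (min (π+1/16) a)
lemma cl_eq {a : ℝ} (h1 : -(1/16) ≤ a) (h2 : a ≤ π + 1/16) : cl a = a := by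
  rw [cl, min_eq_right h2, max_eq_right h1]
lemma cl_mem (a : ℝ) : -(1/16) ≤ cl a ∧ cl a ≤ π + 1/16 := by
  refine ⟨le_max_left _ _, max_le (by linarith [pi_pos]) (min_le_left _ _)⟩
lemma cl_lip (a b : ℝ) : |cl a - cl b| ≤ |a - b| := by
  unfold cl
  rw [max_comm, max_comm _ (min _ b), min_comm, min_comm _ b]
  exact (abs_max_sub_max_le_abs _ _ _).trans (abs_inf_sub_inf_le_abs _ _ _)

def clC (ζ : ℂ) : ℂ := ⟨cl ζ.re, ζ.im⟩
lemma clC_mem (ζ : ℂ) : clC ζ ∈ strip := by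
  have := cl_mem ζ.re
  constructor
  · change _ < cl ζ.re; linarith
  · change cl ζ.re < _; linarith
lemma clC_eq {ζ : ℂ} (h1 : -(1/16) ≤ ζ.re) (h2 : ζ.re ≤ π + 1/16) : clC ζ = ζ := by
  apply Complex.ext
  · exact cl_eq h1 h2
  · rfl
lemma clC_lip (ζ ξ : ℂ) : ‖clC ζ - clC ξ‖ ≤ ‖ζ - ξ‖ := by
  rw [← sq_le_sq₀ (norm_nonneg _) (norm_nonneg _), Complex.sq_norm, Complex.sq_norm, Complex.normSq_apply, Complex.normSq_apply]
  simp only [Complex.sub_re, Complex.sub_im, clC]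
  have := sq_le_sq.2 (cl_lip ζ.re ξ.re)
  nlinarith

/-- perturbation of a multiple of the identity -/
lemma bij_of_lip {E : Type} [NormedAddCommGroup E] [NormedSpace ℝ E] [CompleteSpace E] {κ : ℝ} (hκ : 0 < κ)
    (e : E → E) (he : ∀ x y, ‖e x - e y‖ ≤ κ/4 * ‖x - y‖) : Function.Bijective fun x => κ • x + e x := by
  constructor
  · intro x y h
    have h1 : κ • (x - y) = -(e x - e y) := by
      have : κ • x + e x = κ • y + e y := h
      rw [smul_sub, eq_neg_iff_add_eq_zero]
      rw [← sub_eq_zero] at this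
      rw [← this]; abel
    have h2 := he x y
    rw [← norm_neg, ← h1, norm_smul, Real.norm_of_nonneg hκ.le] at h2
    have h3 : ‖x - y‖ ≤ 0 := by
      by_contra hc
      push Not at hc
      nlinarith [mul_pos hκ hc]
    exact sub_eq_zero.1 (norm_le_zero_iff.1 h3)
  · intro w
    have hc : ContractingWith (1/4) (fun x => κ⁻¹ • (w - e x)) := by
      refine ⟨by rw [← NNReal.coe_lt_coe]; norm_num, LipschitzWith.of_dist_le_mul fun x y => ?_⟩
      rw [dist_eq_norm, dist_eq_norm, ← smul_sub, norm_smul, norm_inv, Real.norm_of_nonneg hκ.le]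
      have := he x y
      have e1 : w - e x - (w - e y) = -(e x - e y) := by abel
      rw [e1, norm_neg, inv_mul_le_iff₀ hκ]
      push_cast
      linarith
    have h := hc.fixedPoint_isFixedPt
    set x := hc.fixedPoint
    refine ⟨x, ?_⟩
    have h1 : κ⁻¹ • (w - e x) = x := h
    have h2 : w - e x = κ • x := by rw [← h1, smul_smul, mul_inv_cancel₀ hκ.ne', one_smul, h1]
    change κ • x + e x = w
    rw [← h2]; abel

namespace Geo
variable {κ : ℝ} {l : ℕ} {G : ℂ → ℂ}

def La (κ : ℝ) (G : ℂ → ℂ) (ζ : ℂ) : ℂ := κ * (ζ - π) + G (clC ζ)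

lemma lipG (h : Geo κ l G) {ζ ξ : ℂ} (h1 : ζ ∈ strip) (h2 : ξ ∈ strip) : ‖G ζ - G ξ‖ ≤ κ/4 * ‖ζ - ξ‖ :=
  strip_convex.norm_image_sub_le_of_norm_deriv_le (fun x hx => (h.diff x hx).differentiableAt (strip_open.mem_nhds hx))
    h.bd h2 h1

lemma lip (h : Geo κ l G) (ζ ξ : ℂ) : ‖G (clC ζ) - G (clC ξ)‖ ≤ κ/4 * ‖ζ - ξ‖ := by
  refine (h.lipG (clC_mem ζ) (clC_mem ξ)).trans ?_
  have := clC_lip ζ ξ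
  have := h.kpos
  gcongr

lemma bij (h : Geo κ l G) : Function.Bijective (La κ G) := by
  have := bij_of_lip h.kpos (fun ζ => G (clC ζ) - κ * π) (fun x y => by simpa using h.lip x y)
  convert this using 2 with ζ
  rw [La, Complex.real_smul]; ring

lemma La_per (h : Geo κ l G) (ζ : ℂ) : La κ G (ζ + (2*π/(l*κ) : ℝ) * Complex.I) = La κ G ζ + (2*π/l : ℝ) * Complex.I := by
  have hl : (l:ℂ) ≠ 0 := by exact_mod_cast h.lpos.ne'
  have hk : (κ:ℂ) ≠ 0 := by exact_mod_cast h.kpos.ne'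
  have e : clC (ζ + (2*π/(l*κ) : ℝ) * Complex.I) = clC ζ + (2*π/(l*κ) : ℝ) * Complex.I := by
    generalize (2*π/(l*κ) : ℝ) = T
    apply Complex.ext <;> simp [clC]
  rw [La, La, e, h.per]
  push_cast
  field_simp
  ring

lemma La_per_nat (h : Geo κ l G) (n : ℕ) (ζ : ℂ) :
    La κ G (ζ + n * ((2*π/(l*κ) : ℝ) * Complex.I)) = La κ G ζ + n * ((2*π/l : ℝ) * Complex.I) := by
  induction n with
  | zero => simp
  | succ n ih =>
    have : ζ + ((n+1:ℕ):ℂ) * ((2*π/(l*κ) : ℝ) * Complex.I) = (ζ + n * ((2*π/(l*κ) : ℝ) * Complex.I)) + (2*π/(l*κ) : ℝ) * Complex.I := by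
      push_cast; ring
    rw [this, h.La_per, ih]
    push_cast; ring

lemma La_per_int (h : Geo κ l G) (n : ℤ) (ζ : ℂ) :
    La κ G (ζ + n * ((2*π/(l*κ) : ℝ) * Complex.I)) = La κ G ζ + n * ((2*π/l : ℝ) * Complex.I) := by
  obtain ⟨m, rfl | rfl⟩ := n.eq_nat_or_neg
  · simpa using h.La_per_nat m ζ
  · have := h.La_per_nat m (ζ + (-(m:ℤ) : ℤ) * ((2*π/(l*κ) : ℝ) * Complex.I))
    have e : ζ + (-(m:ℤ) : ℤ) * ((2*π/(l*κ) : ℝ) * Complex.I) + m * ((2*π/(l*κ) : ℝ) * Complex.I) = ζ := by push_cast; ring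
    rw [e] at this
    rw [this]; push_cast; ring

/-- the comparison of positions -/
lemma sign (h : Geo κ l G) {ζ ξ : ℂ} (him : (La κ G ζ).im = (La κ G ξ).im) :
    (ξ.re < ζ.re ↔ (La κ G ξ).re < (La κ G ζ).re) := by
  have hk := h.kpos
  set d := ζ - ξ with hd
  set E := G (clC ζ) - G (clC ξ) with hE
  have hL : La κ G ζ - La κ G ξ = κ * d + E := by rw [La, La, hd, hE]; ring
  have h1 : ‖E‖ ≤ κ/4 * ‖d‖ := h.lip ζ ξ
  have h2 : ‖d‖ ≤ |d.re| + |d.im| := Complex.norm_le_abs_re_add_abs_im d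
  have h3 := Complex.abs_re_le_norm E
  have h4 := Complex.abs_im_le_norm E
  have hi : κ * d.im + E.im = 0 := by
    have := congrArg Complex.im hL
    simp only [Complex.sub_im, him, sub_self, Complex.add_im, Complex.re_ofReal_mul, Complex.im_ofReal_mul] at this
    exact this.symm
  have hr : (La κ G ζ).re - (La κ G ξ).re = κ * d.re + E.re := by
    have := congrArg Complex.re hL
    simpa using this
  have h5 : κ * |d.im| ≤ κ/4 * ‖d‖ := by
    have : κ * |d.im| = |E.im| := by
      rw [← abs_neg E.im, ← eq_neg_of_add_eq_zero_left hi, abs_mul, abs_of_pos hk]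
    linarith
  have h6 : |d.im| ≤ 1/4 * ‖d‖ := by
    have : κ * |d.im| ≤ κ * (1/4 * ‖d‖) := by linarith
    exact le_of_mul_le_mul_left this hk
  have h7 : ‖d‖ ≤ 4/3 * |d.re| := by linarith
  have h8 : |E.re| ≤ κ/3 * |d.re| := by
    calc |E.re| ≤ κ/4 * ‖d‖ := h3.trans h1
      _ ≤ κ/4 * (4/3 * |d.re|) := by gcongr
      _ = _ := by ring
  have h9 : d.re = ζ.re - ξ.re := by simp [hd]
  rcases lt_trichotomy d.re 0 with hn | hn | hn
  · rw [abs_of_neg hn] at h8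
    have := (abs_le.1 h8).2
    constructor
    · intro; linarith
    · intro; nlinarith
  · rw [hn, abs_zero, mul_zero] at h8
    have : E.re = 0 := abs_nonpos_iff.1 h8
    rw [hn, this] at hr
    constructor <;> intro <;> linarith
  · rw [abs_of_pos hn] at h8
    have := (abs_le.1 h8).1
    constructor
    · intro; nlinarith
    · intro; linarith

/-- the angle along the vertical line `re = c` -/
def hh (κ : ℝ) (G : ℂ → ℂ) (c y : ℝ) : ℝ := (La κ G (c + y * Complex.I)).im
def rr (κ : ℝ) (G : ℂ → ℂ) (c y : ℝ) : ℝ := (La κ G (c + y * Complex.I)).re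
def rho (κ : ℝ) (G : ℂ → ℂ) (c θ : ℝ) : ℝ := rr κ G c (Function.invFun (hh κ G c) θ)

lemma hh_bij (h : Geo κ l G) (c : ℝ) : Function.Bijective (hh κ G c) := by
  have := bij_of_lip h.kpos (fun y : ℝ => (G (clC (c + y * Complex.I))).im) (fun x y => by
    have h1 := h.lip (c + x * Complex.I) (c + y * Complex.I)
    have h2 := Complex.abs_im_le_norm (G (clC (c + x * Complex.I)) - G (clC (c + y * Complex.I)))
    have h3 : ‖(c + x * Complex.I : ℂ) - (c + y * Complex.I)‖ = ‖x - y‖ := by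
      have : (c + x * Complex.I : ℂ) - (c + y * Complex.I) = ((x - y : ℝ) : ℂ) * Complex.I := by push_cast; ring
      rw [this, norm_mul, Complex.norm_I, mul_one, Complex.norm_real]
    rw [h3] at h1
    rw [Complex.sub_im] at h2
    exact h2.trans h1)
  convert this using 2 with y
  simp [hh, La]

lemma hh_inv (h : Geo κ l G) (c θ : ℝ) : hh κ G c (Function.invFun (hh κ G c) θ) = θ :=
  Function.rightInverse_invFun (h.hh_bij c).2 θ

lemma rho_hh (h : Geo κ l G) (c y : ℝ) : rho κ G c (hh κ G c y) = rr κ G c y := by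
  rw [rho, Function.leftInverse_invFun (h.hh_bij c).1 y]

lemma hh_per (h : Geo κ l G) (c y : ℝ) : hh κ G c (y + 2*π/(l*κ)) = hh κ G c y + 2*π/l ∧
    rr κ G c (y + 2*π/(l*κ)) = rr κ G c y := by
  have := h.La_per (c + y * Complex.I)
  have e : (c + ((y + 2*π/(l*κ) : ℝ):ℂ) * Complex.I) = c + y * Complex.I + (2*π/(l*κ) : ℝ) * Complex.I := by push_cast; ring
  rw [hh, rr, e, this, hh, rr]
  generalize (2*π/l : ℝ) = T
  simp

lemma rho_per' (h : Geo κ l G) (c : ℝ) : Function.Periodic (rho κ G c) (2*π/l) := by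
  intro θ
  obtain ⟨y, rfl⟩ := (h.hh_bij c).2 θ
  rw [← (h.hh_per c y).1, h.rho_hh, h.rho_hh, (h.hh_per c y).2]

lemma rho_per (h : Geo κ l G) (c : ℝ) : Function.Periodic (rho κ G c) (2*π) := by
  have := (h.rho_per' c).nat_mul l
  have hl : (l:ℝ) ≠ 0 := by exact_mod_cast h.lpos.ne'
  rwa [mul_div_cancel₀ _ hl] at this

/-- position relative to a curve -/
lemma lt_rho (h : Geo κ l G) (c : ℝ) (ζ : ℂ) : (c < ζ.re ↔ rho κ G c (La κ G ζ).im < (La κ G ζ).re) ∧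
    (ζ.re < c ↔ (La κ G ζ).re < rho κ G c (La κ G ζ).im) := by
  obtain ⟨y, hy⟩ := (h.hh_bij c).2 (La κ G ζ).im
  rw [← hy, h.rho_hh]
  have hre : (c + y * Complex.I : ℂ).re = c := by simp
  have h1 := h.sign (ζ := ζ) (ξ := c + y * Complex.I) hy.symm
  have h2 := h.sign (ξ := ζ) (ζ := c + y * Complex.I) hy
  rw [hre] at h1 h2
  exact ⟨h1, h2⟩

lemma cmem {c : ℝ} (h0 : 0 ≤ c) (hπ : c ≤ π) {ζ : ℂ} (hz : ζ.re = c) : ζ ∈ strip ∧ ∀ᶠ ξ in nhds ζ, clC ξ = ξ := by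
  constructor
  · constructor <;> rw [hz] <;> linarith
  · have h1 : ∀ᶠ ξ in nhds ζ, -(1/16:ℝ) < ξ.re := Complex.continuous_re.continuousAt.eventually (lt_mem_nhds (by rw [hz]; linarith))
    have h2 : ∀ᶠ ξ in nhds ζ, ξ.re < π + 1/16 := Complex.continuous_re.continuousAt.eventually (gt_mem_nhds (by rw [hz]; linarith))
    filter_upwards [h1, h2] with ξ a b
    exact clC_eq a.le b.le

lemma La_analytic (h : Geo κ l G) {ζ : ℂ} (h0 : 0 ≤ ζ.re) (hπ : ζ.re ≤ π) : AnalyticAt ℂ (La κ G) ζ := by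
  obtain ⟨h1, h2⟩ := cmem h0 hπ rfl
  have hG : AnalyticAt ℂ G ζ := h.diff.analyticAt (strip_open.mem_nhds h1)
  have h3 : AnalyticAt ℂ (fun ζ : ℂ => (κ:ℂ) * (ζ - π) + G ζ) ζ :=
    (analyticAt_const.mul (analyticAt_id.sub analyticAt_const)).add hG
  refine h3.congr ?_
  filter_upwards [h2] with ξ hξ
  rw [La, hξ]

lemma La_deriv (h : Geo κ l G) {ζ : ℂ} (h0 : 0 ≤ ζ.re) (hπ : ζ.re ≤ π) : deriv (La κ G) ζ = κ + deriv G ζ := by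
  obtain ⟨h1, h2⟩ := cmem h0 hπ rfl
  have hG : DifferentiableAt ℂ G ζ := (h.diff ζ h1).differentiableAt (strip_open.mem_nhds h1)
  have h3 : HasDerivAt (fun ζ : ℂ => (κ:ℂ) * (ζ - π) + G ζ) (κ + deriv G ζ) ζ := by
    have h4 := (((hasDerivAt_id ζ).sub_const (π:ℂ)).const_mul (κ:ℂ)).add hG.hasDerivAt
    rw [mul_one] at h4
    exact h4
  have : La κ G =ᶠ[nhds ζ] fun ζ : ℂ => (κ:ℂ) * (ζ - π) + G ζ := by
    filter_upwards [h2] with ξ hξ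
    rw [La, hξ]
  rw [this.deriv_eq, h3.deriv]

lemma La_deriv_re (h : Geo κ l G) {ζ : ℂ} (h0 : 0 ≤ ζ.re) (hπ : ζ.re ≤ π) : 0 < (deriv (La κ G) ζ).re := by
  rw [h.La_deriv h0 hπ]
  have h1 := h.bd ζ (cmem h0 hπ rfl).1
  have h2 := (abs_le.1 (Complex.abs_re_le_norm (deriv G ζ))).1
  have := h.kpos
  simp
  linarith

lemma rho_analytic (h : Geo κ l G) {c : ℝ} (h0 : 0 ≤ c) (hπ : c ≤ π) (θ : ℝ) : AnalyticAt ℝ (rho κ G c) θ := by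
  obtain ⟨y, rfl⟩ := (h.hh_bij c).2 θ
  have hre : (c + y * Complex.I : ℂ).re = c := by simp
  have hA := h.La_analytic (ζ := c + y * Complex.I) (by rw [hre]; exact h0) (by rw [hre]; exact hπ)
  have hl : AnalyticAt ℝ (fun y : ℝ => (c + y * Complex.I : ℂ)) y :=
    analyticAt_const.add ((Complex.ofRealCLM.analyticAt y).mul analyticAt_const)
  have hA' : AnalyticAt ℝ (fun y : ℝ => La κ G (c + y * Complex.I)) y :=
    AnalyticAt.fun_comp (hA.restrictScalars (𝕜 := ℝ)) hl
  have hi : AnalyticAt ℝ (hh κ G c) y := AnalyticAt.fun_comp (g := Complex.imCLM) (Complex.imCLM.analyticAt _) hA'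
  have hr : AnalyticAt ℝ (rr κ G c) y := AnalyticAt.fun_comp (g := Complex.reCLM) (Complex.reCLM.analyticAt _) hA'
  have hd : HasDerivAt (hh κ G c) (deriv (La κ G) (c + y * Complex.I)).re y := by
    have h1 : HasDerivAt (fun y : ℝ => (c + y * Complex.I : ℂ)) Complex.I y := by
      simpa using ((Complex.ofRealCLM.hasDerivAt (x := y)).mul_const Complex.I).const_add (c:ℂ)
    have h2 := hA.differentiableAt.hasDerivAt.comp y h1
    have h3 := Complex.imCLM.hasFDerivAt.comp_hasDerivAt y h2
    have e : Complex.imCLM (deriv (La κ G) (c + y * Complex.I) * Complex.I) = (deriv (La κ G) (c + y * Complex.I)).re := by simp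
    rw [e] at h3
    exact h3
  have hne : deriv (hh κ G c) y ≠ 0 := by
    rw [hd.deriv]
    exact (h.La_deriv_re (by rw [hre]; exact h0) (by rw [hre]; exact hπ)).ne'
  rw [← analyticAt_comp_iff_of_deriv_ne_zero hi hne]
  have : rho κ G c ∘ hh κ G c = rr κ G c := funext fun y => h.rho_hh c y
  rw [this]; exact hr

end Geo

end Schiffer
end

set_option linter.unusedSectionVars false
set_option linter.unusedSimpArgs false
noncomputable section
namespace Schiffer

/-! ### Transport of the eigenfunction -/

lemma WD.contDiff_aux {f a b : ℂ → ℝ} {n : ℕ} (h : ∀ ζ, HasFDerivAt f (a ζ • Complex.reCLM + b ζ • Complex.imCLM) ζ)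
    (ha : ContDiff ℝ n a) (hb : ContDiff ℝ n b) : ContDiff ℝ (n+1) f := by
  rw [contDiff_succ_iff_hasFDerivAt]
  exact ⟨_, (ha.smul contDiff_const).add (hb.smul contDiff_const), h⟩

lemma WD.contDiff (D : WD) : ContDiff ℝ 2 D.W := by
  have hx : ContDiff ℝ 1 D.Wx := by
    have := WD.contDiff_aux (n := 0) D.hx (contDiff_zero.2 D.cxx) (contDiff_zero.2 D.cxy)
    simpa using this
  have hy : ContDiff ℝ 1 D.Wy := by
    have := WD.contDiff_aux (n := 0) D.hy (contDiff_zero.2 D.cxy) (contDiff_zero.2 D.cyy)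
    simpa using this
  have := WD.contDiff_aux (n := 1) D.h0 (by exact_mod_cast hx) (by exact_mod_cast hy)
  norm_num at this
  exact this

def JE : Pt ≃ₗᵢ[ℝ] ℂ := Complex.orthonormalBasisOneI.repr.symm

lemma JE_apply (p : Pt) : JE p = p 0 + p 1 * Complex.I := by
  rw [JE, Complex.orthonormalBasisOneI_repr_symm_apply]

lemma JE_e0 : JE (EuclideanSpace.single 0 1) = 1 := by rw [JE_apply]; simp
lemma JE_e1 : JE (EuclideanSpace.single 1 1) = Complex.I := by rw [JE_apply]; simp

lemma JE_polar (r θ : ℝ) : JE (polar r θ) = r * Complex.exp (θ * Complex.I) := by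
  rw [JE_apply, polar, Complex.exp_mul_I]
  apply Complex.ext <;> simp [Complex.cos_ofReal_re, Complex.sin_ofReal_re]

def JL : Pt →L[ℝ] ℂ := JE.toContinuousLinearEquiv.toContinuousLinearMap
lemma JL_apply (p : Pt) : JL p = JE p := rfl

lemma chain {f : ℂ → ℝ} {a b : ℝ} {g : ℂ → ℂ} {c : ℂ} {p : Pt}
    (hf : HasFDerivAt f (a • Complex.reCLM + b • Complex.imCLM) (g (JE p))) (hg : HasDerivAt g c (JE p)) :
    ∃ L : Pt →L[ℝ] ℝ, HasFDerivAt (fun p => f (g (JE p))) L p ∧ ∀ v, L v = a * (c * JE v).re + b * (c * JE v).im := by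
  have h1 : HasFDerivAt (fun p => JE p) JL p := JL.hasFDerivAt
  have h2 := hg.hasFDerivAt.restrictScalars ℝ
  have h3 := hf.comp p (h2.comp p h1)
  refine ⟨_, h3, fun v => ?_⟩
  simp [JL_apply, mul_comm]

lemma chainC {g : ℂ → ℂ} {c : ℂ} {p : Pt} (hg : HasDerivAt g c (JE p)) :
    (∃ L : Pt →L[ℝ] ℝ, HasFDerivAt (fun p => (g (JE p)).re) L p ∧ ∀ v, L v = (c * JE v).re) ∧
    (∃ L : Pt →L[ℝ] ℝ, HasFDerivAt (fun p => (g (JE p)).im) L p ∧ ∀ v, L v = (c * JE v).im) := by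
  constructor
  · obtain ⟨L, h1, h2⟩ := chain (f := Complex.reCLM) (a := 1) (b := 0) (p := p)
      (by rw [one_smul, zero_smul, add_zero]; exact Complex.reCLM.hasFDerivAt) hg
    exact ⟨L, h1, fun v => by rw [h2]; ring⟩
  · obtain ⟨L, h1, h2⟩ := chain (f := Complex.imCLM) (a := 0) (b := 1) (p := p)
      (by rw [one_smul, zero_smul, zero_add]; exact Complex.imCLM.hasFDerivAt) hg
    exact ⟨L, h1, fun v => by rw [h2]; ring⟩

lemma lap_comp (D : WD) {g : ℂ → ℂ} {u : Pt → ℝ} {p : Pt} (hg : AnalyticAt ℂ g (JE p))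
    (hu : ∀ᶠ q in nhds p, u q = D.W (g (JE q))) :
    ContDiffAt ℝ 2 u p ∧ (D.Wx (g (JE p)) = 0 → D.Wy (g (JE p)) = 0 → HasFDerivAt u (0 : Pt →L[ℝ] ℝ) p) ∧
    lap u p = Complex.normSq (deriv g (JE p)) * (D.Wxx (g (JE p)) + D.Wyy (g (JE p))) := by
  have hu' : u =ᶠ[nhds p] fun q => D.W (g (JE q)) := hu
  refine ⟨?_, ?_, ?_⟩
  · have h1 : ContDiffAt ℝ 2 g (JE p) := (hg.restrictScalars (𝕜 := ℝ)).contDiffAt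
    have h2 : ContDiffAt ℝ 2 (fun q => JE q) p := JL.contDiff.contDiffAt
    exact (D.contDiff.contDiffAt.comp p (h1.comp p h2)).congr_of_eventuallyEq hu'
  · intro hx hy
    obtain ⟨L, h1, h2⟩ := chain (D.h0 _) hg.differentiableAt.hasDerivAt
    have : L = 0 := by ext v; rw [h2, hx, hy]; simp
    rw [this] at h1
    exact h1.congr_of_eventuallyEq hu'
  · have hgp : ∀ᶠ q in nhds p, AnalyticAt ℂ g (JE q) := JE.continuous.continuousAt.eventually hg.eventually_analyticAt
    have hfd : ∀ᶠ q in nhds p, ∀ v, fderiv ℝ u q v = D.Wx (g (JE q)) * (deriv g (JE q) * JE v).re + D.Wy (g (JE q)) * (deriv g (JE q) * JE v).im := by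
      filter_upwards [hgp, hu'.eventuallyEq_nhds] with q hq1 hq2 v
      obtain ⟨L, h1, h2⟩ := chain (D.h0 _) hq1.differentiableAt.hasDerivAt
      rw [hq2.fderiv_eq, h1.fderiv, h2]
    have e0 : pd 0 u =ᶠ[nhds p] fun q => D.Wx (g (JE q)) * (deriv g (JE q)).re + D.Wy (g (JE q)) * (deriv g (JE q)).im := by
      filter_upwards [hfd] with q hq
      rw [pd, hq, JE_e0, mul_one]
    have e1 : pd 1 u =ᶠ[nhds p] fun q => D.Wy (g (JE q)) * (deriv g (JE q)).re - D.Wx (g (JE q)) * (deriv g (JE q)).im := by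
      filter_upwards [hfd] with q hq
      rw [pd, hq, JE_e1, Complex.mul_I_re, Complex.mul_I_im]; ring
    have dg := hg.differentiableAt.hasDerivAt
    have dg' := hg.deriv.differentiableAt.hasDerivAt
    obtain ⟨Lx, hx, vx⟩ := chain (D.hx _) dg
    obtain ⟨Ly, hy, vy⟩ := chain (D.hy _) dg
    obtain ⟨⟨Lr, hr, vr⟩, ⟨Li, hi, vi⟩⟩ := chainC dg'
    have d0 := (hx.mul hr).add (hy.mul hi)
    have d1 := (hy.mul hr).sub (hx.mul hi)
    have f0 := (d0.congr_of_eventuallyEq e0).fderiv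
    have f1 := (d1.congr_of_eventuallyEq e1).fderiv
    rw [lap, pd, f0, pd, f1]
    simp [vx, vy, vr, vi, JE_e0, JE_e1, Complex.normSq_apply]
    ring

end Schiffer
end

set_option linter.unusedSectionVars false
set_option linter.unusedSimpArgs false
noncomputable section
namespace Schiffer

namespace Geo
variable {κ : ℝ} {l : ℕ} {G : ℂ → ℂ}

def FF (κ : ℝ) (G : ℂ → ℂ) (ζ : ℂ) : ℂ := Complex.exp (La κ G ζ)

lemma FF_analytic (h : Geo κ l G) {ζ : ℂ} (h0 : 0 ≤ ζ.re) (hπ : ζ.re ≤ π) : AnalyticAt ℂ (FF κ G) ζ :=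
  (h.La_analytic h0 hπ).cexp

lemma FF_deriv (h : Geo κ l G) {ζ : ℂ} (h0 : 0 ≤ ζ.re) (hπ : ζ.re ≤ π) : deriv (FF κ G) ζ = FF κ G ζ * (κ + deriv G ζ) := by
  have := (h.La_analytic h0 hπ).differentiableAt.hasDerivAt.cexp
  rw [h.La_deriv h0 hπ] at this
  exact this.deriv

lemma FF_deriv_ne (h : Geo κ l G) {ζ : ℂ} (h0 : 0 ≤ ζ.re) (hπ : ζ.re ≤ π) : deriv (FF κ G) ζ ≠ 0 := by
  rw [h.FF_deriv h0 hπ]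
  refine mul_ne_zero (Complex.exp_ne_zero _) fun hc => ?_
  have := h.La_deriv_re h0 hπ
  rw [h.La_deriv h0 hπ, hc] at this
  simp at this

/-- the open strip -/
def OS : Set ℂ := {ζ | 0 < ζ.re ∧ ζ.re < π}
lemma OS_open : IsOpen OS := (isOpen_lt continuous_const Complex.continuous_re).inter (isOpen_lt Complex.continuous_re continuous_const)
lemma OS_convex : Convex ℝ OS := (convex_halfSpace_re_gt 0).inter (convex_halfSpace_re_lt π)

def Om (κ : ℝ) (G : ℂ → ℂ) : Set Pt :=
  {x | ∃ r θ : ℝ, Real.exp (rho κ G 0 θ) < r ∧ r < Real.exp (rho κ G π θ) ∧ x = polar r θ}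

lemma exp_polar (z : ℂ) : JE (polar (Real.exp z.re) z.im) = Complex.exp z := by
  rw [JE_polar, Complex.ofReal_exp, ← Complex.exp_add, Complex.re_add_im]

lemma mem_Om (h : Geo κ l G) (x : Pt) : x ∈ Om κ G ↔ ∃ ζ ∈ OS, FF κ G ζ = JE x := by
  constructor
  · rintro ⟨r, θ, h1, h2, rfl⟩
    have hr : 0 < r := (Real.exp_pos _).trans h1
    obtain ⟨ζ, hζ⟩ := h.bij.2 (Real.log r + θ * Complex.I)
    have e1 : (La κ G ζ).re = Real.log r := by rw [hζ]; simp
    have e2 : (La κ G ζ).im = θ := by rw [hζ]; simp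
    refine ⟨ζ, ⟨?_, ?_⟩, ?_⟩
    · rw [(h.lt_rho 0 ζ).1, e1, e2]; exact (Real.lt_log_iff_exp_lt hr).2 h1
    · rw [(h.lt_rho π ζ).2, e1, e2]; exact (Real.log_lt_iff_lt_exp hr).2 h2
    · rw [FF, ← exp_polar, e1, e2, Real.exp_log hr]
  · rintro ⟨ζ, ⟨h1, h2⟩, h3⟩
    refine ⟨Real.exp (La κ G ζ).re, (La κ G ζ).im, ?_, ?_, ?_⟩
    · exact Real.exp_lt_exp.2 ((h.lt_rho 0 ζ).1.1 h1)
    · exact Real.exp_lt_exp.2 ((h.lt_rho π ζ).2.1 h2)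
    · apply JE.injective
      rw [exp_polar, ← h3, FF]

lemma Om_eq (h : Geo κ l G) : Om κ G = JE ⁻¹' (FF κ G '' OS) := by
  ext x; rw [h.mem_Om]; rfl

lemma Om_eq' (h : Geo κ l G) : Om κ G = JE.symm '' (FF κ G '' OS) := by
  rw [h.Om_eq]
  ext x; constructor
  · intro hx; exact ⟨JE x, hx, by simp⟩
  · rintro ⟨y, hy, rfl⟩; simpa using hy

lemma Om_open (h : Geo κ l G) : IsOpen (Om κ G) := by
  rw [h.Om_eq]
  refine IsOpen.preimage JE.continuous ?_
  rw [isOpen_iff_mem_nhds]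
  rintro _ ⟨ζ, hζ, rfl⟩
  have := (h.FF_analytic hζ.1.le hζ.2.le).hasStrictDerivAt.map_nhds_eq (h.FF_deriv_ne hζ.1.le hζ.2.le)
  rw [← this]
  exact Filter.image_mem_map (OS_open.mem_nhds hζ)

lemma Om_conn (h : Geo κ l G) : IsConnected (Om κ G) := by
  rw [h.Om_eq']
  refine IsConnected.image (IsConnected.image ⟨⟨1, ?_⟩, OS_convex.isPreconnected⟩ _ ?_) _ JE.symm.continuous.continuousOn
  · constructor
    · simp
    · have := pi_gt_three; simp; linarith
  · intro ζ hζ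
    exact (h.FF_analytic hζ.1.le hζ.2.le).continuousAt.continuousWithinAt

def KK (κ : ℝ) (G : ℂ → ℂ) : Set Pt := JE.symm '' (FF κ G '' (Icc 0 π ×ℂ Icc 0 (2*π/κ)))

lemma KK_compact (h : Geo κ l G) : IsCompact (KK κ G) := by
  refine IsCompact.image (IsCompact.image_of_continuousOn (isCompact_Icc.reProdIm isCompact_Icc) ?_) JE.symm.continuous
  intro ζ hζ
  exact (h.FF_analytic hζ.1.1 hζ.1.2).continuousAt.continuousWithinAt

lemma FF_per (h : Geo κ l G) (n : ℤ) (ζ : ℂ) : FF κ G (ζ + ((n * (2*π/κ) : ℝ):ℂ) * Complex.I) = FF κ G ζ := by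
  have hl : (l:ℂ) ≠ 0 := by exact_mod_cast h.lpos.ne'
  have hk : (κ:ℂ) ≠ 0 := by exact_mod_cast h.kpos.ne'
  have e : ζ + ((n * (2*π/κ) : ℝ):ℂ) * Complex.I = ζ + ((n * l : ℤ):ℂ) * ((2*π/(l*κ) : ℝ) * Complex.I) := by
    push_cast; field_simp
  rw [e, FF, h.La_per_int, FF, Complex.exp_eq_exp_iff_exists_int]
  refine ⟨n, ?_⟩
  push_cast; field_simp

lemma Om_sub (h : Geo κ l G) : Om κ G ⊆ KK κ G := by
  intro x hx
  rw [h.mem_Om] at hx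
  obtain ⟨ζ, hζ, he⟩ := hx
  have hT : 0 < 2*π/κ := div_pos (by positivity) h.kpos
  obtain ⟨n, hn, -⟩ := existsUnique_add_zsmul_mem_Ico hT ζ.im 0
  refine ⟨JE x, ⟨ζ + ((n * (2*π/κ) : ℝ):ℂ) * Complex.I, ⟨?_, ?_⟩, ?_⟩, by simp⟩
  · rw [mem_preimage, Complex.add_re, Complex.re_ofReal_mul, Complex.I_re, mul_zero, add_zero]
    exact ⟨hζ.1.le, hζ.2.le⟩
  · rw [mem_preimage, Complex.add_im, Complex.im_ofReal_mul, Complex.I_im, mul_one]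
    rw [zsmul_eq_mul, zero_add] at hn
    exact ⟨hn.1, hn.2.le⟩
  · rw [h.FF_per, he]

lemma Om_bdd (h : Geo κ l G) : Bornology.IsBounded (Om κ G) := h.KK_compact.isBounded.subset h.Om_sub

lemma closure_sub (h : Geo κ l G) {x : Pt} (hx : x ∈ closure (Om κ G)) : ∃ ζ : ℂ, 0 ≤ ζ.re ∧ ζ.re ≤ π ∧ FF κ G ζ = JE x := by
  have := closure_minimal h.Om_sub h.KK_compact.isClosed hx
  obtain ⟨_, ⟨ζ, hζ, rfl⟩, rfl⟩ := this
  exact ⟨ζ, hζ.1.1, hζ.1.2, by simp⟩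

lemma closure_mem (h : Geo κ l G) {ζ : ℂ} (h0 : 0 ≤ ζ.re) (hπ : ζ.re ≤ π) : JE.symm (FF κ G ζ) ∈ closure (Om κ G) := by
  have h1 : ζ ∈ closure OS := by
    have : OS = Ioo 0 π ×ℂ univ := by ext z; simp [OS, Complex.mem_reProdIm]
    rw [this, Complex.closure_reProdIm, closure_Ioo pi_pos.ne]
    exact ⟨⟨h0, hπ⟩, by simp⟩
  have h2 : FF κ G ζ ∈ closure (FF κ G '' OS) :=
    ContinuousWithinAt.mem_closure_image (h.FF_analytic h0 hπ).continuousAt.continuousWithinAt h1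
  rw [h.Om_eq']
  exact ContinuousWithinAt.mem_closure_image JE.symm.continuous.continuousAt.continuousWithinAt h2

lemma frontier_sub (h : Geo κ l G) {x : Pt} (hx : x ∈ frontier (Om κ G)) : ∃ ζ : ℂ, (ζ.re = 0 ∨ ζ.re = π) ∧ FF κ G ζ = JE x := by
  rw [h.Om_open.frontier_eq] at hx
  obtain ⟨ζ, h1, h2, h3⟩ := h.closure_sub hx.1
  refine ⟨ζ, ?_, h3⟩
  by_contra hc
  push Not at hc
  exact hx.2 ((h.mem_Om x).2 ⟨ζ, ⟨lt_of_le_of_ne h1 (Ne.symm hc.1), lt_of_le_of_ne h2 hc.2⟩, h3⟩)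

def uf (κ : ℝ) (G : ℂ → ℂ) (D : WD) (p : Pt) : ℝ := D.W (Function.invFun (La κ G) (Complex.log (JE p)))

lemma per_int {D : WD} {T : ℂ} (per : ∀ ζ, D.W (ζ + T) = D.W ζ) (n : ℤ) (ζ : ℂ) : D.W (ζ + n * T) = D.W ζ :=
  Function.Periodic.int_mul per n ζ

lemma uf_FF (h : Geo κ l G) (D : WD) (per : ∀ ζ, D.W (ζ + (2*π/(l*κ) : ℝ) * Complex.I) = D.W ζ) (ζ : ℂ) {x : Pt} (hx : JE x = FF κ G ζ) :
    uf κ G D x = D.W ζ := by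
  have hl : (l:ℂ) ≠ 0 := by exact_mod_cast h.lpos.ne'
  have h1 : Complex.exp (Complex.log (JE x)) = Complex.exp (La κ G ζ) := by
    rw [Complex.exp_log (by rw [hx]; exact Complex.exp_ne_zero _), hx, FF]
  obtain ⟨n, hn⟩ := Complex.exp_eq_exp_iff_exists_int.1 h1
  have h2 : Complex.log (JE x) = La κ G (ζ + ((n*l : ℤ):ℂ) * ((2*π/(l*κ) : ℝ) * Complex.I)) := by
    rw [hn, h.La_per_int]; push_cast; field_simp
  rw [uf, h2, Function.leftInverse_invFun h.bij.1, per_int per]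

lemma locA (h : Geo κ l G) (D : WD) (per : ∀ ζ, D.W (ζ + (2*π/(l*κ) : ℝ) * Complex.I) = D.W ζ) {ζ : ℂ} (h0 : 0 ≤ ζ.re) (hπ : ζ.re ≤ π)
    {p : Pt} (hp : FF κ G ζ = JE p) : ∃ g : ℂ → ℂ, AnalyticAt ℂ g (JE p) ∧ g (JE p) = ζ ∧ deriv g (JE p) = (deriv (FF κ G) ζ)⁻¹ ∧
      ∀ᶠ q in nhds p, uf κ G D q = D.W (g (JE q)) := by
  have hA := h.FF_analytic h0 hπ
  have hne := h.FF_deriv_ne h0 hπ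
  have hs := hA.hasStrictDerivAt
  refine ⟨hs.localInverse _ _ _ hne, ?_, ?_, ?_, ?_⟩
  · rw [← hp]; exact hA.analyticAt_localInverse hne
  · rw [← hp]; exact (hs.eventually_left_inverse hne).self_of_nhds
  · rw [← hp]; exact (hs.to_localInverse hne).hasDerivAt.deriv
  · have := hs.eventually_right_inverse hne
    rw [hp] at this
    filter_upwards [JE.continuous.continuousAt.eventually this] with q hq
    exact h.uf_FF D per _ hq.symm

lemma lap_const {u : Pt → ℝ} {x : Pt} {c : ℝ} (hu : ∀ᶠ q in nhds x, u q = c) : lap u x = 0 := by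
  have h1 : ∀ i, pd i u =ᶠ[nhds x] fun _ => 0 := by
    intro i
    have : u =ᶠ[nhds x] fun _ => c := hu
    filter_upwards [this.eventuallyEq_nhds] with q hq
    rw [pd, hq.fderiv_eq]; simp
  have h2 : ∀ i, pd i (pd i u) x = 0 := by
    intro i
    rw [pd, (h1 i).fderiv_eq]; simp
  rw [lap, h2, h2, add_zero]

lemma norm_polar {r θ : ℝ} (hr : 0 ≤ r) : ‖polar r θ‖ = r := by
  rw [← JE.norm_map, JE_polar, norm_mul, Complex.norm_exp_ofReal_mul_I, mul_one, Complex.norm_real, Real.norm_of_nonneg hr]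

theorem thmC (h : Geo κ l G) (D : WD) {μ : ℝ} (hμ : μ ≠ 0)
    (per : ∀ ζ, D.W (ζ + (2*π/(l*κ) : ℝ) * Complex.I) = D.W ζ)
    (one : ∀ ζ : ℂ, ζ.re = 0 → D.W ζ = 1)
    (bx : ∀ ζ : ℂ, ζ.re = 0 ∨ ζ.re = π → D.Wx ζ = 0) (bY : ∀ ζ : ℂ, ζ.re = 0 ∨ ζ.re = π → D.Wy ζ = 0)
    (pde : ∀ ζ : ℂ, 0 ≤ ζ.re → ζ.re ≤ π → D.Wxx ζ + D.Wyy ζ + μ * Complex.normSq (deriv (FF κ G) ζ) * D.W ζ = 0) :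
    IsOpen (Om κ G) ∧ IsConnected (Om κ G) ∧ Bornology.IsBounded (Om κ G) ∧
            ∃ u : Pt → ℝ,
              ContDiffOn ℝ 2 u (closure (Om κ G)) ∧
              (∃ x ∈ closure (Om κ G), ∃ y ∈ closure (Om κ G), u x ≠ u y) ∧
              (∀ x ∈ Om κ G, lap u x + μ * u x = 0) ∧
              (∀ x ∈ frontier (Om κ G), fderivWithin ℝ u (closure (Om κ G)) x = 0) ∧
              ((∃ θ₁ θ₂, rho κ G 0 θ₁ ≠ rho κ G 0 θ₂) → ¬ ∃ g : ℝ → ℝ, ∀ x ∈ closure (Om κ G), u x = g ‖x‖) := by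
  have hpde : ∀ x ∈ Om κ G, lap (uf κ G D) x + μ * uf κ G D x = 0 := by
    intro x hx
    obtain ⟨ζ, hζ, he⟩ := (h.mem_Om x).1 hx
    obtain ⟨g, g1, g2, g3, g4⟩ := h.locA D per hζ.1.le hζ.2.le he
    rw [(lap_comp D g1 g4).2.2, g2, g3, h.uf_FF D per ζ he.symm, Complex.normSq_inv]
    have hp := pde ζ hζ.1.le hζ.2.le
    have hne : Complex.normSq (deriv (FF κ G) ζ) ≠ 0 := by
      rw [Ne, Complex.normSq_eq_zero]; exact h.FF_deriv_ne hζ.1.le hζ.2.le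
    field_simp
    linarith
  have hno : ∀ x ∈ Om κ G, ¬ ∀ᶠ q in nhds x, uf κ G D q = 1 := by
    intro x hx hc
    have h1 := hpde x hx
    rw [lap_const hc, hc.self_of_nhds] at h1
    exact hμ (by linarith)
  have hone : ∀ y : ℝ, uf κ G D (JE.symm (FF κ G (y * Complex.I))) = 1 := by
    intro y
    rw [h.uf_FF D per (y * Complex.I) (by simp)]
    exact one _ (by simp)
  have hcl : ∀ y : ℝ, JE.symm (FF κ G (y * Complex.I)) ∈ closure (Om κ G) :=
    fun y => h.closure_mem (by simp) (by simp [pi_pos.le])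
  refine ⟨h.Om_open, h.Om_conn, h.Om_bdd, uf κ G D, ?_, ?_, hpde, ?_, ?_⟩
  · intro x hx
    obtain ⟨ζ, h1, h2, he⟩ := h.closure_sub hx
    obtain ⟨g, g1, g2, g3, g4⟩ := h.locA D per h1 h2 he
    exact (lap_comp D g1 g4).1.contDiffWithinAt
  · by_contra hc
    push Not at hc
    obtain ⟨x, hx⟩ := h.Om_conn.nonempty
    refine hno x hx ?_
    filter_upwards [h.Om_open.mem_nhds hx] with q hq
    rw [hc q (subset_closure hq) _ (hcl 0), hone]
  · intro x hx
    obtain ⟨ζ, hz, he⟩ := h.frontier_sub hx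
    have h12 : 0 ≤ ζ.re ∧ ζ.re ≤ π := by
      rcases hz with hz | hz <;> rw [hz] <;> simp [pi_pos.le]
    obtain ⟨g, g1, g2, g3, g4⟩ := h.locA D per h12.1 h12.2 he
    have := (lap_comp D g1 g4).2.1 (by rw [g2]; exact bx ζ hz) (by rw [g2]; exact bY ζ hz)
    rw [fderivWithin, if_pos this.hasFDerivWithinAt]
  · rintro ⟨θ₁, θ₂, hθ⟩ ⟨g, hg⟩
    have hg1 : ∀ θ, g (Real.exp (rho κ G 0 θ)) = 1 := by
      intro θ
      obtain ⟨y, rfl⟩ := (h.hh_bij 0).2 θ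
      rw [h.rho_hh, ← hone y, hg _ (hcl y)]
      congr 1
      rw [JE.symm.norm_map, FF, Complex.norm_exp, rr]
      simp
    have hcont : Continuous fun θ => Real.exp (rho κ G 0 θ) := by
      refine Real.continuous_exp.comp ?_
      rw [continuous_iff_continuousAt]
      exact fun θ => (h.rho_analytic le_rfl pi_pos.le θ).continuousAt
    wlog hlt : rho κ G 0 θ₁ < rho κ G 0 θ₂ generalizing θ₁ θ₂
    · exact this θ₂ θ₁ hθ.symm (lt_of_le_of_ne (not_lt.1 hlt) hθ.symm)
    have hb : rho κ G 0 θ₁ < rho κ G π θ₁ := by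
      obtain ⟨y, rfl⟩ := (h.hh_bij 0).2 θ₁
      have := (h.lt_rho π ((0:ℝ) + y * Complex.I)).2.1 (by simp [pi_pos])
      rw [h.rho_hh]; exact this
    obtain ⟨r, hr1, hr2⟩ := exists_between (lt_min (Real.exp_lt_exp.2 hlt) (Real.exp_lt_exp.2 hb))
    have hr0 : 0 < r := (Real.exp_pos _).trans hr1
    have hx : polar r θ₁ ∈ Om κ G := ⟨r, θ₁, hr1, hr2.trans_le (min_le_right _ _), rfl⟩
    refine hno _ hx ?_
    have hn : ∀ᶠ q in nhds (polar r θ₁), ‖q‖ ∈ Ioo (Real.exp (rho κ G 0 θ₁)) (Real.exp (rho κ G 0 θ₂)) := by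
      refine continuous_norm.continuousAt.eventually (Ioo_mem_nhds ?_ ?_)
      · change _ < ‖polar r θ₁‖; rw [norm_polar hr0.le]; exact hr1
      · change ‖polar r θ₁‖ < _; rw [norm_polar hr0.le]; exact hr2.trans_le (min_le_left _ _)
    filter_upwards [hn, h.Om_open.mem_nhds hx] with q hq1 hq2
    rw [hg q (subset_closure hq2)]
    obtain ⟨θ, hθ⟩ := mem_range_of_exists_le_of_exists_ge hcont ⟨θ₁, hq1.1.le⟩ ⟨θ₂, hq1.2.le⟩
    rw [← hθ]; exact hg1 θ

end Geo

end Schiffer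
end

set_option linter.unusedSectionVars false
set_option linter.unusedSimpArgs false
noncomputable section
namespace Schiffer

/-! ### The conformal map -/

def ST (τ : ℝ) (A D : ℕ → ℝ) (k : ℕ) (ζ : ℂ) : ℂ :=
  (1/2:ℂ)^k * (A k * Complex.exp (-(k*τ) * ζ) + D k * Complex.exp (-(k*τ) * (π - ζ)))

lemma SS_def (τ : ℝ) (A D : ℕ → ℝ) (ζ : ℂ) : SS τ A D ζ = ∑' k, ST τ A D k ζ := rfl

lemma exp_quarter : Real.exp (1/4) ≤ 3/2 := by
  have h : Real.exp (1/4) ^ 4 = Real.exp 1 := by rw [← Real.exp_nat_mul]; norm_num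
  have := Real.exp_one_lt_d9
  by_contra hc
  push Not at hc
  have : (3/2:ℝ)^4 < Real.exp (1/4) ^ 4 := by gcongr
  norm_num at this
  linarith

lemma exp_bd {τ : ℝ} (h0 : 0 ≤ τ) (h2 : τ ≤ 2) (k : ℕ) {ζ : ℂ} (hz : -(1/8) ≤ ζ.re) : ‖Complex.exp (-(k*τ) * ζ)‖ ≤ (3/2)^k := by
  rw [Complex.norm_exp]
  have e : (-(k*τ) * ζ : ℂ).re = k * (-(τ * ζ.re)) := by
    have : (-(k*τ) * ζ : ℂ) = ((-(k*τ) : ℝ):ℂ) * ζ := by push_cast; ring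
    rw [this, Complex.re_ofReal_mul]; ring
  rw [e, Real.exp_nat_mul]
  have h1 : -(τ * ζ.re) ≤ 1/4 := by nlinarith
  have h3 : Real.exp (-(τ * ζ.re)) ≤ 3/2 := (Real.exp_le_exp.2 h1).trans exp_quarter
  gcongr

lemma ST_bd {τ C : ℝ} {A D : ℕ → ℝ} (h0 : 0 ≤ τ) (h2 : τ ≤ 2) (hA : ∀ k, |A k| ≤ C) (hD : ∀ k, |D k| ≤ C) (k : ℕ) {ζ : ℂ} (hz : ζ ∈ strip) :
    ‖ST τ A D k ζ‖ ≤ 2*C*(3/4)^k := by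
  have hC : 0 ≤ C := (abs_nonneg _).trans (hA 0)
  have e1 := exp_bd h0 h2 k hz.1.le
  have e2 := exp_bd h0 h2 k (ζ := π - ζ) (by simp; linarith [hz.2])
  rw [ST, norm_mul, norm_pow]
  have hh : ‖(1/2:ℂ)‖ = 1/2 := by norm_num
  have h3 : ‖(A k * Complex.exp (-(k*τ) * ζ) + D k * Complex.exp (-(k*τ) * (π - ζ)) : ℂ)‖ ≤ 2 * C * (3/2)^k := by
    refine (norm_add_le _ _).trans ?_
    rw [norm_mul, norm_mul, Complex.norm_real, Complex.norm_real, Real.norm_eq_abs, Real.norm_eq_abs]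
    have a1 := mul_le_mul (hA k) e1 (norm_nonneg _) hC
    have a2 := mul_le_mul (hD k) e2 (norm_nonneg _) hC
    linarith
  rw [hh]
  calc (1/2:ℝ)^k * _ ≤ (1/2:ℝ)^k * (2 * C * (3/2)^k) := by gcongr
    _ = 2*C*((1/2)*(3/2))^k := by rw [mul_pow]; ring
    _ = _ := by norm_num

lemma geo_sum (C : ℝ) : HasSum (fun k : ℕ => 2*C*(3/4:ℝ)^k) (8*C) := by
  have := (hasSum_geometric_of_lt_one (r := (3/4:ℝ)) (by norm_num) (by norm_num)).mul_left (2*C)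
  have e : 2*C*(1 - 3/4:ℝ)⁻¹ = 8*C := by norm_num; linarith
  rwa [e] at this

lemma ST_summable {τ C : ℝ} {A D : ℕ → ℝ} (h0 : 0 ≤ τ) (h2 : τ ≤ 2) (hA : ∀ k, |A k| ≤ C) (hD : ∀ k, |D k| ≤ C) {ζ : ℂ} (hz : ζ ∈ strip) :
    Summable fun k => ST τ A D k ζ :=
  Summable.of_norm_bounded (geo_sum C).summable fun k => ST_bd h0 h2 hA hD k hz

lemma SS_bd {τ C : ℝ} {A D : ℕ → ℝ} (h0 : 0 ≤ τ) (h2 : τ ≤ 2) (hA : ∀ k, |A k| ≤ C) (hD : ∀ k, |D k| ≤ C) {ζ : ℂ} (hz : ζ ∈ strip) :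
    ‖SS τ A D ζ‖ ≤ 8*C :=
  tsum_of_norm_bounded (geo_sum C) fun k => ST_bd h0 h2 hA hD k hz

lemma SS_deriv {τ C : ℝ} {A D : ℕ → ℝ} (h0 : 0 ≤ τ) (h2 : τ ≤ 2) (hA : ∀ k, |A k| ≤ C) (hD : ∀ k, |D k| ≤ C)
    (hA' : ∀ k : ℕ, |-(k*τ) * A k| ≤ C) (hD' : ∀ k : ℕ, |k*τ * D k| ≤ C) {ζ : ℂ} (hz : ζ ∈ strip) :
    HasDerivAt (SS τ A D) (SS τ (fun k => -(k*τ) * A k) (fun k => k*τ * D k) ζ) ζ := by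
  refine hasDerivAt_tsum_of_isPreconnected (geo_sum C).summable strip_open strip_convex.isPreconnected
    (g := fun k ζ => ST τ A D k ζ) (g' := fun k ζ => ST τ (fun k => -(k*τ) * A k) (fun k => k*τ * D k) k ζ) ?_ ?_ hz (ST_summable h0 h2 hA hD hz) hz
  · intro k ζ _
    have d1 : HasDerivAt (fun ζ : ℂ => Complex.exp (-(k*τ) * ζ)) (Complex.exp (-(k*τ) * ζ) * (-(k*τ))) ζ := by
      have := (((hasDerivAt_id ζ).const_mul (-(k*τ) : ℂ))).cexp
      simpa using this
    have d2 : HasDerivAt (fun ζ : ℂ => Complex.exp (-(k*τ) * (π - ζ))) (Complex.exp (-(k*τ) * (π - ζ)) * (k*τ)) ζ := by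
      have := ((((hasDerivAt_id ζ).const_sub (π:ℂ))).const_mul (-(k*τ) : ℂ)).cexp
      simpa using this
    have := ((d1.const_mul (A k : ℂ)).add (d2.const_mul (D k : ℂ))).const_mul ((1/2:ℂ)^k)
    refine HasDerivAt.congr_deriv this ?_
    rw [ST]; push_cast; ring
  · intro k ζ hζ
    exact ST_bd h0 h2 hA' hD' k hζ

structure Par (τ : ℝ) (l : ℕ) (A D : ℕ → ℝ) (s : ℝ) : Prop where
  t1 : 1 ≤ τ
  t2 : τ ≤ 2
  l4 : 4 ≤ l
  A0 : A 0 = 0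
  hA : ∀ k, |A k| ≤ 2
  hD : ∀ k, |D k| ≤ 2
  hs : 128 * |s| * l ≤ 1

def pA (l : ℕ) (A : ℕ → ℝ) (k : ℕ) : ℝ := A k / (1 - k*l)
def pD (l : ℕ) (D : ℕ → ℝ) (k : ℕ) : ℝ := D k / (1 + k*l)
def phi (τ : ℝ) (l : ℕ) (A D : ℕ → ℝ) (ζ : ℂ) : ℂ := SS τ (pA l A) (pD l D) ζ
def GG (τ : ℝ) (l : ℕ) (A D : ℕ → ℝ) (s : ℝ) (ζ : ℂ) : ℂ := Complex.log (1 + s * phi τ l A D ζ)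

lemma den_A {l : ℕ} (hl : 4 ≤ l) (k : ℕ) : 1 ≤ |(1 - k*l : ℝ)| ∧ 2*k ≤ |(1 - k*l : ℝ)| := by
  have hl' : (4:ℝ) ≤ l := by exact_mod_cast hl
  rcases Nat.eq_zero_or_pos k with rfl | hk
  · simp
  · have hk' : (1:ℝ) ≤ k := by exact_mod_cast hk
    have h1 : (k*l - 1 : ℝ) ≤ |(1 - k*l : ℝ)| := by rw [abs_sub_comm]; exact le_abs_self _
    constructor <;> nlinarith
lemma den_D {l : ℕ} (hl : 4 ≤ l) (k : ℕ) : 1 ≤ |(1 + k*l : ℝ)| ∧ 2*k ≤ |(1 + k*l : ℝ)| := by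
  have hl' : (4:ℝ) ≤ l := by exact_mod_cast hl
  have hk' : (0:ℝ) ≤ k := Nat.cast_nonneg k
  rw [abs_of_nonneg (by positivity)]
  constructor <;> nlinarith

lemma quot_bd {a d C : ℝ} (ha : |a| ≤ C) (hd : 1 ≤ |d|) : |a/d| ≤ C := by
  rw [abs_div, div_le_iff₀ (by linarith)]
  nlinarith [(abs_nonneg a).trans ha]

lemma quot_bd' {a d C τ : ℝ} {k : ℕ} (ha : |a| ≤ C) (hd : 1 ≤ |d|) (hk : 2*k ≤ |d|) (h0 : 0 ≤ τ) (h2 : τ ≤ 2) : |k*τ*(a/d)| ≤ C := by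
  have hC := (abs_nonneg a).trans ha
  rw [abs_mul, abs_div, abs_of_nonneg (by positivity : (0:ℝ) ≤ k*τ), mul_div_assoc', div_le_iff₀ (by linarith)]
  have : k*τ ≤ |d| := by nlinarith [Nat.cast_nonneg (α := ℝ) k]
  calc k*τ*|a| ≤ |d| * C := mul_le_mul this ha (abs_nonneg _) (abs_nonneg _)
    _ = _ := mul_comm _ _

lemma pA_bd {l : ℕ} (hl : 4 ≤ l) {A : ℕ → ℝ} {C : ℝ} (hA : ∀ k, |A k| ≤ C) (k : ℕ) : |pA l A k| ≤ C := quot_bd (hA k) (den_A hl k).1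
lemma pD_bd {l : ℕ} (hl : 4 ≤ l) {A : ℕ → ℝ} {C : ℝ} (hA : ∀ k, |A k| ≤ C) (k : ℕ) : |pD l A k| ≤ C := quot_bd (hA k) (den_D hl k).1

namespace Par
variable {τ : ℝ} {l : ℕ} {A D : ℕ → ℝ} {s : ℝ}

lemma t0 (h : Par τ l A D s) : 0 ≤ τ := by linarith [h.t1]
lemma lpos (h : Par τ l A D s) : (0:ℝ) < l := by
  have := h.l4
  exact_mod_cast (by omega : 0 < l)

lemma phi_bd (h : Par τ l A D s) {ζ : ℂ} (hz : ζ ∈ strip) : ‖phi τ l A D ζ‖ ≤ 16 :=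
  (SS_bd h.t0 h.t2 (pA_bd h.l4 h.hA) (pD_bd h.l4 h.hD) hz).trans (by norm_num)

lemma A' (h : Par τ l A D s) (k : ℕ) : |-(k*τ) * pA l A k| ≤ 2 := by
  rw [neg_mul, abs_neg]
  exact quot_bd' (h.hA k) (den_A h.l4 k).1 (den_A h.l4 k).2 h.t0 h.t2
lemma D' (h : Par τ l A D s) (k : ℕ) : |k*τ * pD l D k| ≤ 2 :=
  quot_bd' (h.hD k) (den_D h.l4 k).1 (den_D h.l4 k).2 h.t0 h.t2

def dphi (τ : ℝ) (l : ℕ) (A D : ℕ → ℝ) (ζ : ℂ) : ℂ := SS τ (fun k => -(k*τ) * pA l A k) (fun k => k*τ * pD l D k) ζ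

lemma phi_deriv (h : Par τ l A D s) {ζ : ℂ} (hz : ζ ∈ strip) : HasDerivAt (phi τ l A D) (dphi τ l A D ζ) ζ :=
  SS_deriv h.t0 h.t2 (pA_bd h.l4 h.hA) (pD_bd h.l4 h.hD) h.A' h.D' hz

lemma dphi_bd (h : Par τ l A D s) {ζ : ℂ} (hz : ζ ∈ strip) : ‖dphi τ l A D ζ‖ ≤ 16 :=
  (SS_bd h.t0 h.t2 h.A' h.D' hz).trans (by norm_num)

lemma ident (h : Par τ l A D s) {ζ : ℂ} (hz : ζ ∈ strip) :
    ((τ/l : ℝ):ℂ) * phi τ l A D ζ + dphi τ l A D ζ = ((τ/l : ℝ):ℂ) * SS τ A D ζ := by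
  rw [phi, dphi, SS_def, SS_def, SS_def, ← tsum_mul_left, ← tsum_mul_left, ← Summable.tsum_add
    ((ST_summable h.t0 h.t2 (pA_bd h.l4 h.hA) (pD_bd h.l4 h.hD) hz).mul_left _) (ST_summable h.t0 h.t2 h.A' h.D' hz)]
  congr 1; ext k
  have hl := h.lpos
  have d1 : (1 - k*l : ℝ) ≠ 0 := fun hc => by have := (den_A h.l4 k).1; rw [hc, abs_zero] at this; linarith
  have d2 : (1 + k*l : ℝ) ≠ 0 := fun hc => by have := (den_D h.l4 k).1; rw [hc, abs_zero] at this; linarith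
  have e1 : τ/l * pA l A k + -(k*τ) * pA l A k = τ/l * A k := by
    have : pA l A k * (1 - k*l) = A k := by rw [pA]; exact div_mul_cancel₀ _ d1
    rw [← this]; field_simp; ring
  have e2 : τ/l * pD l D k + (k*τ) * pD l D k = τ/l * D k := by rw [pD]; field_simp
  have e1' : ((τ/l : ℝ):ℂ) * (pA l A k : ℝ) + ((-(k*τ) * pA l A k : ℝ):ℂ) = ((τ/l : ℝ):ℂ) * (A k : ℝ) := by exact_mod_cast e1
  have e2' : ((τ/l : ℝ):ℂ) * (pD l D k : ℝ) + ((k*τ * pD l D k : ℝ):ℂ) = ((τ/l : ℝ):ℂ) * (D k : ℝ) := by exact_mod_cast e2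
  rw [ST, ST, ST]
  linear_combination (1/2:ℂ)^k * Complex.exp (-(k*τ) * ζ) * e1' + (1/2:ℂ)^k * Complex.exp (-(k*τ) * (π - ζ)) * e2'

lemma s_bd (h : Par τ l A D s) : 512 * |s| ≤ 1 := by
  have h1 := h.hs
  have : (4:ℝ) ≤ l := by exact_mod_cast h.l4
  nlinarith [abs_nonneg s]

lemma sphi_bd (h : Par τ l A D s) {ζ : ℂ} (hz : ζ ∈ strip) : ‖(s:ℂ) * phi τ l A D ζ‖ ≤ 16 * |s| ∧ ‖(s:ℂ) * phi τ l A D ζ‖ ≤ 1/2 := by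
  have h1 := h.phi_bd hz
  have h2 := h.s_bd
  have : ‖(s:ℂ) * phi τ l A D ζ‖ ≤ 16 * |s| := by
    rw [norm_mul, Complex.norm_real, Real.norm_eq_abs]; nlinarith [abs_nonneg s]
  exact ⟨this, by linarith⟩

lemma one_add_mem (h : Par τ l A D s) {ζ : ℂ} (hz : ζ ∈ strip) : 1 + (s:ℂ) * phi τ l A D ζ ∈ Complex.slitPlane := by
  left
  have h1 := (h.sphi_bd hz).2
  have := (abs_le.1 ((Complex.abs_re_le_norm _).trans h1)).1
  rw [Complex.add_re, Complex.one_re]; linarith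

lemma GG_deriv (h : Par τ l A D s) {ζ : ℂ} (hz : ζ ∈ strip) :
    HasDerivAt (GG τ l A D s) (s * dphi τ l A D ζ / (1 + s * phi τ l A D ζ)) ζ :=
  (((h.phi_deriv hz).const_mul (s:ℂ)).const_add 1).clog (h.one_add_mem hz)

lemma phi_per (h : Par τ l A D s) (ζ : ℂ) : phi τ l A D (ζ + (2*π/τ : ℝ) * Complex.I) = phi τ l A D ζ := by
  rw [phi, phi, SS_def, SS_def]
  congr 1; ext k
  have ht : (τ:ℂ) ≠ 0 := by have := h.t1; exact_mod_cast (by linarith : τ ≠ 0)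
  rw [ST, ST]
  have e1 : Complex.exp (-(k*τ) * (ζ + (2*π/τ : ℝ) * Complex.I)) = Complex.exp (-(k*τ) * ζ) := by
    rw [Complex.exp_eq_exp_iff_exists_int]
    refine ⟨-k, ?_⟩
    push_cast; field_simp; ring
  have e2 : Complex.exp (-(k*τ) * (π - (ζ + (2*π/τ : ℝ) * Complex.I))) = Complex.exp (-(k*τ) * (π - ζ)) := by
    rw [Complex.exp_eq_exp_iff_exists_int]
    refine ⟨k, ?_⟩
    push_cast; field_simp; ring
  rw [e1, e2]

lemma lk (h : Par τ l A D s) : l * (τ/l) = τ := by have := h.lpos; field_simp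

lemma geo (h : Par τ l A D s) : Geo (τ/l) l (GG τ l A D s) where
  kpos := div_pos (by linarith [h.t1]) h.lpos
  lpos := by have := h.l4; omega
  diff := fun ζ hz => (h.GG_deriv hz).differentiableAt.differentiableWithinAt
  bd := fun ζ hz => by
    rw [(h.GG_deriv hz).deriv, norm_div, norm_mul, Complex.norm_real, Real.norm_eq_abs]
    have h1 := (h.sphi_bd hz).2
    have h2 := h.dphi_bd hz
    have h3 : 1/2 ≤ ‖1 + (s:ℂ) * phi τ l A D ζ‖ := by
      have := norm_sub_norm_le (1:ℂ) (-((s:ℂ) * phi τ l A D ζ))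
      rw [norm_neg, sub_neg_eq_add, norm_one] at this
      linarith
    have h4 : 32 * |s| ≤ τ/l/4 := by
      rw [div_div, le_div_iff₀ (by have := h.lpos; positivity)]
      have := h.hs
      linarith [h.t1]
    rw [div_le_iff₀ (by linarith)]
    calc |s| * ‖dphi τ l A D ζ‖ ≤ |s| * 16 := by gcongr
      _ = 32 * |s| * (1/2) := by ring
      _ ≤ _ := by gcongr; exact (mul_nonneg (by norm_num) (abs_nonneg s)).trans h4
  per := fun ζ => by
    rw [h.lk, GG, GG, h.phi_per]

lemma clS {ζ : ℂ} (h0 : 0 ≤ ζ.re) (hπ : ζ.re ≤ π) : ζ ∈ strip := (Geo.cmem h0 hπ rfl).1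

lemma FF_eq (h : Par τ l A D s) {ζ : ℂ} (h0 : 0 ≤ ζ.re) (hπ : ζ.re ≤ π) :
    Geo.FF (τ/l) (GG τ l A D s) ζ = Complex.exp ((τ/l : ℝ) * (ζ - π)) * (1 + s * phi τ l A D ζ) := by
  rw [Geo.FF, Geo.La, clC_eq (by linarith) (by linarith), Complex.exp_add, GG, Complex.exp_log]
  exact Complex.slitPlane_ne_zero (h.one_add_mem (clS h0 hπ))

lemma FF_deriv (h : Par τ l A D s) {ζ : ℂ} (h0 : 0 ≤ ζ.re) (hπ : ζ.re ≤ π) :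
    deriv (Geo.FF (τ/l) (GG τ l A D s)) ζ = (τ/l : ℝ) * Complex.exp ((τ/l : ℝ) * (ζ - π)) * (1 + s * SS τ A D ζ) := by
  have hz := clS h0 hπ
  have hne := Complex.slitPlane_ne_zero (h.one_add_mem hz)
  have hi := h.ident hz
  rw [h.geo.FF_deriv h0 hπ, h.FF_eq h0 hπ, (h.GG_deriv hz).deriv]
  generalize ((τ/l : ℝ):ℂ) = κ at *
  field_simp
  linear_combination (s:ℂ) * hi

lemma FF_normSq (h : Par τ l A D s) {ζ : ℂ} (h0 : 0 ≤ ζ.re) (hπ : ζ.re ≤ π) :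
    Complex.normSq (deriv (Geo.FF (τ/l) (GG τ l A D s)) ζ) = (τ/l)^2 * Real.exp (-(2*(τ/l)*π)) * Real.exp (2*(1/l)*τ*ζ.re) * Complex.normSq (1 + s * SS τ A D ζ) := by
  rw [h.FF_deriv h0 hπ, Complex.normSq_mul, Complex.normSq_mul, Complex.normSq_ofReal, Complex.normSq_eq_norm_sq (Complex.exp _), Complex.norm_exp]
  have e : (((τ/l : ℝ):ℂ) * (ζ - π)).re = τ/l * (ζ.re - π) := by
    rw [Complex.re_ofReal_mul]; simp
  rw [e, ← Real.exp_nat_mul, mul_assoc ((τ/l)^2), ← Real.exp_add]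
  have e2 : ((2:ℕ):ℝ) * (τ/l * (ζ.re - π)) = -(2*(τ/l)*π) + 2*(1/l)*τ*ζ.re := by push_cast; ring
  rw [e2]; ring

end Par

end Schiffer
end

set_option linter.unusedSectionVars false
set_option linter.unusedSimpArgs false
noncomputable section
namespace Schiffer

/-! ### Asymptotics of the boundary curves -/

def one1 (d : ℝ) (k : ℕ) : ℝ := if k = 1 then d else 0

def gam (τ d : ℝ) (l : ℕ) (c : ℝ) : ℝ := 1/2 * (Real.exp (-(τ*c))/(1-l) + d * Real.exp (-(τ*(π-c)))/(1+l))

lemma norm_one_add (w : ℂ) (hw : ‖w‖ ≤ 1/2) : |‖1 + w‖ - 1 - w.re| ≤ ‖w‖^2 := by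
  have h1 : ‖1+w‖^2 = (1+w.re)^2 + w.im^2 := by
    rw [Complex.sq_norm, Complex.normSq_apply]; simp; ring
  have h2 : ‖w‖^2 = w.re^2 + w.im^2 := by
    rw [Complex.sq_norm, Complex.normSq_apply]; ring
  have h3 := (abs_le.1 ((Complex.abs_re_le_norm w).trans hw)).1
  have h4 := norm_nonneg (1+w)
  have h5 : 1 + w.re ≤ ‖1+w‖ := by
    have := Complex.re_le_norm (1+w)
    simpa using this
  rw [abs_le]
  constructor
  · nlinarith [sq_nonneg ‖w‖]
  · have h6 : (‖1+w‖ - 1 - w.re) * (‖1+w‖ + (1 + w.re)) = w.im^2 := by nlinarith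
    have h7 : 1 ≤ ‖1+w‖ + (1 + w.re) := by linarith
    nlinarith [sq_nonneg w.re]

lemma exp_re' (τ : ℝ) (z : ℂ) : (Complex.exp (-(τ:ℂ) * z)).re = Real.exp (-(τ * z.re)) * Real.cos (τ * z.im) := by
  have : (-(τ:ℂ) * z) = ((-τ : ℝ):ℂ) * z := by push_cast; ring
  rw [this, Complex.exp_re, Complex.re_ofReal_mul, Complex.im_ofReal_mul, neg_mul, neg_mul, Real.cos_neg]

lemma SS_one (τ d : ℝ) (l : ℕ) (ζ : ℂ) : (SS τ (pA l (one1 1)) (pD l (one1 d)) ζ).re = gam τ d l ζ.re * Real.cos (τ * ζ.im) := by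
  have h : SS τ (pA l (one1 1)) (pD l (one1 d)) ζ = ST τ (pA l (one1 1)) (pD l (one1 d)) 1 ζ := by
    rw [SS_def]
    refine tsum_eq_single 1 fun k hk => ?_
    simp [ST, pA, pD, one1, hk]
  rw [h, ST]
  have e : (1/2:ℂ)^1 * (((pA l (one1 1) 1 : ℝ):ℂ) * Complex.exp (-((1:ℕ)*τ) * ζ) + ((pD l (one1 d) 1 : ℝ):ℂ) * Complex.exp (-((1:ℕ)*τ) * (π - ζ)))
      = ((1/2 : ℝ):ℂ) * (((1/(1-l) : ℝ):ℂ) * Complex.exp (-(τ:ℂ) * ζ) + ((d/(1+l) : ℝ):ℂ) * Complex.exp (-(τ:ℂ) * (π - ζ))) := by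
    simp [pA, pD, one1]
  rw [e, Complex.re_ofReal_mul, Complex.add_re, Complex.re_ofReal_mul, Complex.re_ofReal_mul, exp_re', exp_re', gam]
  have e1 : ((π:ℂ) - ζ).re = π - ζ.re := by simp
  have e2 : ((π:ℂ) - ζ).im = -ζ.im := by simp
  rw [e1, e2, mul_neg, Real.cos_neg]
  ring

lemma gam_le {τ d : ℝ} {l : ℕ} {c : ℝ} (hl : 4 ≤ l) (hτ : 0 ≤ τ) (hd : |d| ≤ 2) (h0 : 0 ≤ c) (hπ : c ≤ π) : |gam τ d l c| ≤ 1 := by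
  have hl' : (4:ℝ) ≤ l := by exact_mod_cast hl
  have e1 : Real.exp (-(τ*c)) ≤ 1 := Real.exp_le_one_iff.2 (by nlinarith)
  have e2 : Real.exp (-(τ*(π-c))) ≤ 1 := Real.exp_le_one_iff.2 (by nlinarith)
  have a1 : |Real.exp (-(τ*c))/(1-l)| ≤ 1/3 := by
    rw [abs_div, abs_of_pos (Real.exp_pos _), abs_of_neg (by linarith : (1-l:ℝ) < 0), div_le_iff₀ (by linarith)]
    linarith
  have a2 : |d * Real.exp (-(τ*(π-c)))/(1+l)| ≤ 2/5 := by
    rw [abs_div, abs_mul, abs_of_pos (Real.exp_pos _), abs_of_pos (by linarith : (0:ℝ) < 1+l), div_le_iff₀ (by linarith)]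
    have := mul_le_mul hd e2 (Real.exp_pos _).le (by norm_num)
    linarith
  rw [gam, abs_mul]
  have := abs_add_le (Real.exp (-(τ*c))/(1-l)) (d * Real.exp (-(τ*(π-c)))/(1+l))
  have h2 : |(1/2:ℝ)| = 1/2 := by norm_num
  rw [h2]; linarith

namespace Par
variable {τ : ℝ} {l : ℕ} {A D : ℕ → ℝ} {s : ℝ}

lemma phi_near (h : Par τ l A D s) {d M : ℝ} (hd : |d| ≤ 2) (hA : ∀ k, |A k - one1 1 k| ≤ M) (hD : ∀ k, |D k - one1 d k| ≤ M) {ζ : ℂ} (hz : ζ ∈ strip) :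
    |(phi τ l A D ζ).re - gam τ d l ζ.re * Real.cos (τ * ζ.im)| ≤ 8 * M := by
  have o1 : ∀ k, |one1 1 k| ≤ 2 := by intro k; unfold one1; split_ifs <;> norm_num
  have o2 : ∀ k, |one1 d k| ≤ 2 := by intro k; unfold one1; split_ifs <;> simp [hd]
  have e : phi τ l A D ζ - SS τ (pA l (one1 1)) (pD l (one1 d)) ζ = SS τ (pA l fun k => A k - one1 1 k) (pD l fun k => D k - one1 d k) ζ := by
    rw [phi, SS_def, SS_def, SS_def, ← Summable.tsum_sub (ST_summable h.t0 h.t2 (pA_bd h.l4 h.hA) (pD_bd h.l4 h.hD) hz)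
      (ST_summable h.t0 h.t2 (pA_bd h.l4 o1) (pD_bd h.l4 o2) hz)]
    congr 1; ext k
    simp only [ST, pA, pD]
    push_cast
    ring
  have hb := SS_bd h.t0 h.t2 (pA_bd h.l4 hA) (pD_bd h.l4 hD) hz
  rw [← SS_one, ← Complex.sub_re, e]
  exact (Complex.abs_re_le_norm _).trans hb

lemma asym (h : Par τ l A D s) {d M c : ℝ} (hd : |d| ≤ 2) (hA : ∀ k, |A k - one1 1 k| ≤ M) (hD : ∀ k, |D k - one1 d k| ≤ M)
    (h0 : 0 ≤ c) (hπ : c ≤ π) (θ : ℝ) :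
    |Real.exp (Geo.rho (τ/l) (GG τ l A D s) c θ) - Real.exp (τ/l*(c-π)) * (1 + s * (gam τ d l c * Real.cos (l*θ)))| ≤
      |s| * (8*M + (24*l + 256) * |s|) := by
  obtain ⟨y, rfl⟩ := (h.geo.hh_bij c).2 θ
  rw [h.geo.rho_hh]
  set ζ : ℂ := c + y * Complex.I with hζ
  have hre : ζ.re = c := by simp [hζ]
  have him : ζ.im = y := by simp [hζ]
  have hz : ζ ∈ strip := clS (by rw [hre]; exact h0) (by rw [hre]; exact hπ)
  set w : ℂ := s * phi τ l A D ζ with hw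
  have hwb := h.sphi_bd hz
  rw [← hw] at hwb
  have eA : Real.exp (Geo.rr (τ/l) (GG τ l A D s) c y) = Real.exp (τ/l*(c-π)) * ‖1 + w‖ := by
    have := h.FF_eq (ζ := ζ) (by rw [hre]; exact h0) (by rw [hre]; exact hπ)
    have h2 := congrArg norm this
    rw [Geo.FF, Complex.norm_exp, norm_mul, Complex.norm_exp, Complex.re_ofReal_mul, Complex.sub_re, hre, Complex.ofReal_re] at h2
    exact h2
  have eB : Geo.hh (τ/l) (GG τ l A D s) c y = τ/l * y + (Complex.log (1+w)).im := by
    rw [Geo.hh, ← hζ, Geo.La, clC_eq (by rw [hre]; linarith) (by rw [hre]; linarith), GG, ← hw, Complex.add_im, Complex.im_ofReal_mul]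
    simp [him]
  have hlog : |(Complex.log (1+w)).im| ≤ 24 * |s| := by
    have h1 := Complex.norm_log_one_add_half_le_self hwb.2
    have := Complex.abs_im_le_norm (Complex.log (1+w))
    linarith [hwb.1]
  have hl := h.lpos
  have hcos : |Real.cos (τ * y) - Real.cos (l * Geo.hh (τ/l) (GG τ l A D s) c y)| ≤ 24 * l * |s| := by
    refine (Real.abs_cos_sub_cos_le _ _).trans ?_
    have e : τ * y - l * Geo.hh (τ/l) (GG τ l A D s) c y = -(l * (Complex.log (1+w)).im) := by
      rw [eB]; field_simp; ring
    rw [e, abs_neg, abs_mul, abs_of_pos hl]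
    nlinarith
  have hphi := h.phi_near hd hA hD hz
  rw [hre, him] at hphi
  have hg := gam_le (c := c) h.l4 h.t0 hd h0 hπ
  have hn := norm_one_add w hwb.2
  have hwre : w.re = s * (phi τ l A D ζ).re := by rw [hw, Complex.re_ofReal_mul]
  rw [eA, ← mul_sub, abs_mul, abs_of_pos (Real.exp_pos _)]
  have hE : Real.exp (τ/l*(c-π)) ≤ 1 := Real.exp_le_one_iff.2 (by
    have : 0 ≤ τ/l := div_nonneg h.t0 hl.le
    nlinarith)
  set C1 := Real.cos (τ * y)
  set C2 := Real.cos (l * Geo.hh (τ/l) (GG τ l A D s) c y)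
  set g := gam τ d l c
  have hw2 : ‖w‖^2 ≤ 256 * |s|^2 := by
    have := pow_le_pow_left₀ (norm_nonneg w) hwb.1 2
    nlinarith
  have key : |‖1+w‖ - (1 + s * (g * C2))| ≤ |s| * (8*M + (24*l + 256) * |s|) := by
    have e : ‖1+w‖ - (1 + s * (g * C2)) = (‖1+w‖ - 1 - w.re) + s * ((phi τ l A D ζ).re - g * C1) + s * (g * (C1 - C2)) := by
      rw [hwre]; ring
    have b1 : |s * ((phi τ l A D ζ).re - g * C1)| ≤ |s| * (8*M) := by rw [abs_mul]; gcongr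
    have b2 : |s * (g * (C1 - C2))| ≤ |s| * (1 * (24 * l * |s|)) := by rw [abs_mul, abs_mul]; gcongr
    rw [e]
    refine (abs_add_three _ _ _).trans ?_
    calc _ ≤ 256 * |s|^2 + |s| * (8*M) + |s| * (1 * (24 * l * |s|)) := by linarith
      _ = _ := by ring
  calc _ ≤ 1 * |‖1+w‖ - (1 + s * (g * C2))| := by gcongr
    _ ≤ _ := by rw [one_mul]; exact key

/-- comparison with the reference annulus -/
lemma asym' (h : Par τ l A D s) {d M c τ0 d0 : ℝ} (hd : |d| ≤ 2) (hA : ∀ k, |A k - one1 1 k| ≤ M) (hD : ∀ k, |D k - one1 d k| ≤ M)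
    (h0 : 0 ≤ c) (hπ : c ≤ π) (hτ0 : 0 ≤ τ0) (θ : ℝ) :
    |Real.exp (Geo.rho (τ/l) (GG τ l A D s) c θ) - Real.exp (τ0/l*(c-π)) * (1 + s * (gam τ0 d0 l c * Real.cos (l*θ)))| ≤
      |s| * (8*M + (24*l + 256) * |s|) + 8 * |τ - τ0| + |s| * |gam τ d l c - gam τ0 d0 l c| := by
  have h1 := h.asym hd hA hD h0 hπ θ
  have hl := h.lpos
  have hl4 : (4:ℝ) ≤ l := by exact_mod_cast h.l4
  have hg := gam_le (c := c) h.l4 h.t0 hd h0 hπ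
  have hc := Real.abs_cos_le_one (l*θ)
  have hexp : ∀ x y : ℝ, x ≤ 0 → y ≤ 0 → |Real.exp x - Real.exp y| ≤ |x - y| := by
    intro x y hx hy
    have := Convex.norm_image_sub_le_of_norm_deriv_le (f := Real.exp) (C := 1) (s := Set.Iic 0) (x := y) (y := x)
      (fun _ _ => Real.differentiableAt_exp) (fun t ht => by
        rw [Real.deriv_exp, Real.norm_of_nonneg (Real.exp_pos _).le]; exact Real.exp_le_one_iff.2 ht) (convex_Iic 0) hy hx
    simpa using this
  have hEE : |Real.exp (τ/l*(c-π)) - Real.exp (τ0/l*(c-π))| ≤ 4 * |τ - τ0| := by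
    have p1 : 0 ≤ τ/l := div_nonneg h.t0 hl.le
    have p2 : 0 ≤ τ0/l := div_nonneg hτ0 hl.le
    refine (hexp _ _ (by nlinarith) (by nlinarith)).trans ?_
    have e : τ/l*(c-π) - τ0/l*(c-π) = (τ - τ0) * ((c-π)/l) := by ring
    rw [e, abs_mul, mul_comm]
    have : |(c-π)/l| ≤ 4 := by
      rw [abs_div, abs_of_pos hl, div_le_iff₀ hl, abs_le]
      have := pi_lt_four
      constructor <;> nlinarith
    gcongr
  have hE0 : Real.exp (τ0/l*(c-π)) ≤ 1 := Real.exp_le_one_iff.2 (by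
    have : 0 ≤ τ0/l := div_nonneg hτ0 hl.le
    nlinarith)
  set E := Real.exp (τ/l*(c-π))
  set E0 := Real.exp (τ0/l*(c-π)) with hE0d
  set g := gam τ d l c
  set g0 := gam τ0 d0 l c
  set C := Real.cos (l*θ)
  have hs := h.s_bd
  have hgC : |g * C| ≤ 1 := by rw [abs_mul]; exact mul_le_one₀ hg (abs_nonneg _) hc
  have hb : |1 + s * (g * C)| ≤ 2 := by
    have := abs_add_le 1 (s * (g*C))
    rw [abs_mul, abs_one] at this
    nlinarith [abs_nonneg s, abs_nonneg (g*C)]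
  have e : Real.exp (Geo.rho (τ/l) (GG τ l A D s) c θ) - E0 * (1 + s * (g0 * C)) =
      (Real.exp (Geo.rho (τ/l) (GG τ l A D s) c θ) - E * (1 + s * (g * C))) + (E - E0) * (1 + s * (g * C)) + s * (E0 * ((g - g0) * C)) := by ring
  rw [e]
  refine (abs_add_three _ _ _).trans ?_
  have b2 : |(E - E0) * (1 + s * (g * C))| ≤ 4 * |τ - τ0| * 2 := by rw [abs_mul]; gcongr
  have b3 : |s * (E0 * ((g - g0) * C))| ≤ |s| * |g - g0| := by
    rw [abs_mul, abs_mul, abs_mul, abs_of_pos (Real.exp_pos _)]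
    have : E0 * (|g - g0| * |C|) ≤ 1 * (|g - g0| * 1) := by gcongr
    rw [one_mul, mul_one] at this
    gcongr
  linarith

end Par

end Schiffer
end

set_option linter.unusedSectionVars false
set_option linter.unusedSimpArgs false
noncomputable section
namespace Schiffer

/-! ### Final assembly -/

lemma one1_apply (d : ℝ) (f : L1 ℝ) (k : ℕ) : (sgl 1 d + sh f : L1 ℝ) k - one1 d k = sh f k := by
  have : (sgl 1 d + sh f : L1 ℝ) k = sgl 1 d k + sh f k := rfl
  rw [this, sgl_apply, one1]; ring

lemma sh_bd (f : L1 ℝ) (k : ℕ) : |sh f k| ≤ ‖f‖ := by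
  match k with
  | 0 => rw [sh_apply_zero]; simp
  | 1 => rw [sh_apply_one]; simp
  | k+2 => rw [sh_apply_add]; exact L1.norm_apply_le f k

lemma Ac_near (m : MT) (k : ℕ) : |Ac m k - one1 1 k| ≤ ‖m‖ := by
  rw [Ac, one1_apply]
  exact (sh_bd _ _).trans ((norm_fst_le m.2).trans (norm_snd_le m))

lemma Dc_near (z : ZT) (m : MT) (k : ℕ) : |Dc z m k - one1 z.2.2.1 k| ≤ ‖m‖ := by
  rw [Dc, one1_apply]
  exact (sh_bd _ _).trans ((norm_snd_le m.2).trans (norm_snd_le m))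

lemma near_bds {U : ET} (h : ‖U - (Zs, 0)‖ < 1/10) : |U.1.1 - 4| < 1/10 ∧ |U.1.2.1 - √3| < 1/10 ∧ |U.1.2.2.1 - 1| < 1/10 ∧ ‖U.2‖ < 1/10 := by
  have h1 : ‖U.1 - Zs‖ < 1/10 := (norm_fst_le (U - (Zs, 0))).trans_lt h
  have h2 : ‖U.2 - 0‖ < 1/10 := (norm_snd_le (U - (Zs, 0))).trans_lt h
  have h3 : ‖U.1.2 - Zs.2‖ < 1/10 := (norm_snd_le (U.1 - Zs)).trans_lt h1
  have h4 : ‖U.1.2.2 - Zs.2.2‖ < 1/10 := (norm_snd_le (U.1.2 - Zs.2)).trans_lt h3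
  refine ⟨(norm_fst_le (U.1 - Zs)).trans_lt h1, (norm_fst_le (U.1.2 - Zs.2)).trans_lt h3, (norm_fst_le (U.1.2.2 - Zs.2.2)).trans_lt h4, ?_⟩
  rwa [sub_zero] at h2

lemma near_tau {U : ET} (h : ‖U - (Zs, 0)‖ < 1/10) : 1 ≤ U.1.2.1 ∧ U.1.2.1 ≤ 2 := by
  have h1 := abs_lt.1 (near_bds h).2.1
  have h2 : (1.7:ℝ) < √3 := by rw [Real.lt_sqrt (by norm_num)]; norm_num
  have h3 : √3 < 1.8 := by rw [Real.sqrt_lt' (by norm_num)]; norm_num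
  constructor <;> linarith

lemma near_d {U : ET} (h : ‖U - (Zs, 0)‖ < 1/10) : |U.1.2.2.1| ≤ 11/10 := by
  have h1 := abs_lt.1 (near_bds h).2.2.1
  rw [abs_le]; constructor <;> linarith

lemma near_par {U : ET} {l : ℕ} {s : ℝ} (h : ‖U - (Zs, 0)‖ < 1/10) (hl : 4 ≤ l) (hs : 128 * |s| * l ≤ 1) :
    Par U.1.2.1 l (Ac U.2) (Dc U.1 U.2) s where
  t1 := (near_tau h).1
  t2 := (near_tau h).2
  l4 := hl
  A0 := by
    have : Ac U.2 0 - one1 1 0 = 0 := by rw [Ac, one1_apply, sh_apply_zero]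
    simpa [one1] using this
  hA := fun k => by
    have h1 := Ac_near U.2 k
    have h2 := (near_bds h).2.2.2
    have h3 : |one1 1 k| ≤ 1 := by unfold one1; split_ifs <;> norm_num
    have := abs_add_le (Ac U.2 k - one1 1 k) (one1 1 k)
    rw [sub_add_cancel] at this
    linarith
  hD := fun k => by
    have h1 := Dc_near U.1 U.2 k
    have h2 := (near_bds h).2.2.2
    have h3 : |one1 U.1.2.2.1 k| ≤ 11/10 := by
      unfold one1; split_ifs
      · exact near_d h
      · norm_num
    have := abs_add_le (Dc U.1 U.2 k - one1 U.1.2.2.1 k) (one1 U.1.2.2.1 k)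
    rw [sub_add_cancel] at this
    linarith
  hs := hs

lemma gam_ne {U : ET} {l : ℕ} (h : ‖U - (Zs, 0)‖ < 1/10) (hl : 4 ≤ l) : gam U.1.2.1 U.1.2.2.1 l 0 ≠ 0 ∧ gam U.1.2.1 U.1.2.2.1 l π ≠ 0 := by
  have hl' : (4:ℝ) ≤ l := by exact_mod_cast hl
  obtain ⟨t1, t2⟩ := near_tau h
  have hd := abs_lt.1 (near_bds h).2.2.1
  set τ := U.1.2.1
  set d := U.1.2.2.1
  have hx : Real.exp (-(τ*π)) ≤ 1/2 := by
    have h1 : Real.exp (-(τ*π)) ≤ Real.exp (-1) := Real.exp_le_exp.2 (by nlinarith [pi_gt_three])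
    have := Real.exp_neg_one_lt_d9
    linarith
  have hx0 := Real.exp_pos (-(τ*π))
  set x := Real.exp (-(τ*π))
  have n1 : (1-l:ℝ) ≠ 0 := by linarith
  have n2 : (1+l:ℝ) ≠ 0 := by linarith
  constructor
  · rw [gam, mul_zero, neg_zero, Real.exp_zero, sub_zero]
    intro hc
    have : 1*(1+l:ℝ) + d*x*(1-l) = 0 := by
      field_simp at hc
      linarith
    have h3 : d * x ≤ 11/10*(1/2) := mul_le_mul (by linarith) hx hx0.le (by norm_num)
    nlinarith
  · rw [gam, sub_self, mul_zero, neg_zero, Real.exp_zero, mul_one]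
    intro hc
    have : x*(1+l:ℝ) + d*(1-l) = 0 := by
      field_simp at hc
      linarith
    nlinarith

lemma main_asym {l : ℕ} (hl : 4 ≤ l) {s0 : ℝ} (hs0 : 0 < s0) {U : ℝ → ET} (hU : ∀ s, |s| < s0 → ‖U s - (Zs, 0)‖ < 1/10)
    (hU0 : (U 0).2 = 0) (hc : ContinuousAt U 0)
    (hτ : ∀ c > (0:ℝ), ∃ δ > (0:ℝ), ∀ s, |s| < δ → |(U s).1.2.1 - (U 0).1.2.1| ≤ c * |s|) {c : ℝ} (h0 : 0 ≤ c) (hπ : c ≤ π) :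
    ∀ e > (0:ℝ), ∃ δ > (0:ℝ), ∀ s, |s| < δ → ∀ θ,
      |Real.exp (Geo.rho ((U s).1.2.1/l) (GG (U s).1.2.1 l (Ac (U s).2) (Dc (U s).1 (U s).2) s) c θ) -
        Real.exp ((U 0).1.2.1/l*(c-π)) * (1 + s * (gam (U 0).1.2.1 (U 0).1.2.2.1 l c * Real.cos (l*θ)))| ≤ e * |s| := by
  intro e he
  have hl' : (4:ℝ) ≤ l := by exact_mod_cast hl
  obtain ⟨δ1, hδ1, H1⟩ := hτ (e/32) (by positivity)
  have c2 : ContinuousAt (fun s => ‖(U s).2‖) 0 := hc.snd.norm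
  have c3 : ContinuousAt (fun s => gam (U s).1.2.1 (U s).1.2.2.1 l c) 0 := by
    have d1 : ContinuousAt (fun s => (U s).1.2.1) 0 := hc.fst.snd.fst
    have d2 : ContinuousAt (fun s => (U s).1.2.2.1) 0 := hc.fst.snd.snd.fst
    unfold gam
    fun_prop
  obtain ⟨δ2, hδ2, H2⟩ := Metric.continuousAt_iff.1 c2 (e/32) (by positivity)
  obtain ⟨δ3, hδ3, H3⟩ := Metric.continuousAt_iff.1 c3 (e/4) (by positivity)
  have hp : 0 < e/4/(24*l+256) := by positivity
  have hq : (0:ℝ) < 1/(128*l) := by positivity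
  refine ⟨min s0 (min δ1 (min δ2 (min δ3 (min (e/4/(24*l+256)) (1/(128*l)))))), by positivity, fun s hs θ => ?_⟩
  simp only [lt_min_iff] at hs
  obtain ⟨i0, i1, i2, i3, i4, i5⟩ := hs
  have hn := hU s i0
  have hpar := near_par hn hl (s := s) (by
    rw [lt_div_iff₀ (by positivity)] at i5
    linarith)
  have a := hpar.asym' (d := (U s).1.2.2.1) (M := ‖(U s).2‖) (d0 := (U 0).1.2.2.1) (τ0 := (U 0).1.2.1) ((near_d hn).trans (by norm_num)) (Ac_near _) (Dc_near _ _) h0 hπ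
    (by have := (near_tau (hU 0 (by simpa using hs0))).1; linarith) θ
  refine a.trans ?_
  have b1 := H1 s i1
  have b2 := H2 (x := s) (by rw [Real.dist_eq, sub_zero]; exact i2)
  have b3 := H3 (x := s) (by rw [Real.dist_eq, sub_zero]; exact i3)
  rw [Real.dist_eq, hU0, norm_zero, sub_zero, abs_of_nonneg (norm_nonneg _)] at b2
  rw [Real.dist_eq] at b3
  rw [lt_div_iff₀ (by positivity)] at i4
  have b4 : |s| * (8*‖(U s).2‖ + (24*l + 256) * |s|) ≤ |s| * (e/4 + e/4) := by
    gcongr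
    · linarith
    · linarith
  have b5 : |s| * |gam (U s).1.2.1 (U s).1.2.2.1 l c - gam (U 0).1.2.1 (U 0).1.2.2.1 l c| ≤ |s| * (e/4) := by gcongr
  linarith

lemma exp_mul_eq {a g C ρ s e : ℝ} (hs : s ≠ 0) (h : |ρ - a * (1 + s * (g * C))| ≤ e * |s|) : |(ρ - a)/s - a * g * C| ≤ e := by
  have : (ρ - a)/s - a * g * C = (ρ - a * (1 + s * (g * C)))/s := by field_simp; ring
  rw [this, abs_div, div_le_iff₀ (abs_pos.2 hs)]
  exact h

theorem main : ∃ L : ℕ, 4 ≤ L ∧ ∀ l : ℕ, L ≤ l →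
      ∃ a ∈ Set.Ioo (0:ℝ) 1, ∃ α β : ℝ, α ≠ 0 ∧ β ≠ 0 ∧
        ∃ sl > (0:ℝ), ∃ b B : ℝ → ℝ → ℝ,
          (∀ s ∈ Set.Ioo (-sl) sl,
            AnalyticOnNhd ℝ (b s) Set.univ ∧ Function.Periodic (b s) (2*π) ∧
            AnalyticOnNhd ℝ (B s) Set.univ ∧ Function.Periodic (B s) (2*π)) ∧
          (∀ ε > (0:ℝ), ∃ δ > (0:ℝ), ∀ s : ℝ, |s| < δ → ∀ θ : ℝ,
            |b s θ - α * Real.cos (l * θ)| < ε ∧ |B s θ - β * Real.cos (l * θ)| < ε) ∧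
          (∀ s ∈ Set.Ioo (-sl) sl, ∀ Ω : Set Pt,
            Ω = {x | ∃ r θ : ℝ, a + s * b s θ < r ∧ r < 1 + s * B s θ ∧ x = polar r θ} →
            IsOpen Ω ∧ IsConnected Ω ∧ Bornology.IsBounded Ω ∧
            ∃ μ : ℝ, ∃ u : Pt → ℝ,
              ContDiffOn ℝ 2 u (closure Ω) ∧
              (∃ x ∈ closure Ω, ∃ y ∈ closure Ω, u x ≠ u y) ∧
              (∀ x ∈ Ω, lap u x + μ * u x = 0) ∧
              (∀ x ∈ frontier Ω, fderivWithin ℝ u (closure Ω) x = 0) ∧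
              (s ≠ 0 → ¬ ∃ g : ℝ → ℝ, ∀ x ∈ closure Ω, u x = g ‖x‖)) := by
  obtain ⟨ε0, hε0, H⟩ := thmA (1/10) (by norm_num)
  obtain ⟨N, hN⟩ := exists_nat_gt (1/ε0)
  refine ⟨max 4 N, le_max_left _ _, fun l hl => ?_⟩
  have hl4 : 4 ≤ l := (le_max_left _ _).trans hl
  have hl' : (4:ℝ) ≤ l := by exact_mod_cast hl4
  have hlp : (0:ℝ) < l := by linarith
  have hlN : (N:ℝ) ≤ l := by exact_mod_cast (le_max_right _ _).trans hl
  obtain ⟨s0, hs0, U, hU, hU0, hUc, hUτ⟩ := H (1/l) (by positivity) (by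
    rw [div_lt_iff₀ hlp]
    rw [div_lt_iff₀ hε0] at hN
    nlinarith)
  have hUn : ∀ s, |s| < s0 → ‖U s - (Zs, 0)‖ < 1/10 := fun s hs => (hU s hs).2
  have hU00 := hUn 0 (by simpa using hs0)
  have asy0 := main_asym hl4 hs0 hUn hU0 hUc hUτ le_rfl pi_pos.le
  have asyπ := main_asym hl4 hs0 hUn hU0 hUc hUτ pi_pos.le le_rfl
  obtain ⟨g0ne, gπne⟩ := gam_ne hU00 hl4
  obtain ⟨t1, t2⟩ := near_tau hU00
  set R : ℝ → ℝ → ℝ → ℝ := fun c s θ => Real.exp (Geo.rho ((U s).1.2.1/l) (GG (U s).1.2.1 l (Ac (U s).2) (Dc (U s).1 (U s).2) s) c θ) with hR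
  set a : ℝ := Real.exp ((U 0).1.2.1/l*(0-π)) with ha
  have ha1 : Real.exp ((U 0).1.2.1/l*(π-π)) = 1 := by rw [sub_self, mul_zero, Real.exp_zero]
  rw [ha1] at asyπ
  set g0 := gam (U 0).1.2.1 (U 0).1.2.2.1 l 0
  set gπ := gam (U 0).1.2.1 (U 0).1.2.2.1 l π
  have hapos : 0 < a := Real.exp_pos _
  have halt : a < 1 := by
    rw [ha, Real.exp_lt_one_iff]
    have : 0 < (U 0).1.2.1/l := div_pos (by linarith) hlp
    nlinarith [pi_pos]
  have hRa : ∀ θ, R 0 0 θ = a := by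
    intro θ
    obtain ⟨δ, hδ, h⟩ := asy0 1 one_pos
    have := h 0 (by simpa using hδ) θ
    rw [abs_zero, mul_zero, zero_mul, add_zero, mul_one] at this
    exact sub_eq_zero.1 (abs_nonpos_iff.1 this)
  have hR1 : ∀ θ, R π 0 θ = 1 := by
    intro θ
    obtain ⟨δ, hδ, h⟩ := asyπ 1 one_pos
    have := h 0 (by simpa using hδ) θ
    rw [abs_zero, mul_zero, zero_mul, add_zero, mul_one] at this
    exact sub_eq_zero.1 (abs_nonpos_iff.1 this)
  set b : ℝ → ℝ → ℝ := fun s θ => if s = 0 then a * g0 * Real.cos (l*θ) else (R 0 s θ - a)/s with hb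
  set B : ℝ → ℝ → ℝ := fun s θ => if s = 0 then 1 * gπ * Real.cos (l*θ) else (R π s θ - 1)/s with hB
  have limb : ∀ e > (0:ℝ), ∃ δ > (0:ℝ), ∀ s, |s| < δ → ∀ θ, |b s θ - a * g0 * Real.cos (l*θ)| < e := by
    intro e he
    obtain ⟨δ, hδ, h⟩ := asy0 (e/2) (by positivity)
    refine ⟨δ, hδ, fun s hs θ => ?_⟩
    by_cases h0 : s = 0
    · simp [hb, h0, he]
    · simp only [hb, if_neg h0]
      exact (exp_mul_eq h0 (h s hs θ)).trans_lt (by linarith)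
  have limB : ∀ e > (0:ℝ), ∃ δ > (0:ℝ), ∀ s, |s| < δ → ∀ θ, |B s θ - 1 * gπ * Real.cos (l*θ)| < e := by
    intro e he
    obtain ⟨δ, hδ, h⟩ := asyπ (e/2) (by positivity)
    refine ⟨δ, hδ, fun s hs θ => ?_⟩
    by_cases h0 : s = 0
    · simp [hB, h0, he]
    · simp only [hB, if_neg h0]
      exact (exp_mul_eq h0 (h s hs θ)).trans_lt (by linarith)
  have hbR : ∀ s θ, a + s * b s θ = R 0 s θ := by
    intro s θ
    by_cases h0 : s = 0
    · rw [h0, zero_mul, add_zero, hRa]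
    · simp only [hb, if_neg h0]; field_simp; ring
  have hBR : ∀ s θ, 1 + s * B s θ = R π s θ := by
    intro s θ
    by_cases h0 : s = 0
    · rw [h0, zero_mul, add_zero, hR1]
    · simp only [hB, if_neg h0]; field_simp; ring
  have hane : a * g0 ≠ 0 := mul_ne_zero hapos.ne' g0ne
  obtain ⟨δ1, hδ1, hnc⟩ := limb (|a*g0|/2) (by positivity)
  have hpar : ∀ s, |s| < s0 → |s| < 1/(128*l) → Par (U s).1.2.1 l (Ac (U s).2) (Dc (U s).1 (U s).2) s := by
    intro s h1 h2
    refine near_par (hUn s h1) hl4 ?_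
    rw [lt_div_iff₀ (by positivity)] at h2
    linarith
  have cosA : AnalyticOnNhd ℝ (fun θ : ℝ => Real.cos (l*θ)) univ := fun θ _ =>
    Real.analyticAt_cos.fun_comp (analyticAt_const.mul analyticAt_id)
  have cosP : Function.Periodic (fun θ : ℝ => Real.cos (l*θ)) (2*π) := by
    intro θ
    change Real.cos (l*(θ+2*π)) = _
    rw [mul_add]; exact Real.cos_add_nat_mul_two_pi _ _
  refine ⟨a, ⟨hapos, halt⟩, a * g0, 1 * gπ, hane, by simpa using gπne, min s0 (min δ1 (1/(128*l))), by positivity, b, B, ?_, ?_, ?_⟩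
  · intro s hs
    rw [Set.mem_Ioo, ← abs_lt, lt_min_iff, lt_min_iff] at hs
    have hg := (hpar s hs.1 hs.2.2).geo
    have an : ∀ c, 0 ≤ c → c ≤ π → AnalyticOnNhd ℝ (R c s) univ := fun c h1 h2 θ _ => (hg.rho_analytic h1 h2 θ).rexp
    have pr : ∀ c, Function.Periodic (R c s) (2*π) := fun c θ => by
      simp only [hR]; rw [hg.rho_per c θ]
    by_cases h0 : s = 0
    · have e1 : b s = fun θ => a * g0 * Real.cos (l*θ) := by funext θ; simp only [hb, if_pos h0]
      have e2 : B s = fun θ => 1 * gπ * Real.cos (l*θ) := by funext θ; simp only [hB, if_pos h0]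
      rw [e1, e2]
      refine ⟨analyticOnNhd_const.mul cosA, fun θ => ?_, analyticOnNhd_const.mul cosA, fun θ => ?_⟩
      · exact congrArg _ (cosP θ)
      · exact congrArg _ (cosP θ)
    · have e1 : b s = fun θ => (R 0 s θ - a)/s := by funext θ; simp only [hb, if_neg h0]
      have e2 : B s = fun θ => (R π s θ - 1)/s := by funext θ; simp only [hB, if_neg h0]
      rw [e1, e2]
      refine ⟨((an 0 le_rfl pi_pos.le).sub analyticOnNhd_const).div analyticOnNhd_const (fun _ _ => h0), fun θ => ?_,
        ((an π pi_pos.le le_rfl).sub analyticOnNhd_const).div analyticOnNhd_const (fun _ _ => h0), fun θ => ?_⟩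
      · change (R 0 s (θ+2*π) - a)/s = _
        rw [pr 0 θ]
      · change (R π s (θ+2*π) - 1)/s = _
        rw [pr π θ]
  · intro e he
    obtain ⟨d1, h1, k1⟩ := limb e he
    obtain ⟨d2, h2, k2⟩ := limB e he
    refine ⟨min d1 d2, lt_min h1 h2, fun s hs θ => ?_⟩
    rw [lt_min_iff] at hs
    exact ⟨k1 s hs.1 θ, k2 s hs.2 θ⟩
  · intro s hs Ω hΩ
    rw [Set.mem_Ioo, ← abs_lt, lt_min_iff, lt_min_iff] at hs
    have hp := hpar s hs.1 hs.2.2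
    have hg := hp.geo
    have hΩ' : Ω = Geo.Om ((U s).1.2.1/l) (GG (U s).1.2.1 l (Ac (U s).2) (Dc (U s).1 (U s).2) s) := by
      rw [hΩ]
      simp only [hbR, hBR]
      rfl
    obtain ⟨W, hW⟩ := thmB (s := s) (ε := 1/l) (z := (U s).1) (m := (U s).2) (hU s hs.1).1 hp.t1
    have hlam := abs_lt.1 (near_bds (hUn s hs.1)).1
    set κ := (U s).1.2.1/l with hκ
    have hκp : 0 < κ := hg.kpos
    set μ : ℝ := (U s).1.1 / (κ^2 * Real.exp (-(2*κ*π))) with hμ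
    have hμne : μ ≠ 0 := by
      have : 0 < (U s).1.1 := by linarith
      have := Real.exp_pos (-(2*κ*π))
      positivity
    have hC := hg.thmC W hμne (fun ζ => by rw [hp.lk]; exact hW.per ζ) hW.one hW.bx hW.bY (fun ζ h1 h2 => by
      rw [hp.FF_normSq h1 h2, ← hW.pde ζ h1 h2, ← hκ, hμ]
      have := Real.exp_pos (-(2*κ*π))
      field_simp)
    rw [hΩ']
    obtain ⟨c1, c2, c3, u, c4, c5, c6, c7, c8⟩ := hC
    refine ⟨c1, c2, c3, μ, u, c4, c5, c6, c7, fun hs0 => c8 ⟨0, π/l, fun hc => ?_⟩⟩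
    have e1 : b s 0 = b s (π/l) := by
      simp only [hb, if_neg hs0, hR]
      rw [← hκ, hc]
    have n1 := hnc s hs.2.1 0
    have n2 := hnc s hs.2.1 (π/l)
    rw [mul_div_cancel₀ _ hlp.ne', Real.cos_pi, ← e1] at n2
    rw [mul_zero, Real.cos_zero] at n1
    rw [abs_sub_comm] at n1
    have := abs_add_le (a*g0*1 - b s 0) (b s 0 - a*g0*(-1))
    have e3 : a*g0*1 - b s 0 + (b s 0 - a*g0*(-1)) = 2*(a*g0) := by ring
    rw [e3, abs_mul, abs_two] at this
    have := abs_pos.2 hane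
    linarith

end Schiffer
end

/-- There is an integer `L ≥ 4` such that for every `l ≥ L` there are
`a_l ∈ (0,1)`, nonzero constants `α_l, β_l`, `s_l > 0` and families of real-analytic
`2π`-periodic boundary perturbations `b_{l,s}, B_{l,s}` converging uniformly to
`α_l cos(lθ)`, `β_l cos(lθ)` as `s → 0`, such that each perturbed annular domain
carries a nonconstant Neumann eigenfunction which is locally constant on the boundary,
and which is non-radial for `s ≠ 0`. -/
theorem schiffer_type_annuli :
    ∃ L : ℕ, 4 ≤ L ∧ ∀ l : ℕ, L ≤ l →
      ∃ a ∈ Set.Ioo (0:ℝ) 1, ∃ α β : ℝ, α ≠ 0 ∧ β ≠ 0 ∧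
        ∃ sl > (0:ℝ), ∃ b B : ℝ → ℝ → ℝ,
          (∀ s ∈ Set.Ioo (-sl) sl,
            AnalyticOnNhd ℝ (b s) Set.univ ∧ Function.Periodic (b s) (2*π) ∧
            AnalyticOnNhd ℝ (B s) Set.univ ∧ Function.Periodic (B s) (2*π)) ∧
          (∀ ε > (0:ℝ), ∃ δ > (0:ℝ), ∀ s : ℝ, |s| < δ → ∀ θ : ℝ,
            |b s θ - α * Real.cos (l * θ)| < ε ∧ |B s θ - β * Real.cos (l * θ)| < ε) ∧
          (∀ s ∈ Set.Ioo (-sl) sl, ∀ Ω : Set Pt,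
            Ω = {x | ∃ r θ : ℝ, a + s * b s θ < r ∧ r < 1 + s * B s θ ∧ x = polar r θ} →
            IsOpen Ω ∧ IsConnected Ω ∧ Bornology.IsBounded Ω ∧
            ∃ μ : ℝ, ∃ u : Pt → ℝ,
              ContDiffOn ℝ 2 u (closure Ω) ∧
              (∃ x ∈ closure Ω, ∃ y ∈ closure Ω, u x ≠ u y) ∧
              (∀ x ∈ Ω, lap u x + μ * u x = 0) ∧
              (∀ x ∈ frontier Ω, fderivWithin ℝ u (closure Ω) x = 0) ∧
              (s ≠ 0 → ¬ ∃ g : ℝ → ℝ, ∀ x ∈ closure Ω, u x = g ‖x‖)) := by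
  exact Schiffer.main

end
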